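/- There exists a natural number N such that every integer n ≥ N can be written as n = x² + y² − z² for some integers x, y, z satisfying max(x², y², z²) ≤ n. -/

import Mathlib

/-- `w` lies in the continued fraction cylinder with last two convergents. -/
def Cyl (w : ℝ) (p' q' p q : ℕ) : Prop :=
  ((p : ℤ) * q' - p' * q) ^ 2 = 1 ∧ 1 ≤ q ∧ q' ≤ q ∧
    ∃ τ : ℝ, 0 < τ ∧ τ < 1 ∧ Irrational τ ∧ w * (q + q' * τ) = p + p' * τ

lemma cyl_step {w : ℝ} {p' q' p q : ℕ} (h : Cyl w p' q' p q) :
    ∃ d : ℕ, 1 ≤ d ∧ Cyl w p q (p' + d * p) (q' + d * q) ∧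
      |w - p / q| ≤ 1 / (q * ((q' + d * q : ℕ) : ℝ)) := by
  obtain ⟨hdet, hq, hqq, τ, h0, h1, hirr, hw⟩ := h
  have hinv : 1 < τ⁻¹ := (one_lt_inv₀ h0).2 h1
  have hd1 : 1 ≤ ⌊τ⁻¹⌋₊ := by
    rw [Nat.one_le_floor_iff]; exact hinv.le
  have hfl : ((⌊τ⁻¹⌋₊ : ℕ) : ℝ) ≤ τ⁻¹ := Nat.floor_le (by positivity)
  have hfl2 : τ⁻¹ < (⌊τ⁻¹⌋₊ : ℝ) + 1 := Nat.lt_floor_add_one _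
  have hirr' : Irrational τ⁻¹ := hirr.inv
  have hne : ((⌊τ⁻¹⌋₊ : ℕ) : ℝ) ≠ τ⁻¹ := fun h => hirr' ⟨(⌊τ⁻¹⌋₊ : ℕ), by simpa using h⟩
  generalize ⌊τ⁻¹⌋₊ = d at *
  have hq0 : (0 : ℝ) < q := by exact_mod_cast hq
  have hq0' : (0 : ℝ) ≤ q' := by positivity
  have hd0 : (1 : ℝ) ≤ d := by exact_mod_cast hd1
  have hττ : τ⁻¹ * τ = 1 := inv_mul_cancel₀ h0.ne'
  refine ⟨d, hd1, ⟨?_, ?_, ?_, τ⁻¹ - d, ?_, ?_, ?_, ?_⟩, ?_⟩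
  · rw [← hdet]; push_cast; ring
  · nlinarith
  · nlinarith
  · exact sub_pos.2 (lt_of_le_of_ne hfl hne)
  · linarith
  · exact hirr'.sub_natCast d
  · push_cast
    have := congrArg (fun t => τ⁻¹ * t) hw
    have e1 : τ⁻¹ * (w * (q + q' * τ)) = w * (q * τ⁻¹ + q' * (τ⁻¹ * τ)) := by ring
    have e2 : τ⁻¹ * ((p : ℝ) + p' * τ) = p * τ⁻¹ + p' * (τ⁻¹ * τ) := by ring
    rw [e1, e2, hττ] at this
    linear_combination this
  · have hden : 0 < (q : ℝ) + q' * τ := by positivity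
    have hdetR : ((p : ℝ) * q' - p' * q) ^ 2 = 1 := by exact_mod_cast hdet
    have habs : |(p : ℝ) * q' - p' * q| = 1 := by
      have := sq_abs ((p : ℝ) * q' - p' * q)
      rw [hdetR] at this
      nlinarith [abs_nonneg ((p : ℝ) * q' - p' * q)]
    have hw' : w - p / q = -((p : ℝ) * q' - p' * q) * (τ / (q * (q + q' * τ))) := by
      have : w = (p + p' * τ) / (q + q' * τ) := by
        rw [eq_div_iff hden.ne']; exact hw
      rw [this]; field_simp; ring
    rw [hw', abs_mul, abs_neg, habs, one_mul, abs_of_pos (by positivity)]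
    push_cast
    rw [div_le_div_iff₀ (by positivity) (by positivity)]
    have : (d : ℝ) * τ ≤ 1 := by
      calc (d : ℝ) * τ ≤ τ⁻¹ * τ := by gcongr
        _ = 1 := hττ
    nlinarith [mul_nonneg hq0.le hq0.le]

/-- number of cells hit -/
noncomputable def cells (w : ℕ → ℝ) (X : ℕ) (T : Finset ℕ) : ℝ :=
  ((T.image (fun a => ⌊w a * (X : ℝ) ^ 2⌋)).card : ℝ)

lemma cells_near (w : ℕ → ℝ) (X : ℕ) (T : Finset ℕ) (c δ : ℝ) (hδ : 0 ≤ δ)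
    (h : ∀ a ∈ T, |w a - c| ≤ δ) : cells w X T ≤ 2 * δ * X ^ 2 + 2 := by
  unfold cells
  have hsub : T.image (fun a => ⌊w a * (X : ℝ) ^ 2⌋) ⊆
      Finset.Icc ⌊(c - δ) * (X : ℝ) ^ 2⌋ ⌊(c + δ) * (X : ℝ) ^ 2⌋ := by
    intro k hk
    rw [Finset.mem_image] at hk
    obtain ⟨a, ha, rfl⟩ := hk
    have := abs_le.1 (h a ha)
    rw [Finset.mem_Icc]
    constructor <;> apply Int.floor_le_floor <;> gcongr <;> linarith
  have h1 := Finset.card_le_card hsub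
  rw [Int.card_Icc] at h1
  have h2 := Int.floor_le ((c + δ) * (X : ℝ) ^ 2)
  have h3 := Int.lt_floor_add_one ((c - δ) * (X : ℝ) ^ 2)
  have hmono : ⌊(c - δ) * (X : ℝ) ^ 2⌋ ≤ ⌊(c + δ) * (X : ℝ) ^ 2⌋ := by
    apply Int.floor_le_floor; gcongr; linarith
  have h4 : (((⌊(c + δ) * (X : ℝ) ^ 2⌋ + 1 - ⌊(c - δ) * (X : ℝ) ^ 2⌋).toNat : ℤ) : ℝ)
      = ((⌊(c + δ) * (X : ℝ) ^ 2⌋ + 1 - ⌊(c - δ) * (X : ℝ) ^ 2⌋ : ℤ) : ℝ) := by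
    rw [Int.toNat_of_nonneg (by omega)]
  have h5 : ((T.image (fun a => ⌊w a * (X : ℝ) ^ 2⌋)).card : ℝ) ≤
      (((⌊(c + δ) * (X : ℝ) ^ 2⌋ + 1 - ⌊(c - δ) * (X : ℝ) ^ 2⌋).toNat : ℤ) : ℝ) := by
    exact_mod_cast h1
  rw [h4] at h5
  push_cast at h5
  nlinarith

lemma cells_union (w : ℕ → ℝ) (X : ℕ) (S T : Finset ℕ) :
    cells w X (S ∪ T) ≤ cells w X S + cells w X T := by
  unfold cells
  rw [Finset.image_union]
  exact_mod_cast Finset.card_union_le _ _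

lemma cells_biUnion (w : ℕ → ℝ) (X : ℕ) (I : Finset ℕ) (T : ℕ → Finset ℕ) :
    cells w X (I.biUnion T) ≤ ∑ i ∈ I, cells w X (T i) := by
  unfold cells
  rw [Finset.biUnion_image]
  exact_mod_cast Finset.card_biUnion_le

lemma cells_mono (w : ℕ → ℝ) (X : ℕ) {S T : Finset ℕ} (h : S ⊆ T) :
    cells w X S ≤ cells w X T := by
  unfold cells
  exact_mod_cast Finset.card_le_card (Finset.image_subset_image h)

open Classical in
lemma one_step (w : ℕ → ℝ) (X : ℕ) (T : Finset ℕ) (p' q' p q : ℕ)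
    (hT : ∀ a ∈ T, Cyl (w a) p' q' p q) (hq : 1 ≤ q) (hqX : q ≤ X) :
    cells w X T ≤ 4 * (X / q) + ∑ d ∈ (Finset.Icc 1 X).filter (fun d => q' + d * q ≤ X),
      cells w X (T.filter (fun a => Cyl (w a) p q (p' + d * p) (q' + d * q))) := by
  have hq0 : (0 : ℝ) < q := by exact_mod_cast hq
  have hX0 : (0 : ℝ) < X := by exact_mod_cast (lt_of_lt_of_le hq hqX)
  have hsub : T ⊆ T.filter (fun a => |w a - p / q| ≤ 1 / (q * X)) ∪
      ((Finset.Icc 1 X).filter (fun d => q' + d * q ≤ X)).biUnion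
        (fun d => T.filter (fun a => Cyl (w a) p q (p' + d * p) (q' + d * q))) := by
    intro a ha
    obtain ⟨d, hd, hcyl, habs⟩ := cyl_step (hT a ha)
    rw [Finset.mem_union]
    by_cases hle : q' + d * q ≤ X
    · right
      rw [Finset.mem_biUnion]
      refine ⟨d, ?_, ?_⟩
      · simp only [Finset.mem_filter, Finset.mem_Icc]
        refine ⟨⟨hd, ?_⟩, hle⟩
        nlinarith
      · simp [ha, hcyl]
    · left
      simp only [Finset.mem_filter]
      refine ⟨ha, habs.trans ?_⟩
      have : (X : ℝ) ≤ ((q' + d * q : ℕ) : ℝ) := by exact_mod_cast (not_le.1 hle).le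
      gcongr
  refine (cells_mono w X hsub).trans ((cells_union _ _ _ _).trans ?_)
  refine add_le_add ?_ (cells_biUnion _ _ _ _)
  refine (cells_near w X _ (p / q) (1 / (q * X)) (by positivity) ?_).trans ?_
  · intro a ha
    exact (Finset.mem_filter.1 ha).2
  · have h1 : (1 : ℝ) ≤ X / q := by
      rw [le_div_iff₀ hq0, one_mul]; exact_mod_cast hqX
    have h2 : 2 * (1 / ((q : ℝ) * X)) * X ^ 2 = 2 * (X / q) := by
      field_simp
    rw [h2]; linarith


lemma tel_step {t h s : ℝ} (ht : 0 < t) (hh : 0 < h) (hs : 0 < s) :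
    s * h * (t + h) ^ (-(1 + s)) ≤ t ^ (-s) - (t + h) ^ (-s) := by
  have hth : 0 < t + h := by positivity
  have e1 : (t + h) ^ (-(1 + s)) = (t + h) ^ (-s) * (t + h)⁻¹ := by
    rw [← Real.rpow_neg_one, ← Real.rpow_add hth]; congr 1; ring
  have e2 : t ^ (-s) = (t + h) ^ (-s) * (t / (t + h)) ^ (-s) := by
    rw [← Real.mul_rpow hth.le (by positivity)]; congr 1; field_simp
  have hx : 0 < t / (t + h) := by positivity
  have e3 : 1 + s * (1 - t / (t + h)) ≤ (t / (t + h)) ^ (-s) := by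
    rw [Real.rpow_def_of_pos hx]
    have h1 := Real.add_one_le_exp (Real.log (t / (t + h)) * -s)
    have h2 := Real.log_le_sub_one_of_pos hx
    nlinarith
  have e4 : 1 - t / (t + h) = h * (t + h)⁻¹ := by field_simp; ring
  rw [e4] at e3
  rw [e1, e2]
  have hp : 0 < (t + h) ^ (-s) := Real.rpow_pos_of_pos hth _
  nlinarith

lemma tel_sum {m h s : ℝ} (hm : 0 < m) (hh : 0 < h) (hs : 0 < s) (J : ℕ) :
    s * h * ∑ j ∈ Finset.range J, (m + (j + 1) * h) ^ (-(1 + s)) ≤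
      m ^ (-s) - (m + J * h) ^ (-s) := by
  induction J with
  | zero => simp
  | succ J ih =>
    rw [Finset.sum_range_succ, mul_add]
    have := tel_step (t := m + J * h) (h := h) (s := s) (by positivity) hh hs
    have e : m + (J : ℝ) * h + h = m + (J + 1) * h := by ring
    rw [e] at this
    push_cast
    linarith

lemma two_rpow_bd : (2 : ℝ) ^ (-(0.9 : ℝ)) ≤ 0.54 := by
  have h : (2 : ℝ) ^ (-(0.9 : ℝ)) = ((2 : ℝ) ^ (-9 : ℝ)) ^ ((10 : ℝ)⁻¹) := by
    rw [← Real.rpow_mul (by norm_num)]; norm_num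
  rw [h]
  have h2 : (0.54 : ℝ) = ((0.54 : ℝ) ^ (10 : ℝ)) ^ ((10 : ℝ)⁻¹) := by
    rw [← Real.rpow_mul (by norm_num)]; norm_num
  rw [h2]
  apply Real.rpow_le_rpow (by positivity) _ (by norm_num)
  rw [show (-9 : ℝ) = ((-9 : ℤ) : ℝ) by norm_num, Real.rpow_intCast,
    show (10 : ℝ) = ((10 : ℕ) : ℝ) by norm_num, Real.rpow_natCast]
  norm_num

lemma two_rpow_bd' : (2 : ℝ) ^ (-(1.9 : ℝ)) ≤ 0.27 := by
  have h : (2 : ℝ) ^ (-(1.9 : ℝ)) = (2 : ℝ) ^ (-(0.9 : ℝ)) * (2 : ℝ) ^ (-1 : ℝ) := by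
    rw [← Real.rpow_add (by norm_num)]; norm_num
  have h2 : (2 : ℝ) ^ (-1 : ℝ) = 1 / 2 := by rw [Real.rpow_neg_one]; norm_num
  rw [h, h2]; linarith [two_rpow_bd]

lemma sum_zeta (N : ℕ) : ∑ d ∈ Finset.Icc 1 N, (d : ℝ) ^ (-(1.9 : ℝ)) ≤ 1.87 := by
  have h1 : ∑ d ∈ Finset.Icc 1 N, (d : ℝ) ^ (-(1.9 : ℝ)) ≤
      ∑ d ∈ Finset.range (N + 3), (if d = 0 then (0 : ℝ) else (d : ℝ) ^ (-(1.9 : ℝ))) := by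
    have : ∑ d ∈ Finset.Icc 1 N, (d : ℝ) ^ (-(1.9 : ℝ)) =
        ∑ d ∈ Finset.Icc 1 N, (if d = 0 then (0 : ℝ) else (d : ℝ) ^ (-(1.9 : ℝ))) := by
      apply Finset.sum_congr rfl
      intro d hd
      rw [if_neg]; have := (Finset.mem_Icc.1 hd).1; omega
    rw [this]
    apply Finset.sum_le_sum_of_subset_of_nonneg
    · intro d hd
      have := (Finset.mem_Icc.1 hd).2
      simp; omega
    · intro d _ _
      split_ifs
      · exact le_rfl
      · positivity
  refine h1.trans ?_
  rw [Finset.sum_range_succ', Finset.sum_range_succ', Finset.sum_range_succ']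
  have h2 := tel_sum (m := 2) (h := 1) (s := 0.9) (by norm_num) (by norm_num) (by norm_num) N
  have h3 : 0 ≤ (2 + (N : ℝ) * 1) ^ (-(0.9 : ℝ)) := by positivity
  have h4 : ∑ d ∈ Finset.range N, (if d + 1 + 1 + 1 = 0 then (0 : ℝ) else
      ((d + 1 + 1 + 1 : ℕ) : ℝ) ^ (-(1.9 : ℝ))) =
      ∑ j ∈ Finset.range N, (2 + ((j : ℝ) + 1) * 1) ^ (-(1 + (0.9 : ℝ))) := by
    apply Finset.sum_congr rfl
    intro d _
    rw [if_neg (by omega)]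
    congr 1
    · push_cast; ring
    · norm_num
  rw [h4]
  have h5 := two_rpow_bd
  have h6 := two_rpow_bd'
  norm_num at h2 h3 h5 h6 ⊢
  linarith

lemma sum_zeta_filter (N : ℕ) (P : ℕ → Prop) [DecidablePred P] :
    ∑ d ∈ (Finset.Icc 1 N).filter P, (d : ℝ) ^ (-(1.9 : ℝ)) ≤ 1.87 :=
  (Finset.sum_le_sum_of_subset_of_nonneg (Finset.filter_subset _ _)
    (fun _ _ _ => by positivity)).trans (sum_zeta N)

lemma sum_zeta_even (N : ℕ) (P : ℕ → Prop) [DecidablePred P] :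
    ∑ d ∈ (Finset.Icc 1 N).filter P, (if Even d then (d : ℝ) ^ (-(1.9 : ℝ)) else 0) ≤ 0.505 := by
  rw [← Finset.sum_filter]
  have hsub : ((Finset.Icc 1 N).filter P).filter (fun d => Even d) ⊆
      (Finset.Icc 1 N).image (fun d => 2 * d) := by
    intro d hd
    simp only [Finset.mem_filter, Finset.mem_Icc] at hd
    obtain ⟨⟨⟨h1, h2⟩, _⟩, k, hk⟩ := hd
    simp only [Finset.mem_image, Finset.mem_Icc]
    exact ⟨k, by omega, by omega⟩
  refine (Finset.sum_le_sum_of_subset_of_nonneg hsub (fun _ _ _ => by positivity)).trans ?_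
  rw [Finset.sum_image (by intro a _ b _ h; simpa using h)]
  have : ∀ d ∈ Finset.Icc 1 N, ((2 * d : ℕ) : ℝ) ^ (-(1.9 : ℝ)) =
      (2 : ℝ) ^ (-(1.9 : ℝ)) * (d : ℝ) ^ (-(1.9 : ℝ)) := by
    intro d _
    push_cast
    rw [Real.mul_rpow (by norm_num) (by positivity)]
  rw [Finset.sum_congr rfl this, ← Finset.mul_sum]
  have h0 : 0 ≤ ∑ d ∈ Finset.Icc 1 N, (d : ℝ) ^ (-(1.9 : ℝ)) :=
    Finset.sum_nonneg (fun _ _ => by positivity)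
  calc _ ≤ 0.27 * (1.87 : ℝ) := by
        apply mul_le_mul two_rpow_bd' (sum_zeta N) h0 (by norm_num)
    _ ≤ _ := by norm_num


lemma next_bd {X q q' d : ℕ} (hq : 1 ≤ q) (hd : 1 ≤ d) :
    ((X : ℝ) / ((q' + d * q : ℕ) : ℝ)) ^ (1.9 : ℝ) ≤
      ((X : ℝ) / q) ^ (1.9 : ℝ) * (d : ℝ) ^ (-(1.9 : ℝ)) := by
  have hq0 : (0 : ℝ) < q := by exact_mod_cast hq
  have hd0 : (0 : ℝ) < d := by exact_mod_cast hd
  rw [Real.rpow_neg hd0.le, ← Real.inv_rpow hd0.le, ← Real.mul_rpow (by positivity) (by positivity)]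
  apply Real.rpow_le_rpow (by positivity) _ (by norm_num)
  rw [← div_eq_mul_inv, div_div]
  push_cast
  gcongr
  nlinarith [Nat.cast_nonneg (α := ℝ) q']

lemma lin_bd {X q : ℕ} (hq : 1 ≤ q) (hqX : q ≤ X) :
    (X : ℝ) / q ≤ ((X : ℝ) / q) ^ (1.9 : ℝ) := by
  have hq0 : (0 : ℝ) < q := by exact_mod_cast hq
  have h1 : (1 : ℝ) ≤ X / q := by
    rw [le_div_iff₀ hq0, one_mul]; exact_mod_cast hqX
  exact Real.self_le_rpow_of_one_le h1 (by norm_num)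

open Classical in
/-- unconstrained one step bound -/
lemma one_step_bd (w : ℕ → ℝ) (X : ℕ) (T : Finset ℕ) (p' q' p q : ℕ)
    (hT : ∀ a ∈ T, Cyl (w a) p' q' p q) (hq : 1 ≤ q) (hqX : q ≤ X) (B : ℝ) (hB : 0 ≤ B)
    (hN : ∀ d, 1 ≤ d → q' + d * q ≤ X →
      cells w X (T.filter (fun a => Cyl (w a) p q (p' + d * p) (q' + d * q))) ≤
        B * ((X : ℝ) / ((q' + d * q : ℕ) : ℝ)) ^ (1.9 : ℝ)) :
    cells w X T ≤ (4 + 1.87 * B) * ((X : ℝ) / q) ^ (1.9 : ℝ) := by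
  refine (one_step w X T p' q' p q hT hq hqX).trans ?_
  have h1 := lin_bd hq hqX
  have hP : 0 ≤ ((X : ℝ) / q) ^ (1.9 : ℝ) := by positivity
  have h2 : ∑ d ∈ (Finset.Icc 1 X).filter (fun d => q' + d * q ≤ X),
      cells w X (T.filter (fun a => Cyl (w a) p q (p' + d * p) (q' + d * q))) ≤
      ∑ d ∈ (Finset.Icc 1 X).filter (fun d => q' + d * q ≤ X),
        (B * ((X : ℝ) / q) ^ (1.9 : ℝ)) * (d : ℝ) ^ (-(1.9 : ℝ)) := by
    apply Finset.sum_le_sum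
    intro d hd
    simp only [Finset.mem_filter, Finset.mem_Icc] at hd
    refine (hN d hd.1.1 hd.2).trans ?_
    rw [mul_assoc]
    exact mul_le_mul_of_nonneg_left (next_bd hq hd.1.1) hB
  rw [← Finset.mul_sum] at h2
  have h3 := mul_le_mul_of_nonneg_left
    (sum_zeta_filter X (fun d => q' + d * q ≤ X)) (mul_nonneg hB hP)
  nlinarith

def ParH (A : Finset ℕ) (w : ℕ → ℝ) (b : ℕ → ℤ) (R : ℕ) : Prop :=
  ∀ a ∈ A, ∀ p' q' p q : ℕ, Cyl (w a) p' q' p q → R ≤ q' → q' + R ≤ q →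
    Odd ((a : ℤ) * p' + b a * q' + (a * p + b a * q))

open Classical in
lemma U0 (A : Finset ℕ) (w : ℕ → ℝ) (b : ℕ → ℤ) (R X : ℕ) (H : ParH A w b R) :
    ∀ k : ℕ, ∀ (T : Finset ℕ) (p' q' p q : ℕ), X - q ≤ k → T ⊆ A →
      (∀ a ∈ T, Cyl (w a) p' q' p q) → 1 ≤ q → q ≤ X → 1 ≤ R → R ≤ q' → q' + R ≤ q →
      ((∀ a ∈ T, Odd ((a : ℤ) * p + b a * q)) → cells w X T ≤ 115.2 * ((X : ℝ) / q) ^ (1.9 : ℝ)) ∧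
      ((∀ a ∈ T, Even ((a : ℤ) * p + b a * q)) → cells w X T ≤ 220 * ((X : ℝ) / q) ^ (1.9 : ℝ)) := by
  intro k
  induction k using Nat.strong_induction_on with
  | _ k ih =>
  intro T p' q' p q hk hTA hT hq hqX hR hRq hqR
  have hP : 0 ≤ ((X : ℝ) / q) ^ (1.9 : ℝ) := by positivity
  have h1 := lin_bd hq hqX
  have hpar : ∀ a ∈ T, Odd ((a : ℤ) * p' + b a * q' + (a * p + b a * q)) := fun a ha =>
    H a (hTA ha) p' q' p q (hT a ha) hRq hqR
  constructor
  · intro hodd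
    refine (one_step w X T p' q' p q hT hq hqX).trans ?_
    have h2 : ∑ d ∈ (Finset.Icc 1 X).filter (fun d => q' + d * q ≤ X),
        cells w X (T.filter (fun a => Cyl (w a) p q (p' + d * p) (q' + d * q))) ≤
        ∑ d ∈ (Finset.Icc 1 X).filter (fun d => q' + d * q ≤ X),
          (220 * ((X : ℝ) / q) ^ (1.9 : ℝ)) * (if Even d then (d : ℝ) ^ (-(1.9 : ℝ)) else 0) := by
      apply Finset.sum_le_sum
      intro d hd
      simp only [Finset.mem_filter, Finset.mem_Icc] at hd
      have hge : q' + q ≤ q' + d * q := by nlinarith [hd.1.1]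
      have hev : ∀ a ∈ T.filter (fun a => Cyl (w a) p q (p' + d * p) (q' + d * q)),
          Even ((a : ℤ) * (p' + d * p : ℕ) + b a * (q' + d * q : ℕ)) := by
        intro a ha
        rw [Finset.mem_filter] at ha
        have e1 := H a (hTA ha.1) p q _ _ ha.2 (by omega) (by omega)
        have e2 := hodd a ha.1
        rwa [Int.odd_add, iff_true_left e2] at e1
      split_ifs with hde
      · have := (ih (X - (q' + d * q)) (by omega) (T.filter (fun a => Cyl (w a) p q (p' + d * p) (q' + d * q)))
          p q (p' + d * p) (q' + d * q) le_rfl ((Finset.filter_subset _ _).trans hTA)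
          (fun a ha => (Finset.mem_filter.1 ha).2) (by omega) hd.2 hR (by omega) (by omega)).2 hev
        refine this.trans ?_
        rw [mul_assoc]
        exact mul_le_mul_of_nonneg_left (next_bd hq hd.1.1) (by norm_num)
      · have : T.filter (fun a => Cyl (w a) p q (p' + d * p) (q' + d * q)) = ∅ := by
          rw [Finset.eq_empty_iff_forall_notMem]
          intro a ha
          have e3 := hev a ha
          rw [Finset.mem_filter] at ha
          have e1 := hpar a ha.1
          have e2 := hodd a ha.1
          have e0 : Even ((a : ℤ) * p' + b a * q') := by
            rw [Int.odd_add'] at e1; exact e1.1 e2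
          have e4 : (a : ℤ) * (p' + d * p : ℕ) + b a * (q' + d * q : ℕ) =
            ((a : ℤ) * p' + b a * q') + d * (a * p + b a * q) := by push_cast; ring
          rw [e4, Int.even_add, iff_true_left e0, Int.even_mul] at e3
          rcases e3 with e3 | e3
          · exact hde (by exact_mod_cast e3)
          · exact (Int.not_even_iff_odd.2 e2) e3
        rw [this]; simp [cells]
    rw [← Finset.mul_sum] at h2
    have h3 := mul_le_mul_of_nonneg_left
      (sum_zeta_even X (fun d => q' + d * q ≤ X)) (mul_nonneg (by norm_num : (0:ℝ) ≤ 220) hP)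
    nlinarith
  · intro heven
    have := one_step_bd w X T p' q' p q hT hq hqX 115.2 (by norm_num) (by
      intro d hd1 hd2
      have hge : q' + q ≤ q' + d * q := by nlinarith
      refine (ih (X - (q' + d * q)) (by omega) (T.filter (fun a => Cyl (w a) p q (p' + d * p) (q' + d * q)))
          p q (p' + d * p) (q' + d * q) le_rfl ((Finset.filter_subset _ _).trans hTA)
          (fun a ha => (Finset.mem_filter.1 ha).2) (by omega) hd2 hR (by omega) (by omega)).1 ?_
      intro a ha
      rw [Finset.mem_filter] at ha
      have e1 := H a (hTA ha.1) p q _ _ ha.2 (by omega) (by omega)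
      rw [Int.odd_add'] at e1
      exact e1.2 (heven a ha.1))
    nlinarith

open Classical in
lemma U0' (A : Finset ℕ) (w : ℕ → ℝ) (b : ℕ → ℤ) (R X : ℕ) (H : ParH A w b R)
    (T : Finset ℕ) (p' q' p q : ℕ) (hTA : T ⊆ A)
    (hT : ∀ a ∈ T, Cyl (w a) p' q' p q) (hq : 1 ≤ q) (hqX : q ≤ X) (hR : 1 ≤ R) (h1 : R ≤ q')
    (h2 : q' + R ≤ q) : cells w X T ≤ 336 * ((X : ℝ) / q) ^ (1.9 : ℝ) := by
  have hP : 0 ≤ ((X : ℝ) / q) ^ (1.9 : ℝ) := by positivity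
  have e : T = T.filter (fun a : ℕ => Odd ((a : ℤ) * p + b a * q)) ∪
      T.filter (fun a : ℕ => ¬ Odd ((a : ℤ) * p + b a * q)) := by
    rw [Finset.filter_union_filter_not_eq]
  have a1 := (U0 A w b R X H _ (T.filter (fun a : ℕ => Odd ((a : ℤ) * p + b a * q))) p' q' p q le_rfl
    ((Finset.filter_subset _ _).trans hTA) (fun a ha => hT a (Finset.mem_filter.1 ha).1) hq hqX hR
    h1 h2).1 (fun a ha => (Finset.mem_filter.1 ha).2)
  have a2 := (U0 A w b R X H _ (T.filter (fun a : ℕ => ¬ Odd ((a : ℤ) * p + b a * q))) p' q' p q le_rfl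
    ((Finset.filter_subset _ _).trans hTA) (fun a ha => hT a (Finset.mem_filter.1 ha).1) hq hqX hR
    h1 h2).2 (fun a ha => Int.not_odd_iff_even.1 (Finset.mem_filter.1 ha).2)
  rw [e]
  refine (cells_union _ _ _ _).trans ?_
  nlinarith

open Classical in
lemma U1 (A : Finset ℕ) (w : ℕ → ℝ) (b : ℕ → ℤ) (R X : ℕ) (H : ParH A w b R)
    (T : Finset ℕ) (p' q' p q : ℕ) (hTA : T ⊆ A)
    (hT : ∀ a ∈ T, Cyl (w a) p' q' p q) (hq : 1 ≤ q) (hqX : q ≤ X) (hR : 1 ≤ R) (h1 : R ≤ q')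
    (h2 : q' ≤ q) : cells w X T ≤ 640 * ((X : ℝ) / q) ^ (1.9 : ℝ) := by
  have hP : 0 ≤ ((X : ℝ) / q) ^ (1.9 : ℝ) := by positivity
  have := one_step_bd w X T p' q' p q hT hq hqX 336 (by norm_num) (by
    intro d hd1 hd2
    have hge : q' + q ≤ q' + d * q := by nlinarith
    exact U0' A w b R X H _ p q _ _ ((Finset.filter_subset _ _).trans hTA)
      (fun a ha => (Finset.mem_filter.1 ha).2) (by omega) hd2 hR (by omega) (by omega))
  nlinarith

open Classical in
lemma U2 (A : Finset ℕ) (w : ℕ → ℝ) (b : ℕ → ℤ) (R X : ℕ) (H : ParH A w b R)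
    (T : Finset ℕ) (p' q' p q : ℕ) (hTA : T ⊆ A)
    (hT : ∀ a ∈ T, Cyl (w a) p' q' p q) (hq : 1 ≤ q) (hqX : q ≤ X) (hR : 1 ≤ R) (h1 : R ≤ q) :
    cells w X T ≤ 1300 * ((X : ℝ) / q) ^ (1.9 : ℝ) := by
  have hP : 0 ≤ ((X : ℝ) / q) ^ (1.9 : ℝ) := by positivity
  have := one_step_bd w X T p' q' p q hT hq hqX 640 (by norm_num) (by
    intro d hd1 hd2
    have hge : q' + q ≤ q' + d * q := by nlinarith
    exact U1 A w b R X H _ p q _ _ ((Finset.filter_subset _ _).trans hTA)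
      (fun a ha => (Finset.mem_filter.1 ha).2) (by omega) hd2 hR (by omega) (by omega))
  nlinarith

lemma tele_lo (q' q : ℕ) (hq : 1 ≤ q) (d0 : ℕ) (hd0 : 1 ≤ d0) :
    ∑ d ∈ Finset.Ico 1 d0, 1 / (((q' + d * q : ℕ) : ℝ) * (((q' + d * q : ℕ) : ℝ) + q)) =
      1 / q * (1 / ((q' : ℝ) + q) - 1 / (q' + d0 * q)) := by
  have hq0 : (0 : ℝ) < q := by exact_mod_cast hq
  induction d0, hd0 using Nat.le_induction with
  | base => simp
  | succ k hk ih =>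
    rw [Finset.sum_Ico_succ_top hk, ih]
    have hk0 : (0 : ℝ) < k := by exact_mod_cast hk
    have h1 : (0 : ℝ) < q' + k * q := by positivity
    have h2 : (0 : ℝ) < q' + (k + 1) * q := by positivity
    push_cast
    have h3 : (q' : ℝ) + (k + 1) * q = q' + k * q + q := by ring
    rw [h3] at h2 ⊢
    field_simp
    ring

lemma U3_fin {m X R q : ℝ} (hm0 : 0 < m) (hX0 : 0 < X) (hR0 : 0 < R) (hq0 : 0 < q) (hmR : R ≤ m)
    (hm2 : m ≤ 2 * R) (hqR : q ≤ R) (hRX : R ≤ X) :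
    1300 * X ^ (1.9 : ℝ) * (m ^ (-(1.9 : ℝ)) + m ^ (-(0.9 : ℝ)) / (0.9 * q))
      + 4 * (X / q) ≤ 6000 * X ^ (1.9 : ℝ) * R ^ (0.1 : ℝ) * (1 / q * (1 / m)) := by
  have e1 : m ^ (-(1.9 : ℝ)) = m ^ (0.1 : ℝ) / m ^ 2 := by
    rw [eq_div_iff (by positivity), ← Real.rpow_natCast, ← Real.rpow_add hm0]; norm_num
  have e2 : m ^ (-(0.9 : ℝ)) = m ^ (0.1 : ℝ) / m := by
    rw [eq_div_iff (by positivity)]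
    nth_rw 2 [← Real.rpow_one m]
    rw [← Real.rpow_add hm0]; norm_num
  have e3 : m ^ (0.1 : ℝ) ≤ 2 * (R : ℝ) ^ (0.1 : ℝ) := by
    calc m ^ (0.1 : ℝ) ≤ (2 * (R : ℝ)) ^ (0.1 : ℝ) :=
          Real.rpow_le_rpow hm0.le hm2 (by norm_num)
      _ = 2 ^ (0.1 : ℝ) * (R : ℝ) ^ (0.1 : ℝ) := Real.mul_rpow (by norm_num) hR0.le
      _ ≤ 2 * (R : ℝ) ^ (0.1 : ℝ) := by
          gcongr
          exact Real.rpow_le_self_of_one_le (by norm_num) (by norm_num)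
  have e4 : (X : ℝ) * R ≤ (X : ℝ) ^ (1.9 : ℝ) * (R : ℝ) ^ (0.1 : ℝ) := by
    have : (R : ℝ) = (R : ℝ) ^ (0.9 : ℝ) * (R : ℝ) ^ (0.1 : ℝ) := by
      rw [← Real.rpow_add hR0]; norm_num
    have h2 : (X : ℝ) ^ (1.9 : ℝ) = X * (X : ℝ) ^ (0.9 : ℝ) := by
      nth_rw 2 [← Real.rpow_one (X : ℝ)]
      rw [← Real.rpow_add hX0]; norm_num
    have h3 : (R : ℝ) ^ (0.9 : ℝ) ≤ (X : ℝ) ^ (0.9 : ℝ) :=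
      Real.rpow_le_rpow hR0.le hRX (by norm_num)
    rw [h2]
    calc (X : ℝ) * R = X * ((R : ℝ) ^ (0.9 : ℝ) * (R : ℝ) ^ (0.1 : ℝ)) := by rw [← this]
      _ ≤ X * ((X : ℝ) ^ (0.9 : ℝ) * (R : ℝ) ^ (0.1 : ℝ)) := by gcongr
      _ = _ := by ring
  have hqm : (q : ℝ) ≤ m := by
    linarith
  rw [e1, e2]
  set Y := (X : ℝ) ^ (1.9 : ℝ) with hY
  set r := (R : ℝ) ^ (0.1 : ℝ) with hr
  set z := m ^ (0.1 : ℝ) with hz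
  have hY0 : 0 < Y := by positivity
  have hz0 : 0 < z := by positivity
  have g1 : z / m ^ 2 ≤ 2 * r / (q * m) := by
    rw [div_le_div_iff₀ (by positivity) (by positivity)]
    calc z * (q * m) ≤ (2 * r) * (m * m) := by gcongr
      _ = _ := by ring
  have g2 : z / m / (0.9 * q) ≤ 2.3 * r / (q * m) := by
    rw [div_div, div_le_div_iff₀ (by positivity) (by positivity)]
    have : 0 < m * q := by positivity
    nlinarith
  have g3 : 4 * ((X : ℝ) / q) ≤ 8 * Y * r / (q * m) := by
    rw [← mul_div_assoc, div_le_div_iff₀ (by positivity) (by positivity)]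
    have : (X : ℝ) * m ≤ 2 * (Y * r) := by nlinarith
    nlinarith
  calc _ ≤ 1300 * Y * (2 * r / (q * m) + 2.3 * r / (q * m)) + 8 * Y * r / (q * m) := by gcongr
    _ = 5598 * Y * r / (q * m) := by ring
    _ ≤ 6000 * Y * r / (q * m) := by gcongr; norm_num
    _ = _ := by field_simp

open Classical in
lemma U3 (A : Finset ℕ) (w : ℕ → ℝ) (b : ℕ → ℤ) (R X : ℕ) (H : ParH A w b R) (hRX : R ≤ X) :
    ∀ k : ℕ, ∀ (T : Finset ℕ) (p' q' p q : ℕ), 2 * R - (q + q') ≤ k → T ⊆ A →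
      (∀ a ∈ T, Cyl (w a) p' q' p q) → 1 ≤ q → q < R → q' ≤ q →
      cells w X T ≤ 6000 * (X : ℝ) ^ (1.9 : ℝ) * (R : ℝ) ^ (0.1 : ℝ) / (q * (q + q')) := by
  intro k
  induction k using Nat.strong_induction_on with
  | _ k ih =>
  intro T p' q' p q hk hTA hT hq hqR hqq
  have hex : ∃ d, R ≤ q' + d * q := ⟨R, by nlinarith⟩
  obtain ⟨d0, hd0, hmin⟩ : ∃ d0, R ≤ q' + d0 * q ∧ ∀ d, d < d0 → q' + d * q < R :=
    ⟨Nat.find hex, Nat.find_spec hex, fun d hd => not_le.1 (Nat.find_min hex hd)⟩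
  have hd01 : 1 ≤ d0 := by
    rcases Nat.eq_zero_or_pos d0 with h | h
    · subst h; omega
    · exact h
  set K : ℝ := 6000 * (X : ℝ) ^ (1.9 : ℝ) * (R : ℝ) ^ (0.1 : ℝ) with hK
  have hK0 : 0 ≤ K := by positivity
  set I := (Finset.Icc 1 X).filter (fun d => q' + d * q ≤ X) with hI
  set N : ℕ → ℝ := fun d =>
    cells w X (T.filter (fun a => Cyl (w a) p q (p' + d * p) (q' + d * q))) with hN
  have hN0 : ∀ d, 0 ≤ N d := fun d => by simp [hN, cells]
  have hstep := one_step w X T p' q' p q hT hq (by omega)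
  have hq0 : (0 : ℝ) < q := by exact_mod_cast hq
  have hR0 : (0 : ℝ) < R := by exact_mod_cast (by omega : 0 < R)
  have hX0 : (0 : ℝ) < X := by exact_mod_cast (by omega : 0 < X)
  set m : ℝ := q' + d0 * q with hm
  have hmR : (R : ℝ) ≤ m := by rw [hm]; exact_mod_cast hd0
  have hm0 : 0 < m := by linarith
  have hm2 : m ≤ 2 * R := by
    have := hmin (d0 - 1) (by omega)
    have e : q' + d0 * q = q' + (d0 - 1) * q + q := by
      obtain ⟨e, rfl⟩ : ∃ e, d0 = e + 1 := ⟨d0 - 1, by omega⟩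
      simp; ring
    have : q' + d0 * q ≤ 2 * R := by omega
    rw [hm]; exact_mod_cast this
  have hlo : ∑ d ∈ I.filter (fun d => d < d0), N d ≤
      K * (1 / q * (1 / ((q' : ℝ) + q) - 1 / m)) := by
    rw [hm, ← tele_lo q' q hq d0 hd01, Finset.mul_sum]
    refine (Finset.sum_le_sum_of_subset_of_nonneg (t := Finset.Ico 1 d0) ?_
      (fun d _ _ => hN0 d)).trans (Finset.sum_le_sum ?_)
    · intro d hd
      simp only [hI, Finset.mem_filter, Finset.mem_Icc] at hd
      simp only [Finset.mem_Ico]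
      omega
    · intro d hd
      simp only [Finset.mem_Ico] at hd
      have hge : q' + q ≤ q' + d * q := by nlinarith [hd.1]
      have hlt := hmin d hd.2
      have := ih (2 * R - (q' + d * q + q)) (by omega)
        (T.filter (fun a => Cyl (w a) p q (p' + d * p) (q' + d * q))) p q (p' + d * p) (q' + d * q)
        le_rfl ((Finset.filter_subset _ _).trans hTA) (fun a ha => (Finset.mem_filter.1 ha).2)
        (by omega) hlt (by omega)
      rw [mul_one_div]
      exact this
  have hhi : ∑ d ∈ I.filter (fun d => ¬ d < d0), N d ≤
      1300 * (X : ℝ) ^ (1.9 : ℝ) * (m ^ (-(1.9 : ℝ)) + m ^ (-(0.9 : ℝ)) / (0.9 * q)) := by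
    have e1 : ∑ d ∈ I.filter (fun d => ¬ d < d0), N d ≤
        ∑ d ∈ I.filter (fun d => ¬ d < d0),
          1300 * (X : ℝ) ^ (1.9 : ℝ) * ((q' : ℝ) + d * q) ^ (-(1.9 : ℝ)) := by
      apply Finset.sum_le_sum
      intro d hd
      simp only [hI, Finset.mem_filter, Finset.mem_Icc, not_lt] at hd
      have hge : q' + q ≤ q' + d * q := by nlinarith [hd.1.1.1]
      have hge2 : q' + d0 * q ≤ q' + d * q := by nlinarith [hd.2]
      have := U2 A w b R X H (T.filter (fun a => Cyl (w a) p q (p' + d * p) (q' + d * q)))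
        p q (p' + d * p) (q' + d * q)
        ((Finset.filter_subset _ _).trans hTA) (fun a ha => (Finset.mem_filter.1 ha).2)
        (by omega) hd.1.2 (by omega) (by omega)
      refine this.trans (le_of_eq ?_)
      push_cast
      rw [mul_assoc, Real.div_rpow hX0.le (by positivity), Real.rpow_neg (by positivity)]
      rfl
    refine e1.trans ?_
    rw [← Finset.mul_sum]
    apply mul_le_mul_of_nonneg_left _ (by positivity)
    have hsub : I.filter (fun d => ¬ d < d0) ⊆ (Finset.range (X + 1)).image (fun j => d0 + j) := by
      intro d hd
      simp only [hI, Finset.mem_filter, Finset.mem_Icc, not_lt] at hd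
      simp only [Finset.mem_image, Finset.mem_range]
      exact ⟨d - d0, by omega, by omega⟩
    refine (Finset.sum_le_sum_of_subset_of_nonneg hsub (fun _ _ _ => by positivity)).trans ?_
    rw [Finset.sum_image (by intro a _ b _ h; simpa using h), Finset.sum_range_succ', add_comm]
    apply add_le_add
    · simp [hm]
    · have ht := tel_sum (m := m) (h := q) (s := 0.9) hm0 hq0 (by norm_num) X
      have hp : 0 ≤ (m + X * q) ^ (-(0.9 : ℝ)) := by positivity
      rw [le_div_iff₀ (by positivity)]
      have e2 : ∑ j ∈ Finset.range X, ((q' : ℝ) + ((d0 + (j + 1) : ℕ) : ℝ) * q) ^ (-(1.9 : ℝ)) =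
          ∑ j ∈ Finset.range X, (m + ((j : ℝ) + 1) * q) ^ (-(1 + (0.9 : ℝ))) := by
        apply Finset.sum_congr rfl
        intro j _
        congr 1
        · rw [hm]; push_cast; ring
        · norm_num
      rw [e2]
      linarith
  have hsplit := Finset.sum_filter_add_sum_filter_not I (fun d => d < d0) N
  have hfin := U3_fin hm0 hX0 hR0 hq0 hmR hm2 (by exact_mod_cast hqR.le) (by exact_mod_cast hRX)
  have hgoal : K / (q * (q + q')) = K * (1 / q * (1 / ((q' : ℝ) + q) - 1 / m)) + K * (1 / q * (1 / m)) := by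
    have : 0 < (q' : ℝ) + q := by positivity
    rw [add_comm (q : ℝ) q']
    field_simp
    ring
  rw [hgoal]
  rw [← hK] at hfin
  change cells w X T ≤ 4 * ((X : ℝ) / q) + ∑ d ∈ I, N d at hstep
  calc cells w X T ≤ 4 * ((X : ℝ) / q) + ∑ d ∈ I, N d := hstep
    _ ≤ _ := by rw [← hsplit]; linarith

lemma cover_bound (A : Finset ℕ) (w : ℕ → ℝ) (b : ℕ → ℤ) (R X : ℕ) (H : ParH A w b R)
    (hRX : R ≤ X) (hR : 2 ≤ R) (hw : ∀ a ∈ A, 0 < w a ∧ w a < 1 ∧ Irrational (w a)) :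
    cells w X A ≤ 6000 * (X : ℝ) ^ (1.9 : ℝ) * (R : ℝ) ^ (0.1 : ℝ) := by
  have := U3 A w b R X H hRX _ A 1 0 0 1 le_rfl (Finset.Subset.refl _) (by
    intro a ha
    obtain ⟨h0, h1, h2⟩ := hw a ha
    exact ⟨by norm_num, le_rfl, by norm_num, w a, h0, h1, h2, by simp⟩) le_rfl (by omega) (by omega)
  simpa using this


lemma sol_of_form {n A B Y : ℤ} (h1 : Y ^ 2 - A * B = n) (h2 : A * B < 0)
    (h3 : (A + B + 2 * Y) * (A + B - 2 * Y) ≤ 0) (h4 : Even (A + B)) :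
    ∃ x y z : ℤ, n = x ^ 2 + y ^ 2 - z ^ 2 ∧ x ^ 2 ≤ n ∧ y ^ 2 ≤ n ∧ z ^ 2 ≤ n := by
  obtain ⟨z, hz⟩ := h4
  obtain rfl : A = 2 * z - B := by omega
  refine ⟨z - B, Y, z, ?_, ?_, ?_, ?_⟩ <;> nlinarith

lemma form_par (a b y p q : ℤ) : Even ((a * p ^ 2 + 2 * y * p * q - b * q ^ 2) - (a * p + b * q)) := by
  have e : (a * p ^ 2 + 2 * y * p * q - b * q ^ 2) - (a * p + b * q) =
    a * (p * (p - 1)) + 2 * (y * p * q) - b * (q * (q - 1)) - 2 * (b * q) := by ring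
  rw [e]
  have h1 : Even (p * (p - 1)) := Int.even_mul_pred_self p
  have h2 : Even (q * (q - 1)) := Int.even_mul_pred_self q
  exact ((((h1.mul_left a)).add (even_two_mul _)).sub (h2.mul_left b)).sub (even_two_mul _)

set_option maxHeartbeats 1600000 in
lemma parH_of_noSol (n : ℕ) (A : Finset ℕ) (w : ℕ → ℝ) (b y : ℕ → ℤ) (R X : ℕ)
    (hns : ¬ ∃ x y z : ℤ, (n : ℤ) = x ^ 2 + y ^ 2 - z ^ 2 ∧ x ^ 2 ≤ n ∧ y ^ 2 ≤ n ∧ z ^ 2 ≤ n)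
    (hA : ∀ a ∈ A, 1 ≤ a ∧ a ≤ X ^ 2 ∧ y a ^ 2 + a * b a = n ∧ w a = (√(n : ℝ) - y a) / a)
    (hR1 : 1 ≤ R) (hR : (X : ℝ) ^ 2 ≤ √(n : ℝ) * R ^ 2) : ParH A w b R := by
  intro a ha p' q' p q hcyl hq1 hq2
  by_contra hodd
  rw [Int.not_odd_iff_even] at hodd
  apply hns
  obtain ⟨ha1, haX, hab, hw⟩ := hA a ha
  obtain ⟨hdet, hq, hqq, τ, h0, h1, hirr, hwt⟩ := hcyl
  set s := √(n : ℝ) with hs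
  have hs2 : s ^ 2 = n := Real.sq_sqrt (by positivity)
  have hs0 : 0 ≤ s := Real.sqrt_nonneg _
  have ha0 : (0 : ℝ) < a := by exact_mod_cast ha1
  have haw : (a : ℝ) * w a = s - y a := by rw [hw]; field_simp
  have habR : (y a : ℝ) ^ 2 + a * b a = n := by exact_mod_cast hab
  have haR : (a : ℝ) ≤ s * R ^ 2 := le_trans (by exact_mod_cast haX) hR
  set Den : ℝ := q + q' * τ with hDen
  set ε : ℝ := (p : ℝ) * q' - p' * q with hε
  have hε2 : ε ^ 2 = 1 := by rw [hε]; exact_mod_cast hdet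
  have hR0 : (1 : ℝ) ≤ R := by exact_mod_cast hR1
  have hq'R : (R : ℝ) ≤ q' := by exact_mod_cast hq1
  have hqR : (q' : ℝ) + R ≤ q := by exact_mod_cast hq2
  have hDq : (q : ℝ) ≤ Den := by
    rw [hDen]; exact le_add_of_nonneg_right (by positivity)
  have hD0 : 0 < Den := by linarith
  have hb1 : ((p : ℝ) - w a * q) * Den = ε * τ := by rw [hε]; linear_combination (-(q : ℝ)) * hwt
  have hb2 : ((p' : ℝ) - w a * q') * Den = -ε := by rw [hε]; linear_combination (-(q' : ℝ)) * hwt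
  have hs_pos : 0 < s := by
    rcases hs0.lt_or_eq with h | h
    · exact h
    · rw [← h, zero_mul] at haR; linarith
  -- general evaluation
  have hform : ∀ P Q : ℝ, a * P ^ 2 + 2 * y a * P * Q - b a * Q ^ 2 =
      (P - w a * Q) * (a * (P - w a * Q) + 2 * s * Q) := by
    intro P Q
    have hbb : (b a : ℝ) = w a * (s + y a) := by
      have : (a : ℝ) * b a = a * (w a * (s + y a)) := by
        rw [← mul_assoc, haw]; linear_combination habR - hs2
      exact mul_left_cancel₀ ha0.ne' this
    rw [hbb]
    linear_combination (2 * P * Q - w a * Q ^ 2) * haw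
  set FA : ℤ := a * p ^ 2 + 2 * y a * p * q - b a * q ^ 2 with hFA
  set FB : ℤ := a * p' ^ 2 + 2 * y a * p' * q' - b a * q' ^ 2 with hFB
  set FY : ℤ := a * p * p' + y a * (p * q' + p' * q) - b a * q * q' with hFY
  have hεabs : -1 ≤ ε ∧ ε ≤ 1 := abs_le.1 (by
    exact (sq_le_one_iff_abs_le_one ε).1 hε2.le)
  have hRD : (R : ℝ) ^ 2 * 2 ≤ R * Den := by
    have h2R : 2 * (R : ℝ) ≤ Den := by linarith
    calc (R : ℝ) ^ 2 * 2 = R * (2 * R) := by ring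
      _ ≤ R * Den := mul_le_mul_of_nonneg_left h2R (by linarith)
  have hFAr : (FA : ℝ) * Den ^ 2 = (ε * τ) * (a * (ε * τ) + 2 * s * q * Den) := by
    have := hform p q
    rw [hFA]; push_cast; rw [this, ← hb1]; ring
  have hFBr : (FB : ℝ) * Den ^ 2 = (-ε) * (a * (-ε) + 2 * s * q' * Den) := by
    have := hform p' q'
    rw [hFB]; push_cast; rw [this, ← hb2]; ring
  have hFPr : ((FA + FB + 2 * FY : ℤ) : ℝ) * Den ^ 2 =
      (ε * τ - ε) * (a * (ε * τ - ε) + 2 * s * (q + q') * Den) := by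
    have := hform (p + p') (q + q')
    have e : ((FA + FB + 2 * FY : ℤ) : ℝ) = a * ((p : ℝ) + p') ^ 2 +
      2 * y a * ((p : ℝ) + p') * (q + q') - b a * ((q : ℝ) + q') ^ 2 := by
      rw [hFA, hFB, hFY]; push_cast; ring
    have e2 : ((p : ℝ) + p' - w a * (q + q')) * Den = ε * τ - ε := by linear_combination hb1 + hb2
    rw [e, this, ← e2]; ring
  have hFMr : ((FA + FB - 2 * FY : ℤ) : ℝ) * Den ^ 2 =
      (ε * τ + ε) * (a * (ε * τ + ε) + 2 * s * (q - q') * Den) := by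
    have := hform (p - p') (q - q')
    have e : ((FA + FB - 2 * FY : ℤ) : ℝ) = a * ((p : ℝ) - p') ^ 2 +
      2 * y a * ((p : ℝ) - p') * (q - q') - b a * ((q : ℝ) - q') ^ 2 := by
      rw [hFA, hFB, hFY]; push_cast; ring
    have e2 : ((p : ℝ) - p' - w a * (q - q')) * Den = ε * τ + ε := by linear_combination hb1 - hb2
    rw [e, this, ← e2]; ring
  have key : ∀ Q c : ℝ, (R : ℝ) ≤ Q → -2 ≤ c → 0 < a * c + 2 * s * Q * Den := by
    intro Q c hQ hc
    have g1 : s * (R ^ 2 * 2) ≤ s * (Q * Den) := by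
      apply mul_le_mul_of_nonneg_left _ hs0
      exact hRD.trans (mul_le_mul_of_nonneg_right hQ hD0.le)
    have g2 : (a : ℝ) * (-2) ≤ a * c := mul_le_mul_of_nonneg_left hc ha0.le
    have g3 : 2 * s * Q * Den = 2 * (s * (Q * Den)) := by ring
    rw [g3]
    linarith
  have hετ : -1 ≤ ε * τ ∧ ε * τ ≤ 1 := by
    rw [← abs_le, abs_mul, abs_of_pos h0]
    calc |ε| * τ ≤ 1 * 1 := mul_le_mul (abs_le.2 hεabs) h1.le h0.le zero_le_one
      _ = 1 := one_mul 1
  have k1 := key q (ε * τ) (by linarith) (by linarith)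
  have k2 := key q' (-ε) (by linarith) (by linarith)
  have k3 := key (q + q') (ε * τ - ε) (by linarith) (by linarith)
  have k4 := key (q - q') (ε * τ + ε) (by linarith) (by linarith)
  apply sol_of_form (A := FA) (B := FB) (Y := FY)
  · have hdet' : ((p : ℤ) * q' - p' * q) ^ 2 = 1 := hdet
    have : FY ^ 2 - FA * FB = (y a ^ 2 + a * b a) * ((p : ℤ) * q' - p' * q) ^ 2 := by
      rw [hFA, hFB, hFY]; ring
    rw [this, hdet', hab, mul_one]
  · have : ((FA : ℝ) * FB) * (Den ^ 2 * Den ^ 2) < 0 := by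
      have e : ((FA : ℝ) * FB) * (Den ^ 2 * Den ^ 2) =
        -(ε ^ 2 * τ * ((a * (ε * τ) + 2 * s * q * Den) * (a * (-ε) + 2 * s * q' * Den))) := by
        rw [show ((FA : ℝ) * FB) * (Den ^ 2 * Den ^ 2) = (FA * Den ^ 2) * (FB * Den ^ 2) by ring,
          hFAr, hFBr]; ring
      rw [e, hε2, one_mul, neg_lt_zero]
      exact mul_pos h0 (mul_pos k1 k2)
    have h5 : ((FA : ℝ) * FB) < 0 := by
      by_contra hcon
      push Not at hcon
      have : 0 ≤ ((FA : ℝ) * FB) * (Den ^ 2 * Den ^ 2) := mul_nonneg hcon (by positivity)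
      linarith
    exact_mod_cast h5
  · have : (((FA + FB + 2 * FY : ℤ) : ℝ) * ((FA + FB - 2 * FY : ℤ) : ℝ)) * (Den ^ 2 * Den ^ 2) ≤ 0 := by
      have e : (((FA + FB + 2 * FY : ℤ) : ℝ) * ((FA + FB - 2 * FY : ℤ) : ℝ)) * (Den ^ 2 * Den ^ 2) =
        -(ε ^ 2 * (1 - τ ^ 2) * ((a * (ε * τ - ε) + 2 * s * (q + q') * Den) *
          (a * (ε * τ + ε) + 2 * s * (q - q') * Den))) := by
        rw [show (((FA + FB + 2 * FY : ℤ) : ℝ) * ((FA + FB - 2 * FY : ℤ) : ℝ)) * (Den ^ 2 * Den ^ 2) =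
          (((FA + FB + 2 * FY : ℤ) : ℝ) * Den ^ 2) * (((FA + FB - 2 * FY : ℤ) : ℝ) * Den ^ 2) by ring,
          hFPr, hFMr]; ring
      rw [e, hε2, one_mul, neg_nonpos]
      exact mul_nonneg (sub_nonneg.2 (pow_le_one₀ h0.le h1.le)) (mul_pos k3 k4).le
    have h5 : ((FA + FB + 2 * FY : ℤ) : ℝ) * ((FA + FB - 2 * FY : ℤ) : ℝ) ≤ 0 := by
      by_contra hcon
      push Not at hcon
      have : 0 < (((FA + FB + 2 * FY : ℤ) : ℝ) * ((FA + FB - 2 * FY : ℤ) : ℝ)) *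
        (Den ^ 2 * Den ^ 2) := mul_pos hcon (by positivity)
      linarith
    exact_mod_cast h5
  · have e1 := form_par a (b a) (y a) p q
    have e2 := form_par a (b a) (y a) p' q'
    have e3 := (e1.add e2).add hodd
    have e4 : FA + FB = (FA - (a * p + b a * q)) + (FB - (a * p' + b a * q')) +
      ((a : ℤ) * p' + b a * q' + (a * p + b a * q)) := by ring
    rw [e4]
    exact e3


lemma divisor_bound (ε : ℝ) (hε : 0 < ε) : ∃ C : ℝ, 1 ≤ C ∧ ∀ m : ℕ, m ≠ 0 →
    (m.divisors.card : ℝ) ≤ C * (m : ℝ) ^ ε := by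
  set K : ℝ := 1 + 1 / (ε * Real.log 2) with hK
  have hl2 : 0 < Real.log 2 := Real.log_pos (by norm_num)
  have hK1 : 1 ≤ K := by
    have : 0 < 1 / (ε * Real.log 2) := by positivity
    linarith
  set P : ℕ := ⌈(2 : ℝ) ^ (1 / ε)⌉₊ with hP
  refine ⟨K ^ P, one_le_pow₀ hK1, ?_⟩
  intro m hm
  rw [Nat.card_divisors hm]
  have hm' : (m : ℝ) ^ ε = ∏ p ∈ m.primeFactors, ((p : ℝ) ^ ε) ^ (m.factorization p) := by
    conv_lhs => rw [← Nat.prod_factorization_pow_eq_self hm]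
    rw [Finsupp.prod, Nat.support_factorization]
    push_cast
    rw [← Real.finsetProd_rpow _ _ (fun i _ => by positivity)]
    apply Finset.prod_congr rfl
    intro p _
    rw [← Real.rpow_natCast, ← Real.rpow_mul (by positivity), ← Real.rpow_natCast,
      ← Real.rpow_mul (by positivity), mul_comm]
  have hc : ∏ p ∈ m.primeFactors, (if p < P then K else 1) ≤ K ^ P := by
    rw [Finset.prod_ite, Finset.prod_const, Finset.prod_const_one, mul_one]
    apply pow_le_pow_right₀ hK1
    calc (m.primeFactors.filter (fun p => p < P)).card ≤ (Finset.range P).card := by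
          apply Finset.card_le_card
          intro p hp
          simpa using (Finset.mem_filter.1 hp).2
      _ = P := by simp
  push_cast
  calc ∏ p ∈ m.primeFactors, ((m.factorization p : ℝ) + 1)
      ≤ ∏ p ∈ m.primeFactors, ((if p < P then K else 1) * ((p : ℝ) ^ ε) ^ (m.factorization p)) := by
        apply Finset.prod_le_prod
        · intro p _; positivity
        · intro p hp
          have hp2 : (2 : ℝ) ≤ p := by exact_mod_cast (Nat.prime_of_mem_primeFactors hp).two_le
          set v := m.factorization p
          split_ifs with h
          · have h1 : 1 + v * (ε * Real.log 2) ≤ ((p : ℝ) ^ ε) ^ v := by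
              calc 1 + v * (ε * Real.log 2) ≤ Real.exp (v * (ε * Real.log 2)) := by
                    linarith [Real.add_one_le_exp (v * (ε * Real.log 2))]
                _ = ((2 : ℝ) ^ ε) ^ v := by
                    rw [Real.rpow_def_of_pos (by norm_num), ← Real.exp_nat_mul]; ring_nf
                _ ≤ _ := by gcongr
            have hc0 : 0 < ε * Real.log 2 := by positivity
            have h2 : (v : ℝ) + 1 ≤ K * (1 + v * (ε * Real.log 2)) := by
              have : K * (1 + v * (ε * Real.log 2)) =
                1 + v + v * (ε * Real.log 2) + 1 / (ε * Real.log 2) := by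
                rw [hK]; field_simp; ring
              rw [this]
              have : 0 ≤ (v : ℝ) * (ε * Real.log 2) := by positivity
              have : 0 < 1 / (ε * Real.log 2) := by positivity
              linarith
            exact h2.trans (mul_le_mul_of_nonneg_left h1 (by linarith))
          · rw [one_mul]
            push Not at h
            have h1 : (2 : ℝ) ^ (1 / ε) ≤ p := (Nat.le_ceil _).trans (by exact_mod_cast h)
            have h2 : (2 : ℝ) ≤ (p : ℝ) ^ ε := by
              calc (2 : ℝ) = ((2 : ℝ) ^ (1 / ε)) ^ ε := by
                    rw [← Real.rpow_mul (by norm_num)]; field_simp; simp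
                _ ≤ _ := by gcongr
            have h3 : (v : ℝ) + 1 ≤ 2 ^ v := by exact_mod_cast Nat.lt_two_pow_self
            exact h3.trans (by gcongr)
    _ = (∏ p ∈ m.primeFactors, (if p < P then K else 1)) * (m : ℝ) ^ ε := by
        rw [Finset.prod_mul_distrib, hm']
    _ ≤ _ := by gcongr


lemma dvd_cg {a b c : ℤ} (h : a ∣ b) (e : c = b) : a ∣ c := e ▸ h

lemma minor_core {m D h W U W' U' W0 U0 : ℤ} (hm : m ≠ 0)
    (c1 : IsCoprime W U) (c0 : IsCoprime W0 U0)
    (e1 : m ∣ W ^ 2 - D * U ^ 2) (e2 : m ∣ W' ^ 2 - D * U' ^ 2) (e0 : m ∣ W0 ^ 2 - D * U0 ^ 2)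
    (hg : Int.gcd m (W * U0 - W0 * U) = Int.gcd m (W' * U0 - W0 * U'))
    (hh : ∀ c : ℤ, c ∣ m → c ∣ 4 * D → c ∣ 4 * h) :
    m ∣ 4 * h * (W * U' - W' * U) := by
  obtain ⟨k1, hk1⟩ := e1
  obtain ⟨k2, hk2⟩ := e2
  obtain ⟨k0, hk0⟩ := e0
  set E : ℤ := (Int.gcd m (W * U0 - W0 * U) : ℤ) with hE
  have hE0 : E ≠ 0 := by
    rw [hE]; exact_mod_cast fun h => hm (Int.gcd_eq_zero_iff.1 h).1
  have hEm : E ∣ m := Int.gcd_dvd_left _ _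
  have hEX : E ∣ W * U0 - W0 * U := Int.gcd_dvd_right _ _
  have hEX' : E ∣ W' * U0 - W0 * U' := by rw [hE, hg]; exact Int.gcd_dvd_right _ _
  obtain ⟨m2, hm2⟩ := hEm
  obtain ⟨X2, hX2⟩ := hEX
  obtain ⟨X2', hX2'⟩ := hEX'
  have cop : IsCoprime m2 X2 := by
    rw [Int.isCoprime_iff_gcd_eq_one]
    have : Int.gcd m (W * U0 - W0 * U) = E.natAbs * Int.gcd m2 X2 := by
      conv_lhs => rw [hX2, hm2]
      exact Int.gcd_mul_left _ _ _
    have h2 : E.natAbs = Int.gcd m (W * U0 - W0 * U) := by rw [hE]; simp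
    rw [← h2] at this
    have h3 : E.natAbs ≠ 0 := by simpa using hE0
    exact (Nat.eq_of_mul_eq_mul_left (Nat.pos_of_ne_zero h3) (by rw [mul_one]; exact this.symm))
  have cop' : IsCoprime m2 X2' := by
    rw [Int.isCoprime_iff_gcd_eq_one]
    have : Int.gcd m (W' * U0 - W0 * U') = E.natAbs * Int.gcd m2 X2' := by
      conv_lhs => rw [hX2', hm2]
      exact Int.gcd_mul_left _ _ _
    have h2 : E.natAbs = Int.gcd m (W' * U0 - W0 * U') := by rw [← hg, hE]; simp
    rw [← h2] at this
    have h3 : E.natAbs ≠ 0 := by simpa using hE0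
    exact (Nat.eq_of_mul_eq_mul_left (Nat.pos_of_ne_zero h3) (by rw [mul_one]; exact this.symm))
  have hY : m2 ∣ W * U0 + W0 * U := by
    apply cop.dvd_of_dvd_mul_left
    refine ⟨k1 * U0 ^ 2 - k0 * U ^ 2, ?_⟩
    apply mul_left_cancel₀ hE0
    calc E * (X2 * (W * U0 + W0 * U)) = (E * X2) * (W * U0 + W0 * U) := by ring
      _ = (E * m2) * (k1 * U0 ^ 2 - k0 * U ^ 2) := by
        rw [← hX2, ← hm2]; linear_combination U0 ^ 2 * hk1 - U ^ 2 * hk0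
      _ = _ := by ring
  have hY' : m2 ∣ W' * U0 + W0 * U' := by
    apply cop'.dvd_of_dvd_mul_left
    refine ⟨k2 * U0 ^ 2 - k0 * U' ^ 2, ?_⟩
    apply mul_left_cancel₀ hE0
    calc E * (X2' * (W' * U0 + W0 * U')) = (E * X2') * (W' * U0 + W0 * U') := by ring
      _ = (E * m2) * (k2 * U0 ^ 2 - k0 * U' ^ 2) := by
        rw [← hX2', ← hm2]; linear_combination U0 ^ 2 * hk2 - U' ^ 2 * hk0
      _ = _ := by ring
  obtain ⟨u, v, huv⟩ := c0
  have d1 : E ∣ W * U' - W' * U := by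
    have a1 : E ∣ U0 * (W * U' - W' * U) := by
      have := (Dvd.intro _ hX2.symm).mul_left U' |>.sub ((Dvd.intro _ hX2'.symm).mul_left U)
      exact dvd_cg this (by ring)
    have a2 : E ∣ W0 * (W * U' - W' * U) := by
      have := (Dvd.intro _ hX2.symm).mul_left W' |>.sub ((Dvd.intro _ hX2'.symm).mul_left W)
      exact dvd_cg this (by ring)
    have := (a2.mul_left u).add (a1.mul_left v)
    exact dvd_cg this (by linear_combination (-(W * U' - W' * U)) * huv)
  have d2 : m2 ∣ W * U' - W' * U := by
    have a1 : m2 ∣ U0 * (W * U' - W' * U) := by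
      have := (hY.mul_left U').sub (hY'.mul_left U)
      exact dvd_cg this (by ring)
    have a2 : m2 ∣ W0 * (W * U' - W' * U) := by
      have := (hY'.mul_left W).sub (hY.mul_left W')
      exact dvd_cg this (by ring)
    have := (a2.mul_left u).add (a1.mul_left v)
    exact dvd_cg this (by linear_combination (-(W * U' - W' * U)) * huv)
  set c : ℤ := (Int.gcd E m2 : ℤ) with hc
  have hcE : c ∣ E := Int.gcd_dvd_left _ _
  have hcm2 : c ∣ m2 := Int.gcd_dvd_right _ _
  have hcm : c ∣ m := hm2 ▸ hcE.mul_right _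
  have hlcm : (Int.lcm E m2 : ℤ) ∣ W * U' - W' * U := Int.coe_lcm_dvd d1 d2
  have hmc : m ∣ c * (W * U' - W' * U) := by
    have e : c * (Int.lcm E m2 : ℤ) = |m| := by
      rw [hc, ← Nat.cast_mul, Int.gcd_mul_lcm, hm2, Int.abs_eq_natAbs,
        Int.natAbs_mul]
    have := mul_dvd_mul_left c hlcm
    rw [e, abs_dvd] at this
    exact this
  have copU : ∀ {W U k : ℤ}, IsCoprime W U → W ^ 2 - D * U ^ 2 = m * k → IsCoprime c U := by
    intro W U k h1 h2
    have h3 : IsCoprime (W ^ 2 - D * U ^ 2) U := by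
      have h4 : IsCoprime (W ^ 2) U := h1.pow_left
      have : W ^ 2 - D * U ^ 2 = W ^ 2 + U * (-(D * U)) := by ring
      rw [this]
      exact h4.add_mul_left_left _
    apply IsCoprime.of_isCoprime_of_dvd_left h3
    rw [h2]; exact hcm.mul_right _
  have hcop1 := copU c1 hk1
  have hcop0 := copU (⟨u, v, huv⟩ : IsCoprime W0 U0) hk0
  have f1 : c ∣ 2 * W := by
    apply hcop0.dvd_of_dvd_mul_right
    have := (hcE.trans (Dvd.intro _ hX2.symm)).add (hcm2.trans hY)
    exact dvd_cg this (by ring)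
  have f2 : c ∣ 4 * D := by
    have g1 : c ∣ 4 * D * U ^ 2 := by
      have := (f1.mul_right (2 * W)).sub ((hcm.mul_right k1).mul_left 4)
      exact dvd_cg this (by linear_combination (-4 : ℤ) * hk1)
    exact (hcop1.pow_right).dvd_of_dvd_mul_right g1
  have f3 := hh c hcm f2
  exact hmc.trans (mul_dvd_mul_right f3 _)

lemma gcd_hh (d e c : ℤ) (h1 : c ∣ e) (h2 : c ∣ 4 * d) : c ∣ 4 * (Int.gcd d e : ℤ) := by
  have : c ∣ (Int.gcd (4 * d) (4 * e) : ℤ) := Int.dvd_coe_gcd h2 (h1.mul_left 4)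
  rw [Int.gcd_mul_left] at this
  simpa using this

lemma minor_e {d e W U A W' U' A' W0 U0 A0 : ℤ} {g : ℕ} (he : e ≠ 0) (hg0 : g ≠ 0)
    (h1 : W ^ 2 = e * A ^ 2 + d * U ^ 2) (h2 : W' ^ 2 = e * A' ^ 2 + d * U' ^ 2)
    (h0 : W0 ^ 2 = e * A0 ^ 2 + d * U0 ^ 2)
    (p1 : Int.gcd (Int.gcd W U) A = 1) 
    (g1 : Int.gcd W U = g) (g2 : Int.gcd W' U' = g) (g0 : Int.gcd W0 U0 = g)
    (hk : Int.gcd e (W * U0 - W0 * U) = Int.gcd e (W' * U0 - W0 * U')) :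
    e ∣ 4 * (Int.gcd d e : ℤ) * (W * U' - W' * U) := by
  have split : ∀ {W U : ℤ}, Int.gcd W U = g → ∃ w u : ℤ, W = g * w ∧ U = g * u ∧ IsCoprime w u := by
    intro W U h
    obtain ⟨w, hw⟩ : (g : ℤ) ∣ W := h ▸ Int.gcd_dvd_left _ _
    obtain ⟨u, hu⟩ : (g : ℤ) ∣ U := h ▸ Int.gcd_dvd_right _ _
    refine ⟨w, u, hw, hu, ?_⟩
    rw [Int.isCoprime_iff_gcd_eq_one]
    rw [hw, hu, Int.gcd_mul_left, Int.natAbs_natCast] at h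
    exact Nat.eq_of_mul_eq_mul_left (Nat.pos_of_ne_zero hg0) (by rw [h, mul_one])
  obtain ⟨w, u, rfl, rfl, c1⟩ := split g1
  obtain ⟨w', u', rfl, rfl, c2⟩ := split g2
  obtain ⟨w0, u0, rfl, rfl, c0⟩ := split g0
  have hgz : (g : ℤ) ≠ 0 := by exact_mod_cast hg0
  have hg2 : (g : ℤ) ^ 2 ≠ 0 := pow_ne_zero _ hgz
  rw [g1] at p1
  have hge : (g : ℤ) ^ 2 ∣ e := by
    have hc : IsCoprime ((g : ℤ) ^ 2) (A ^ 2) :=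
      (Int.isCoprime_iff_gcd_eq_one.2 p1).pow
    apply hc.dvd_of_dvd_mul_right
    exact ⟨w ^ 2 - d * u ^ 2, by linear_combination -h1⟩
  obtain ⟨m, rfl⟩ := hge
  have hm : m ≠ 0 := right_ne_zero_of_mul he
  have key := minor_core (m := m) (D := d) (h := (Int.gcd d ((g : ℤ) ^ 2 * m) : ℤ)) (W := w) (U := u)
    (W' := w') (U' := u') (W0 := w0) (U0 := u0) hm c1 c0
    ⟨A ^ 2, mul_left_cancel₀ hg2 (by linear_combination h1)⟩
    ⟨A' ^ 2, mul_left_cancel₀ hg2 (by linear_combination h2)⟩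
    ⟨A0 ^ 2, mul_left_cancel₀ hg2 (by linear_combination h0)⟩
    (by
      have e1 : (g : ℤ) * w * (g * u0) - g * w0 * (g * u) = g ^ 2 * (w * u0 - w0 * u) := by ring
      have e2 : (g : ℤ) * w' * (g * u0) - g * w0 * (g * u') = g ^ 2 * (w' * u0 - w0 * u') := by ring
      rw [e1, e2, Int.gcd_mul_left, Int.gcd_mul_left] at hk
      exact Nat.eq_of_mul_eq_mul_left (by positivity) hk)
    (fun c hc1 hc2 => gcd_hh d _ c (hc1.mul_left _) hc2)
  have := mul_dvd_mul_left ((g : ℤ) ^ 2) key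
  exact dvd_cg this (by ring)

lemma det_dvd {d e W1 U1 A1 W2 U2 A2 W3 U3 A3 : ℤ}
    (a12 : e ∣ 4 * (Int.gcd d e : ℤ) * (W1 * U2 - W2 * U1))
    (a13 : e ∣ 4 * (Int.gcd d e : ℤ) * (W1 * U3 - W3 * U1))
    (a23 : e ∣ 4 * (Int.gcd d e : ℤ) * (W2 * U3 - W3 * U2))
    (b12 : d ∣ 4 * (Int.gcd d e : ℤ) * (W1 * A2 - W2 * A1))
    (b13 : d ∣ 4 * (Int.gcd d e : ℤ) * (W1 * A3 - W3 * A1))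
    (b23 : d ∣ 4 * (Int.gcd d e : ℤ) * (W2 * A3 - W3 * A2)) :
    d * e ∣ 4 * (Int.gcd d e : ℤ) ^ 2 *
      (A1 * (W2 * U3 - W3 * U2) - A2 * (W1 * U3 - W3 * U1) + A3 * (W1 * U2 - W2 * U1)) := by
  set h : ℤ := (Int.gcd d e : ℤ) with hh
  set D := (A1 * (W2 * U3 - W3 * U2) - A2 * (W1 * U3 - W3 * U1) + A3 * (W1 * U2 - W2 * U1)) with hD
  have h1 : e ∣ 4 * h * D := by
    have := ((a23.mul_left A1).sub (a13.mul_left A2)).add (a12.mul_left A3)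
    exact dvd_cg this (by rw [hD]; ring)
  have h2 : d ∣ 4 * h * D := by
    have := ((b23.mul_left (-U1)).add (b13.mul_left U2)).sub (b12.mul_left U3)
    exact dvd_cg this (by rw [hD]; ring)
  have h3 : (Int.lcm d e : ℤ) ∣ 4 * h * D := Int.coe_lcm_dvd h2 h1
  have e1 : h * (Int.lcm d e : ℤ) = |d * e| := by
    rw [hh, ← Nat.cast_mul, Int.gcd_mul_lcm, Int.abs_eq_natAbs, Int.natAbs_mul]
  have := mul_dvd_mul_left h h3
  rw [e1, abs_dvd] at this
  exact dvd_cg this (by ring)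


/-- Facts on a pair. -/
structure PF (n : ℕ) (x : ℝ) (d t a a' : ℤ) (θ : ℝ) : Prop where
  a1 : 1 ≤ a
  a1' : 1 ≤ a'
  ax : (a : ℝ) ≤ x
  ax' : (a' : ℝ) ≤ x
  eq : t ^ 2 - n * (a' - a) ^ 2 = d * a * a'
  ht : (t : ℝ) = θ * a + √(n : ℝ) * (a' - a)
  h1 : |θ| ≤ 1
  h0 : θ ≠ 0

lemma PF.param {n : ℕ} {x : ℝ} {d t a a' : ℤ} {θ : ℝ} (h : PF n x d t a a' θ) (hn : 2 ≤ √(n : ℝ)) :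
    ∃ l : ℝ, (a : ℝ) = l * (2 * √(n : ℝ) * θ - d) ∧ (a' : ℝ) = l * (θ * (2 * √(n : ℝ) - θ)) ∧
      0 < l * θ ∧ l * θ ≤ x / √(n : ℝ) := by
  obtain ⟨a1, a1', ax, ax', eq, ht, h1, h0⟩ := h
  set s := √(n : ℝ) with hs
  have hs2 : s ^ 2 = n := Real.sq_sqrt (by positivity)
  have hθ := abs_le.1 h1
  have ha : (1 : ℝ) ≤ a := by exact_mod_cast a1
  have ha' : (1 : ℝ) ≤ a' := by exact_mod_cast a1'
  have hpos : 0 < 2 * s - θ := by linarith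
  have eqR : (t : ℝ) ^ 2 - n * (a' - a) ^ 2 = d * a * a' := by exact_mod_cast eq
  refine ⟨a' / (θ * (2 * s - θ)), ?_, ?_, ?_, ?_⟩
  · rw [div_mul_eq_mul_div, eq_div_iff (mul_ne_zero h0 hpos.ne')]
    rw [ht, ← hs2] at eqR
    apply mul_left_cancel₀ (by linarith : (a : ℝ) ≠ 0)
    linear_combination -eqR
  · rw [div_mul_cancel₀ _ (mul_ne_zero h0 hpos.ne')]
  · have : a' / (θ * (2 * s - θ)) * θ = a' / (2 * s - θ) := by field_simp
    rw [this]; positivity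
  · have : a' / (θ * (2 * s - θ)) * θ = a' / (2 * s - θ) := by field_simp
    rw [this]
    apply div_le_div₀ (by linarith) ax' (by linarith) (by linarith)

lemma PF.d_bd {n : ℕ} {x : ℝ} {d t a a' : ℤ} {θ : ℝ} (h : PF n x d t a a' θ) (hn : 2 ≤ √(n : ℝ))
    (hθx : |θ| ≤ a' / x) : |(d : ℝ)| ≤ 3 * √(n : ℝ) := by
  obtain ⟨a1, a1', ax, ax', eq, ht, h1, h0⟩ := h
  set s := √(n : ℝ) with hs
  have hs2 : s ^ 2 = n := Real.sq_sqrt (by positivity)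
  have ha : (1 : ℝ) ≤ a := by exact_mod_cast a1
  have ha' : (1 : ℝ) ≤ a' := by exact_mod_cast a1'
  have hx : 0 < x := by linarith
  have eqR : (t : ℝ) ^ 2 - n * (a' - a) ^ 2 = d * a * a' := by exact_mod_cast eq
  have e1 : (d : ℝ) * a' = θ * (θ * a + 2 * s * (a' - a)) := by
    rw [ht, ← hs2] at eqR
    apply mul_left_cancel₀ (by linarith : (a : ℝ) ≠ 0)
    linear_combination -eqR
  have e2 : |θ * a + 2 * s * (a' - a)| ≤ 3 * s * x := by
    have b1 : |θ * a| ≤ x := by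
      rw [abs_mul, abs_of_pos (by linarith : (0 : ℝ) < a)]
      calc |θ| * a ≤ 1 * x := by gcongr
        _ = x := one_mul x
    have b2 : |2 * s * ((a' : ℝ) - a)| ≤ 2 * s * x := by
      rw [abs_mul, abs_of_nonneg (by linarith : 0 ≤ 2 * s)]
      gcongr
      rw [abs_le]; constructor <;> linarith
    calc _ ≤ |θ * a| + |2 * s * ((a' : ℝ) - a)| := abs_add_le _ _
      _ ≤ x + 2 * s * x := add_le_add b1 b2
      _ ≤ 3 * s * x := by nlinarith
  have e3 : |(d : ℝ)| * a' ≤ a' / x * (3 * s * x) := by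
    rw [← abs_of_pos (by linarith : (0 : ℝ) < a'), ← abs_mul, e1, abs_mul, 
      abs_of_pos (by linarith : (0 : ℝ) < a')]
    gcongr
  have e4 : a' / x * (3 * s * x) = 3 * s * a' := by field_simp
  rw [e4] at e3
  exact le_of_mul_le_mul_right e3 (by linarith)

lemma PF.th_lb {n : ℕ} {x : ℝ} {d t a a' : ℤ} {θ : ℝ} (h : PF n x d t a a' θ) (hn : 2 ≤ √(n : ℝ))
    (hd : d ≠ 0) : 1 / (3 * √(n : ℝ) * x) ≤ |θ| := by
  obtain ⟨a1, a1', ax, ax', eq, ht, h1, h0⟩ := h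
  set s := √(n : ℝ) with hs
  have hs2 : s ^ 2 = n := Real.sq_sqrt (by positivity)
  have ha : (1 : ℝ) ≤ a := by exact_mod_cast a1
  have ha' : (1 : ℝ) ≤ a' := by exact_mod_cast a1'
  have hx : 0 < x := by linarith
  have eqR : (t : ℝ) ^ 2 - n * (a' - a) ^ 2 = d * a * a' := by exact_mod_cast eq
  have e1 : (d : ℝ) * a' = θ * (θ * a + 2 * s * (a' - a)) := by
    rw [ht, ← hs2] at eqR
    apply mul_left_cancel₀ (by linarith : (a : ℝ) ≠ 0)
    linear_combination -eqR
  have e2 : |θ * a + 2 * s * (a' - a)| ≤ 3 * s * x := by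
    have b1 : |θ * a| ≤ x := by
      rw [abs_mul, abs_of_pos (by linarith : (0 : ℝ) < a)]
      calc |θ| * a ≤ 1 * x := by gcongr
        _ = x := one_mul x
    have b2 : |2 * s * ((a' : ℝ) - a)| ≤ 2 * s * x := by
      rw [abs_mul, abs_of_nonneg (by linarith : 0 ≤ 2 * s)]
      gcongr
      rw [abs_le]; constructor <;> linarith
    calc _ ≤ |θ * a| + |2 * s * ((a' : ℝ) - a)| := abs_add_le _ _
      _ ≤ x + 2 * s * x := add_le_add b1 b2
      _ ≤ 3 * s * x := by nlinarith
  have hd1 : (1 : ℝ) ≤ |(d : ℝ)| := by exact_mod_cast Int.one_le_abs hd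
  rw [div_le_iff₀ (by positivity)]
  calc (1 : ℝ) ≤ |(d : ℝ)| * |(a' : ℝ)| := by
        rw [abs_of_pos (by linarith : (0 : ℝ) < a')]; nlinarith
    _ = |θ| * |θ * a + 2 * s * (a' - a)| := by rw [← abs_mul, e1, abs_mul]
    _ ≤ _ := by gcongr

lemma triple_det {n : ℕ} {x : ℝ} {d : ℤ} {t₁ a₁ b₁ t₂ a₂ b₂ t₃ a₃ b₃ : ℤ} {θ₁ θ₂ θ₃ : ℝ}
    (P1 : PF n x d t₁ a₁ b₁ θ₁) (P2 : PF n x d t₂ a₂ b₂ θ₂) (P3 : PF n x d t₃ a₃ b₃ θ₃)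
    (hn : 2 ≤ √(n : ℝ)) (hd : d ≠ 0) (he : 0 < 4 * (n : ℤ) - d) (h : ℕ) (hh : 1 ≤ h)
    (h12 : |θ₁ - θ₂| ≤ 2 * (√(n : ℝ) / (8 * x * h)) * |θ₁|)
    (h23 : |θ₂ - θ₃| ≤ 2 * (√(n : ℝ) / (8 * x * h)) * |θ₂|)
    (h13 : |θ₁ - θ₃| ≤ 2 * (√(n : ℝ) / (8 * x * h)) * |θ₃|) :
    16 * (h : ℤ) ^ 2 * |t₁ * (a₂ * b₃ - b₂ * a₃) - t₂ * (a₁ * b₃ - b₁ * a₃) + t₃ * (a₁ * b₂ - b₁ * a₂)|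
      < |d| * (4 * n - d) ∧
    (t₁ * (a₂ * b₃ - b₂ * a₃) - t₂ * (a₁ * b₃ - b₁ * a₃) + t₃ * (a₁ * b₂ - b₁ * a₂) = 0 →
      θ₁ = θ₂ ∨ θ₂ = θ₃ ∨ θ₁ = θ₃) := by
  obtain ⟨l1, ha1, hb1, hp1, hq1⟩ := P1.param hn
  obtain ⟨l2, ha2, hb2, hp2, hq2⟩ := P2.param hn
  obtain ⟨l3, ha3, hb3, hp3, hq3⟩ := P3.param hn
  have ht1 := P1.ht
  have ht2 := P2.ht
  have ht3 := P3.ht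
  have hx : 0 < x := lt_of_lt_of_le (by exact_mod_cast P1.a1) P1.ax
  set s := √(n : ℝ) with hs
  have hs2 : s ^ 2 = n := Real.sq_sqrt (by positivity)
  set D : ℤ := t₁ * (a₂ * b₃ - b₂ * a₃) - t₂ * (a₁ * b₃ - b₁ * a₃) + t₃ * (a₁ * b₂ - b₁ * a₂) with hD
  have hDR : (D : ℝ) = d * (4 * n - d) * (l1 * l2 * l3) * ((θ₁ - θ₂) * (θ₂ - θ₃) * (θ₁ - θ₃)) := by
    rw [hD]; push_cast
    rw [ht1, ht2, ht3, ha1, ha2, ha3, hb1, hb2, hb3, ← hs2]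
    ring
  have hdR : (d : ℝ) ≠ 0 := by exact_mod_cast hd
  have heR : 0 < 4 * (n : ℝ) - d := by exact_mod_cast he
  have hh0 : (1 : ℝ) ≤ h := by exact_mod_cast hh
  constructor
  · have key : |(l1 * l2 * l3) * ((θ₁ - θ₂) * (θ₂ - θ₃) * (θ₁ - θ₃))| ≤ 1 / (64 * (h : ℝ) ^ 3) := by
      set η := s / (8 * x * h) with hη
      have hη0 : 0 < η := by positivity
      calc |(l1 * l2 * l3) * ((θ₁ - θ₂) * (θ₂ - θ₃) * (θ₁ - θ₃))|
          = |l1| * |l2| * |l3| * (|θ₁ - θ₂| * |θ₂ - θ₃| * |θ₁ - θ₃|) := by simp only [abs_mul]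
        _ ≤ |l1| * |l2| * |l3| * ((2 * η * |θ₁|) * (2 * η * |θ₂|) * (2 * η * |θ₃|)) := by gcongr
        _ = (2 * η) ^ 3 * (|l1 * θ₁| * |l2 * θ₂| * |l3 * θ₃|) := by simp only [abs_mul]; ring
        _ = (2 * η) ^ 3 * ((l1 * θ₁) * (l2 * θ₂) * (l3 * θ₃)) := by
            rw [abs_of_pos hp1, abs_of_pos hp2, abs_of_pos hp3]
        _ ≤ (2 * η) ^ 3 * ((x / s) * (x / s) * (x / s)) := by gcongr
        _ = 1 / (64 * (h : ℝ) ^ 3) := by rw [hη]; field_simp; norm_num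
    have e1 : |(D : ℝ)| ≤ |(d : ℝ)| * (4 * n - d) * (1 / (64 * (h : ℝ) ^ 3)) := by
      rw [hDR, mul_assoc, abs_mul, abs_mul, abs_of_pos heR]
      gcongr
    have e2 : 16 * (h : ℝ) ^ 2 * |(D : ℝ)| < |(d : ℝ)| * (4 * n - d) := by
      have hpos : 0 < |(d : ℝ)| * (4 * n - d) := mul_pos (abs_pos.2 hdR) heR
      calc 16 * (h : ℝ) ^ 2 * |(D : ℝ)| ≤
          16 * (h : ℝ) ^ 2 * (|(d : ℝ)| * (4 * n - d) * (1 / (64 * (h : ℝ) ^ 3))) := by gcongr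
        _ = |(d : ℝ)| * (4 * n - d) * (1 / (4 * h)) := by field_simp; norm_num
        _ < |(d : ℝ)| * (4 * n - d) * 1 := by
            apply mul_lt_mul_of_pos_left _ hpos
            rw [div_lt_one (by positivity)]; linarith
        _ = _ := mul_one _
    exact_mod_cast e2
  · intro h0
    have : (D : ℝ) = 0 := by exact_mod_cast h0
    rw [hDR] at this
    have l1' := left_ne_zero_of_mul hp1.ne'
    have l2' := left_ne_zero_of_mul hp2.ne'
    have l3' := left_ne_zero_of_mul hp3.ne'
    have := (mul_eq_zero.1 this).resolve_left
      (mul_ne_zero (mul_ne_zero hdR heR.ne') (mul_ne_zero (mul_ne_zero l1' l2') l3'))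
    rcases mul_eq_zero.1 this with h | h
    · rcases mul_eq_zero.1 h with h | h
      · left; linarith
      · right; left; linarith
    · right; right; linarith

/-- same angle, same gcd: same pair. -/
lemma pair_eq {n : ℕ} {x : ℝ} {d : ℤ} {t₁ a₁ b₁ t₂ a₂ b₂ : ℤ} {θ : ℝ}
    (P1 : PF n x d t₁ a₁ b₁ θ) (P2 : PF n x d t₂ a₂ b₂ θ) (hn : 2 ≤ √(n : ℝ))
    (hG : Int.gcd (Int.gcd (2 * t₁) (a₁ + b₁)) (b₁ - a₁) = Int.gcd (Int.gcd (2 * t₂) (a₂ + b₂)) (b₂ - a₂)) :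
    a₁ = a₂ ∧ b₁ = b₂ := by
  obtain ⟨l1, ha1, hb1, hp1, hq1⟩ := P1.param hn
  obtain ⟨l2, ha2, hb2, hp2, hq2⟩ := P2.param hn
  have e1 : a₁ * b₂ = a₂ * b₁ := by
    have : (a₁ : ℝ) * b₂ = a₂ * b₁ := by rw [ha1, ha2, hb1, hb2]; ring
    exact_mod_cast this
  have e2 : t₁ * b₂ = t₂ * b₁ := by
    have : (t₁ : ℝ) * b₂ = t₂ * b₁ := by rw [P1.ht, P2.ht, ha1, ha2, hb1, hb2]; ring
    exact_mod_cast this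
  have p1 := P1.a1'
  have p2 := P2.a1'
  have g : ∀ u v w k : ℤ, 0 ≤ k → ((Int.gcd (Int.gcd u v) w : ℕ) : ℤ) * k =
      (Int.gcd (Int.gcd (u * k) (v * k)) (w * k) : ℕ) := by
    intro u v w k hk
    rw [Int.gcd_mul_right, Nat.cast_mul, Int.natCast_natAbs, abs_of_nonneg hk, Int.gcd_mul_right]
    push_cast
    rw [abs_of_nonneg hk]
  have h1 := g (2 * t₁) (a₁ + b₁) (b₁ - a₁) b₂ (by omega)
  have h2 := g (2 * t₂) (a₂ + b₂) (b₂ - a₂) b₁ (by omega)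
  have f1 : 2 * t₁ * b₂ = 2 * t₂ * b₁ := by linear_combination 2 * e2
  have f2 : (a₁ + b₁) * b₂ = (a₂ + b₂) * b₁ := by linear_combination e1
  have f3 : (b₁ - a₁) * b₂ = (b₂ - a₂) * b₁ := by linear_combination -e1
  rw [f1, f2, f3, ← h2, hG] at h1
  have hne : ((Int.gcd (Int.gcd (2 * t₂) (a₂ + b₂)) (b₂ - a₂) : ℕ) : ℤ) ≠ 0 := by
    intro h
    have h' : Int.gcd (Int.gcd (2 * t₂) (a₂ + b₂)) (b₂ - a₂) = 0 := by exact_mod_cast h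
    rw [Int.gcd_eq_zero_iff] at h'
    have h3 : Int.gcd (2 * t₂) (a₂ + b₂) = 0 := by exact_mod_cast h'.1
    rw [Int.gcd_eq_zero_iff] at h3
    have := P2.a1
    omega
  have hb : b₂ = b₁ := mul_left_cancel₀ hne h1
  refine ⟨?_, hb.symm⟩
  rw [hb] at e1
  exact mul_right_cancel₀ (by omega : b₁ ≠ 0) e1


lemma theta_close {u v η : ℝ} (hu : u ≠ 0) (hv : v ≠ 0) (hs : 0 < u ↔ 0 < v) (hη : 0 < η) (hη1 : η ≤ 1)
    (hf : ⌊Real.log |u| / η⌋ = ⌊Real.log |v| / η⌋) : |u - v| ≤ 2 * η * |u| := by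
  have h1 := Int.abs_sub_lt_one_of_floor_eq_floor hf
  rw [← sub_div, abs_div, abs_of_pos hη, div_lt_one hη, abs_lt] at h1
  have hu' : 0 < |u| := abs_pos.2 hu
  have hv' : 0 < |v| := abs_pos.2 hv
  have e1 : |v| ≤ Real.exp η * |u| := by
    rw [← Real.log_le_log_iff hv' (by positivity), Real.log_mul (Real.exp_ne_zero _) hu'.ne', Real.log_exp]
    linarith [h1.1]
  have e2 : |u| ≤ Real.exp η * |v| := by
    rw [← Real.log_le_log_iff hu' (by positivity), Real.log_mul (Real.exp_ne_zero _) hv'.ne', Real.log_exp]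
    linarith [h1.2]
  have e3 : Real.exp η ≤ 1 + 2 * η := by
    have := Real.abs_exp_sub_one_le (x := η) (by rwa [abs_of_pos hη])
    rw [abs_of_pos hη] at this
    linarith [(abs_le.1 this).2]
  have e4 : 1 - η ≤ Real.exp (-η) := by linarith [Real.add_one_le_exp (-η)]
  have e5 : (1 - η) * |u| ≤ |v| := by
    calc (1 - η) * |u| ≤ Real.exp (-η) * (Real.exp η * |v|) := by gcongr
      _ = |v| := by rw [← mul_assoc, ← Real.exp_add]; simp
  have e6 : |v| ≤ (1 + 2 * η) * |u| := e1.trans (by gcongr)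
  have e7 : |u - v| = abs (|u| - |v|) := by
    by_cases h : 0 < u
    · rw [abs_of_pos h, abs_of_pos (hs.1 h)]
    · have h' : ¬ 0 < v := fun h'' => h (hs.2 h'')
      rw [abs_of_nonpos (not_lt.1 h), abs_of_nonpos (not_lt.1 h'), ← abs_neg]
      congr 1; ring
  rw [e7, abs_le]
  have := mul_pos hη hu'
  constructor <;> nlinarith

lemma det_scale {G W1 U1 A1 W2 U2 A2 W3 U3 A3 t1 a1 b1 t2 a2 b2 t3 a3 b3 : ℤ}
    (w1 : 2 * t1 = G * W1) (u1 : a1 + b1 = G * U1) (v1 : b1 - a1 = G * A1)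
    (w2 : 2 * t2 = G * W2) (u2 : a2 + b2 = G * U2) (v2 : b2 - a2 = G * A2)
    (w3 : 2 * t3 = G * W3) (u3 : a3 + b3 = G * U3) (v3 : b3 - a3 = G * A3) :
    G ^ 3 * (A1 * (W2 * U3 - W3 * U2) - A2 * (W1 * U3 - W3 * U1) + A3 * (W1 * U2 - W2 * U1)) =
    4 * (t1 * (a2 * b3 - b2 * a3) - t2 * (a1 * b3 - b1 * a3) + t3 * (a1 * b2 - b1 * a2)) := by
  have : G ^ 3 * (A1 * (W2 * U3 - W3 * U2) - A2 * (W1 * U3 - W3 * U1) + A3 * (W1 * U2 - W2 * U1)) =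
   ((G * A1) * ((G * W2) * (G * U3) - (G * W3) * (G * U2)) - (G * A2) * ((G * W1) * (G * U3) - (G * W3) * (G * U1)) + (G * A3) * ((G * W1) * (G * U2) - (G * W2) * (G * U1))) := by ring
  rw [this, ← w1, ← w2, ← w3, ← u1, ← u2, ← u3, ← v1, ← v2, ← v3]
  ring

/-- gcd of a pair -/
def pG (t a b : ℤ) : ℕ := Int.gcd (Int.gcd (2 * t) (a + b)) (b - a)
/-- reduced coordinates -/
def pW (t a b : ℤ) : ℤ := (2 * t) / pG t a b
/-- reduced coordinates -/
def pU (t a b : ℤ) : ℤ := (a + b) / pG t a b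
/-- reduced coordinates -/
def pA (t a b : ℤ) : ℤ := (b - a) / pG t a b

lemma pG_pos {t a b : ℤ} (ha : 1 ≤ a) (hb : 1 ≤ b) : 0 < pG t a b := by
  rw [pG, Int.gcd_pos_iff]
  left
  have : 0 < Int.gcd (2 * t) (a + b) := Int.gcd_pos_iff.2 (Or.inr (by omega))
  omega

lemma pW_eq (t a b : ℤ) : 2 * t = pG t a b * pW t a b := by
  rw [pW, Int.mul_ediv_cancel']
  exact (Int.gcd_dvd_left _ _).trans (Int.gcd_dvd_left _ _)
lemma pU_eq (t a b : ℤ) : a + b = pG t a b * pU t a b := by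
  rw [pU, Int.mul_ediv_cancel']
  exact (Int.gcd_dvd_left _ _).trans (Int.gcd_dvd_right _ _)
lemma pA_eq (t a b : ℤ) : b - a = pG t a b * pA t a b := by
  rw [pA, Int.mul_ediv_cancel']
  exact (Int.gcd_dvd_right _ _)

lemma p_prim {t a b : ℤ} (ha : 1 ≤ a) (hb : 1 ≤ b) :
    Int.gcd (Int.gcd (pW t a b) (pU t a b)) (pA t a b) = 1 := by
  have h := pG_pos (t := t) ha hb
  have e : pG t a b = Int.gcd (Int.gcd (2 * t) (a + b)) (b - a) := rfl
  rw [pW_eq t a b, pU_eq, pA_eq, Int.gcd_mul_left, Nat.cast_mul, Int.natAbs_natCast, Int.gcd_mul_left,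
    Int.natAbs_natCast] at e
  have := Nat.eq_of_mul_eq_mul_left h (e.symm.trans (mul_one _).symm)
  exact this

lemma p_conic {n : ℕ} {x θ : ℝ} {d t a b : ℤ} (h : PF n x d t a b θ) :
    (pW t a b) ^ 2 = (4 * n - d) * (pA t a b) ^ 2 + d * (pU t a b) ^ 2 := by
  have hp := pG_pos (t := t) h.a1 h.a1'
  have hp' : ((pG t a b : ℤ)) ^ 2 ≠ 0 := by positivity
  apply mul_left_cancel₀ hp'
  have e := h.eq
  have : ((pG t a b : ℤ)) ^ 2 * ((4 * n - d) * (pA t a b) ^ 2 + d * (pU t a b) ^ 2) =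
    (4 * n - d) * (pG t a b * pA t a b) ^ 2 + d * (pG t a b * pU t a b) ^ 2 := by ring
  rw [this, ← mul_pow, ← pW_eq, ← pU_eq, ← pA_eq]
  linear_combination 4 * e

lemma g_dvd {d e W U A : ℤ} (h : W ^ 2 = e * A ^ 2 + d * U ^ 2)
    (hp : Int.gcd (Int.gcd W U) A = 1) : (Int.gcd W U : ℤ) ∣ e := by
  set g : ℤ := (Int.gcd W U : ℤ)
  have h1 : g ∣ W := Int.gcd_dvd_left _ _
  have h2 : g ∣ U := Int.gcd_dvd_right _ _
  have h3 : g ∣ e * A ^ 2 := by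
    have := ((h1.mul_right W).sub (h2.mul_right (U * d)))
    exact dvd_cg this (by linear_combination -h)
  have h4 : IsCoprime g A := Int.isCoprime_iff_gcd_eq_one.2 hp
  exact (h4.pow_right).dvd_of_dvd_mul_right h3

lemma triple_same {n : ℕ} {x : ℝ} {d : ℤ} {t1 a1 b1 t2 a2 b2 t3 a3 b3 : ℤ} {θ1 θ2 θ3 : ℝ}
    (P1 : PF n x d t1 a1 b1 θ1) (P2 : PF n x d t2 a2 b2 θ2) (P3 : PF n x d t3 a3 b3 θ3)
    (hn : 2 ≤ √(n : ℝ)) (hd : d ≠ 0) (he : 0 < 4 * (n : ℤ) - d) (h : ℕ) (hh : h = Int.gcd d (4 * n - d))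
    (h12 : |θ1 - θ2| ≤ 2 * (√(n : ℝ) / (8 * x * h)) * |θ1|)
    (h23 : |θ2 - θ3| ≤ 2 * (√(n : ℝ) / (8 * x * h)) * |θ2|)
    (h13 : |θ3 - θ1| ≤ 2 * (√(n : ℝ) / (8 * x * h)) * |θ3|)
    (hG2 : pG t1 a1 b1 = pG t2 a2 b2) (hG3 : pG t1 a1 b1 = pG t3 a3 b3)
    {W0 U0 A0 W0' U0' A0' : ℤ} (c0 : W0 ^ 2 = (4 * n - d) * A0 ^ 2 + d * U0 ^ 2)
    (c0' : W0' ^ 2 = (4 * n - d) * A0' ^ 2 + d * U0' ^ 2)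
    {g k g' k' : ℕ} (hg0 : g ≠ 0) (hg0' : g' ≠ 0) (g0 : Int.gcd W0 U0 = g) (g0' : Int.gcd W0' A0' = g')
    (g1 : Int.gcd (pW t1 a1 b1) (pU t1 a1 b1) = g) (g1' : Int.gcd (pW t1 a1 b1) (pA t1 a1 b1) = g')
    (g2 : Int.gcd (pW t2 a2 b2) (pU t2 a2 b2) = g) (g2' : Int.gcd (pW t2 a2 b2) (pA t2 a2 b2) = g')
    (g3 : Int.gcd (pW t3 a3 b3) (pU t3 a3 b3) = g) (g3' : Int.gcd (pW t3 a3 b3) (pA t3 a3 b3) = g')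
    (k1 : Int.gcd (4 * n - d) (pW t1 a1 b1 * U0 - W0 * pU t1 a1 b1) = k)
    (k2 : Int.gcd (4 * n - d) (pW t2 a2 b2 * U0 - W0 * pU t2 a2 b2) = k)
    (k3 : Int.gcd (4 * n - d) (pW t3 a3 b3 * U0 - W0 * pU t3 a3 b3) = k)
    (k1' : Int.gcd d (pW t1 a1 b1 * A0' - W0' * pA t1 a1 b1) = k')
    (k2' : Int.gcd d (pW t2 a2 b2 * A0' - W0' * pA t2 a2 b2) = k')
    (k3' : Int.gcd d (pW t3 a3 b3 * A0' - W0' * pA t3 a3 b3) = k') :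
    (a1 = a2 ∧ b1 = b2) ∨ (a2 = a3 ∧ b2 = b3) ∨ (a1 = a3 ∧ b1 = b3) := by
  have hh1 : 1 ≤ h := by rw [hh]; exact Int.gcd_pos_iff.2 (Or.inl hd)
  have T := triple_det P1 P2 P3 hn hd he h hh1 h12 h23 (by rw [abs_sub_comm]; exact h13)
  have q1 := p_conic P1
  have q2 := p_conic P2
  have q3 := p_conic P3
  have r1 := p_prim (t := t1) P1.a1 P1.a1'
  have r2 := p_prim (t := t2) P2.a1 P2.a1'
  have sw : ∀ {W U A : ℤ}, Int.gcd (Int.gcd W U) A = 1 → Int.gcd (Int.gcd W A) U = 1 := by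
    intro W U A hW
    rw [← hW, Int.gcd_assoc, Int.gcd_comm A U, ← Int.gcd_assoc]
  have sc : ∀ {W U A : ℤ}, W ^ 2 = (4 * n - d) * A ^ 2 + d * U ^ 2 → W ^ 2 = d * U ^ 2 + (4 * n - d) * A ^ 2 := by
    intro W U A hW
    rw [hW]; ring
  have D := det_dvd (minor_e he.ne' hg0 q1 q2 c0 r1 g1 g2 g0 (k1.trans k2.symm))
    (minor_e he.ne' hg0 q1 q3 c0 r1 g1 g3 g0 (k1.trans k3.symm))
    (minor_e he.ne' hg0 q2 q3 c0 r2 g2 g3 g0 (k2.trans k3.symm))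
    (by rw [Int.gcd_comm]
        exact (minor_e hd hg0' (sc q1) (sc q2) (sc c0') (sw r1) g1' g2' g0' (k1'.trans k2'.symm)))
    (by rw [Int.gcd_comm]
        exact (minor_e hd hg0' (sc q1) (sc q3) (sc c0') (sw r1) g1' g3' g0' (k1'.trans k3'.symm)))
    (by rw [Int.gcd_comm]
        exact (minor_e hd hg0' (sc q2) (sc q3) (sc c0') (sw r2) g2' g3' g0' (k2'.trans k3'.symm)))
  have S := det_scale (pW_eq t1 a1 b1) (pU_eq t1 a1 b1) (pA_eq t1 a1 b1) (hG2 ▸ pW_eq t2 a2 b2) 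
    (hG2 ▸ pU_eq t2 a2 b2) (hG2 ▸ pA_eq t2 a2 b2) (hG3 ▸ pW_eq t3 a3 b3) 
    (hG3 ▸ pU_eq t3 a3 b3) (hG3 ▸ pA_eq t3 a3 b3)
  rw [← hh] at D
  have D2 := D.mul_left ((pG t1 a1 b1 : ℤ) ^ 3)
  have D3 := dvd_cg D2 (c := 4 * (h : ℤ) ^ 2 * (4 * (t1 * (a2 * b3 - b2 * a3) - t2 * (a1 * b3 - b1 * a3) + t3 * (a1 * b2 - b1 * a2)))) (by rw [← S]; ring)
  have Z : 4 * (h : ℤ) ^ 2 * (4 * (t1 * (a2 * b3 - b2 * a3) - t2 * (a1 * b3 - b1 * a3) + t3 * (a1 * b2 - b1 * a2))) = 0 := by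
    apply Int.eq_zero_of_abs_lt_dvd ((abs_dvd _ _).2 D3)
    have T1 := T.1
    rw [abs_mul d, abs_of_pos he]
    refine lt_of_eq_of_lt ?_ T1
    generalize (t1 * (a2 * b3 - b2 * a3) - t2 * (a1 * b3 - b1 * a3) + t3 * (a1 * b2 - b1 * a2)) = z
    rw [show 4 * (h : ℤ) ^ 2 * (4 * z) = (16 * (h : ℤ) ^ 2) * z by ring, abs_mul,
      abs_of_nonneg (by positivity : (0:ℤ) ≤ 16 * (h:ℤ)^2)]
  have Z2 : (t1 * (a2 * b3 - b2 * a3) - t2 * (a1 * b3 - b1 * a3) + t3 * (a1 * b2 - b1 * a2)) = 0 := by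
    have hp : (4 * (h : ℤ) ^ 2) ≠ 0 := by positivity
    have := (mul_eq_zero.1 Z).resolve_left hp
    omega
  rcases T.2 Z2 with e | e | e
  · subst e; exact Or.inl (pair_eq P1 P2 hn hG2)
  · subst e; exact Or.inr (Or.inl (pair_eq P2 P3 hn (hG2.symm.trans hG3)))
  · subst e; exact Or.inr (Or.inr (pair_eq P1 P3 hn hG3))


lemma card_bnd {A B C D E : Finset ℕ} {I : Finset ℤ} {T : ℕ} {M : ℝ} (a : A.card ≤ T) (b : B.card ≤ T)
    (c : C.card ≤ T) (d : D.card ≤ T) (e : E.card ≤ T) (i : (I.card : ℝ) ≤ M) :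
    ((A ×ˢ B ×ˢ C ×ˢ D ×ˢ E ×ˢ (Finset.univ : Finset Bool) ×ˢ I).card : ℝ) ≤ 2 * (T : ℝ) ^ 5 * M := by
  rw [Finset.card_product, Finset.card_product, Finset.card_product, Finset.card_product,
    Finset.card_product, Finset.card_product]
  push_cast
  rw [show ((Finset.univ : Finset Bool).card : ℝ) = 2 by simp]
  have hM : 0 ≤ M := le_trans (by positivity) i
  calc _ ≤ (T : ℝ) * (T * (T * (T * (T * (2 * M))))) := by gcongr
    _ = _ := by ring

lemma perD (n : ℕ) (x : ℝ) (d : ℤ) (hn : 2 ≤ √(n : ℝ)) (hd : d ≠ 0) (he : 0 < 4 * (n : ℤ) - d)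
    (hx : √(n : ℝ) ≤ x) (hdb : |(d : ℝ)| ≤ 3 * √(n : ℝ))
    (P : Finset (ℕ × ℕ)) (t : ℕ × ℕ → ℤ) (θ : ℕ × ℕ → ℝ)
    (hP : ∀ p ∈ P, PF n x d (t p) p.1 p.2 (θ p))
    (hG : ∀ p ∈ P, (pG (t p) p.1 p.2 : ℤ) ∣ 2 * d * (4 * n - d)) (T : ℕ)
    (hT : ∀ m : ℕ, m ≠ 0 → m ≤ 42 * n ^ 2 → m.divisors.card ≤ T) :
    (P.card : ℝ) ≤ 4 * (T : ℝ) ^ 5 * (Real.log (3 * √(n : ℝ) * x) * (8 * x * (Int.gcd d (4 * n - d) : ℝ)) / √(n : ℝ) + 2) := by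
  classical
  set e : ℤ := 4 * n - d with hedef
  set h := Int.gcd d e with hh
  have hh1 : 1 ≤ h := by rw [hh]; exact Int.gcd_pos_iff.2 (Or.inl hd)
  have hh1R : (1 : ℝ) ≤ h := by exact_mod_cast hh1
  set η : ℝ := √(n : ℝ) / (8 * x * h) with hη
  have hx0 : 0 < x := by linarith
  have hη0 : 0 < η := by rw [hη]; positivity
  have hη1 : η ≤ 1 := by
    rw [hη, div_le_one (by positivity)]
    nlinarith
  set W : ℕ × ℕ → ℤ := fun p => pW (t p) p.1 p.2 with hW
  set U : ℕ × ℕ → ℤ := fun p => pU (t p) p.1 p.2 with hU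
  set A : ℕ × ℕ → ℤ := fun p => pA (t p) p.1 p.2 with hA
  have href : ∀ g : ℕ, ∃ q : ℕ × ℕ, (∃ p ∈ P, Int.gcd (W p) (U p) = g) → q ∈ P ∧ Int.gcd (W q) (U q) = g := by
    intro g
    by_cases hg : ∃ p ∈ P, Int.gcd (W p) (U p) = g
    · obtain ⟨p, hp⟩ := hg
      exact ⟨p, fun _ => hp⟩
    · exact ⟨(0, 0), fun h => absurd h hg⟩
  have href' : ∀ g : ℕ, ∃ q : ℕ × ℕ, (∃ p ∈ P, Int.gcd (W p) (A p) = g) → q ∈ P ∧ Int.gcd (W q) (A q) = g := by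
    intro g
    by_cases hg : ∃ p ∈ P, Int.gcd (W p) (A p) = g
    · obtain ⟨p, hp⟩ := hg
      exact ⟨p, fun _ => hp⟩
    · exact ⟨(0, 0), fun h => absurd h hg⟩
  choose r hr using href
  choose r' hr' using href'
  set key : ℕ × ℕ → ℕ × ℕ × ℕ × ℕ × ℕ × Bool × ℤ := fun p =>
    (pG (t p) p.1 p.2, Int.gcd (W p) (U p), Int.gcd e (W p * U (r (Int.gcd (W p) (U p))) - W (r (Int.gcd (W p) (U p))) * U p),
     Int.gcd (W p) (A p), Int.gcd d (W p * A (r' (Int.gcd (W p) (A p))) - W (r' (Int.gcd (W p) (A p))) * A p),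
     decide (0 < θ p), ⌊Real.log |θ p| / η⌋) with hkey
  set L := Real.log (3 * √(n : ℝ) * x) with hL
  set K := (2 * d * e).natAbs.divisors ×ˢ e.natAbs.divisors ×ˢ e.natAbs.divisors ×ˢ d.natAbs.divisors ×ˢ
    d.natAbs.divisors ×ˢ (Finset.univ : Finset Bool) ×ˢ Finset.Icc ⌊-L / η⌋ 0 with hK
  have prim : ∀ p ∈ P, Int.gcd (Int.gcd (W p) (U p)) (A p) = 1 := fun p hp => p_prim (hP p hp).a1 (hP p hp).a1'
  have sw : ∀ {W U A : ℤ}, Int.gcd (Int.gcd W U) A = 1 → Int.gcd (Int.gcd W A) U = 1 := by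
    intro W U A hW
    rw [← hW, Int.gcd_assoc, Int.gcd_comm A U, ← Int.gcd_assoc]
  have conic : ∀ p ∈ P, (W p) ^ 2 = e * (A p) ^ 2 + d * (U p) ^ 2 := fun p hp => p_conic (hP p hp)
  have conic' : ∀ p ∈ P, (W p) ^ 2 = d * (U p) ^ 2 + e * (A p) ^ 2 := fun p hp => by rw [conic p hp]; ring
  have Upos : ∀ p ∈ P, U p ≠ 0 := by
    intro p hp h0
    have := pU_eq (t p) p.1 p.2
    have h1 := (hP p hp).a1
    have h2 := (hP p hp).a1'
    simp only [hU] at h0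
    rw [h0] at this
    omega
  have h1 : ∀ p ∈ P, key p ∈ K := by
    intro p hp
    simp only [hkey, hK, Finset.mem_product, Finset.mem_univ, Nat.mem_divisors, Finset.mem_Icc, true_and]
    refine ⟨⟨Int.natCast_dvd.1 (hG p hp), ?_⟩, ⟨?_, ?_⟩, ⟨?_, ?_⟩, ⟨?_, ?_⟩, ⟨?_, ?_⟩, ?_, ?_⟩
    · exact Int.natAbs_ne_zero.2 (mul_ne_zero (mul_ne_zero two_ne_zero hd) he.ne')
    · exact Int.natCast_dvd.1 (g_dvd (conic p hp) (prim p hp))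
    · exact Int.natAbs_ne_zero.2 he.ne'
    · exact Int.natCast_dvd.1 (Int.gcd_dvd_left _ _)
    · exact Int.natAbs_ne_zero.2 he.ne'
    · exact Int.natCast_dvd.1 (g_dvd (conic' p hp) (sw (prim p hp)))
    · exact Int.natAbs_ne_zero.2 hd
    · exact Int.natCast_dvd.1 (Int.gcd_dvd_left _ _)
    · exact Int.natAbs_ne_zero.2 hd
    · apply Int.floor_mono
      gcongr
      have := (hP p hp).th_lb hn hd
      rw [hL, ← Real.log_inv, ← one_div]
      exact Real.log_le_log (by positivity) this
    · have : Real.log |θ p| / η ≤ 0 := div_nonpos_of_nonpos_of_nonneg (Real.log_nonpos (abs_nonneg _) (hP p hp).h1) hη0.le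
      have := Int.floor_mono this
      simpa using this
  have key3 : ∀ p1 ∈ P, ∀ p2 ∈ P, ∀ p3 ∈ P, key p1 = key p2 → key p1 = key p3 → p1 = p2 ∨ p2 = p3 ∨ p1 = p3 := by
    intro p1 m1 p2 m2 p3 m3 k12 k13
    simp only [hkey, Prod.mk.injEq, decide_eq_decide] at k12 k13
    obtain ⟨x1, x2, x3, x4, x5, x6, x7⟩ := k12
    obtain ⟨y1, y2, y3, y4, y5, y6, y7⟩ := k13
    rw [← x2] at x3
    rw [← x4] at x5
    rw [← y2] at y3
    rw [← y4] at y5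
    have R := hr (Int.gcd (W p1) (U p1)) ⟨p1, m1, rfl⟩
    have R' := hr' (Int.gcd (W p1) (A p1)) ⟨p1, m1, rfl⟩
    have hg0 : Int.gcd (W p1) (U p1) ≠ 0 := (Int.gcd_pos_iff.2 (Or.inr (Upos p1 m1))).ne'
    have hg0' : Int.gcd (W p1) (A p1) ≠ 0 := by
      intro h0
      rw [Int.gcd_eq_zero_iff] at h0
      have c := conic p1 m1
      rw [h0.1, h0.2] at c
      have : d * (U p1) ^ 2 = 0 := by linarith
      rcases mul_eq_zero.1 this with h | h
      · exact hd h
      · exact Upos p1 m1 (pow_eq_zero_iff two_ne_zero |>.1 h)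
    have z1 := (hP p1 m1).h0
    have z2 := (hP p2 m2).h0
    have z3 := (hP p3 m3).h0
    have S := triple_same (hP p1 m1) (hP p2 m2) (hP p3 m3) hn hd he h hh
      (theta_close z1 z2 x6 hη0 hη1 x7) (theta_close z2 z3 (x6.symm.trans y6) hη0 hη1 (x7.symm.trans y7))
      (theta_close z3 z1 y6.symm hη0 hη1 y7.symm) x1 y1 (conic _ R.1) (conic _ R'.1) hg0 hg0' R.2 R'.2
      rfl rfl x2.symm x4.symm y2.symm y4.symm rfl x3.symm y3.symm rfl x5.symm y5.symm
    have pe : ∀ p q : ℕ × ℕ, ((p.1 : ℤ) = q.1 ∧ (p.2 : ℤ) = q.2) → p = q := by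
      intro p q hpq
      exact Prod.ext (by exact_mod_cast hpq.1) (by exact_mod_cast hpq.2)
    rcases S with s | s | s
    · exact Or.inl (pe _ _ s)
    · exact Or.inr (Or.inl (pe _ _ s))
    · exact Or.inr (Or.inr (pe _ _ s))
  have c1 : P.card ≤ 2 * K.card := by
    apply Finset.card_le_mul_card_image_of_maps_to h1
    intro k _
    by_contra hc
    push Not at hc
    obtain ⟨p1, p2, p3, m1, m2, m3, n12, n13, n23⟩ := Finset.two_lt_card_iff.1 hc
    simp only [Finset.mem_filter] at m1 m2 m3
    rcases key3 p1 m1.1 p2 m2.1 p3 m3.1 (m1.2.trans m2.2.symm) (m1.2.trans m3.2.symm) with s | s | s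
    · exact n12 s
    · exact n23 s
    · exact n13 s
  have hsq : √(n : ℝ) ^ 2 = n := Real.sq_sqrt (by positivity)
  have nR : √(n : ℝ) ≤ n := by nlinarith
  have n4 : (4 : ℝ) ≤ n := by nlinarith
  have dR : (d.natAbs : ℝ) = |(d : ℝ)| := by rw [Nat.cast_natAbs]; push_cast; rfl
  have eR : (e.natAbs : ℝ) ≤ 7 * n := by
    rw [Nat.cast_natAbs, abs_of_pos he, hedef]; push_cast
    have := (abs_le.1 hdb).1
    linarith
  have b1 : (2 * d * e).natAbs.divisors.card ≤ T := by
    apply hT _ (Int.natAbs_ne_zero.2 (mul_ne_zero (mul_ne_zero two_ne_zero hd) he.ne'))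
    rw [Int.natAbs_mul, Int.natAbs_mul]
    have : (((2:ℤ).natAbs * d.natAbs * e.natAbs : ℕ) : ℝ) ≤ ((42 * n ^ 2 : ℕ) : ℝ) := by
      push_cast
      rw [dR]
      calc _ ≤ (2:ℝ) * (3 * n) * (7 * n) := by gcongr; linarith
        _ = _ := by ring
    exact_mod_cast this
  have b2 : e.natAbs.divisors.card ≤ T := by
    apply hT _ (Int.natAbs_ne_zero.2 he.ne')
    have : (e.natAbs : ℝ) ≤ ((42 * n ^ 2 : ℕ) : ℝ) := by push_cast; nlinarith
    exact_mod_cast this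
  have b3 : d.natAbs.divisors.card ≤ T := by
    apply hT _ (Int.natAbs_ne_zero.2 hd)
    have : (d.natAbs : ℝ) ≤ ((42 * n ^ 2 : ℕ) : ℝ) := by push_cast; rw [dR]; nlinarith
    exact_mod_cast this
  have b4 : ((Finset.Icc ⌊-L / η⌋ 0).card : ℝ) ≤ L / η + 2 := by
    rw [Int.card_Icc]
    have hL0 : 0 ≤ L := Real.log_nonneg (by nlinarith)
    have : -L / η ≤ 0 := div_nonpos_of_nonpos_of_nonneg (by linarith) hη0.le
    have f0 : ⌊-L / η⌋ ≤ 0 := by simpa using Int.floor_mono this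
    have f1 := Int.lt_floor_add_one (-L / η)
    rw [neg_div] at f1 f0 ⊢
    have : ((0 + 1 - ⌊-(L / η)⌋).toNat : ℝ) = ((0 + 1 - ⌊-(L / η)⌋ : ℤ) : ℝ) := by
      exact_mod_cast Int.toNat_of_nonneg (by omega : 0 ≤ 0 + 1 - ⌊-(L / η)⌋)
    rw [this]; push_cast
    linarith
  have c2 : (K.card : ℝ) ≤ 2 * (T : ℝ) ^ 5 * (L / η + 2) := card_bnd b1 b2 b2 b3 b3 b4
  have c3 : (P.card : ℝ) ≤ 2 * K.card := by exact_mod_cast c1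
  have c4 : L / η = L * (8 * x * h) / √(n : ℝ) := by
    rw [hη]; field_simp
  rw [← c4]
  calc _ ≤ _ := c3
    _ ≤ _ := mul_le_mul_of_nonneg_left c2 (by norm_num)
    _ = _ := by ring


lemma sum_gcd_le (B m : ℕ) (hm : m ≠ 0) :
    ∑ d ∈ Finset.Icc 1 B, Nat.gcd d m ≤ B * m.divisors.card := by
  have h1 : ∀ d ∈ Finset.Icc 1 B, Nat.gcd d m ≤ ∑ c ∈ m.divisors, if c ∣ d then c else 0 := by
    intro d _
    have : (if Nat.gcd d m ∣ d then Nat.gcd d m else 0) ≤ ∑ c ∈ m.divisors, if c ∣ d then c else 0 :=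
      Finset.single_le_sum (f := fun c => if c ∣ d then c else 0) (fun _ _ => Nat.zero_le _)
        (Nat.mem_divisors.2 ⟨Nat.gcd_dvd_right _ _, hm⟩)
    rwa [if_pos (Nat.gcd_dvd_left _ _)] at this
  calc _ ≤ ∑ d ∈ Finset.Icc 1 B, ∑ c ∈ m.divisors, (if c ∣ d then c else 0) := Finset.sum_le_sum h1
    _ = ∑ c ∈ m.divisors, ∑ d ∈ Finset.Icc 1 B, (if c ∣ d then c else 0) := Finset.sum_comm
    _ ≤ ∑ c ∈ m.divisors, B := by
      apply Finset.sum_le_sum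
      intro c hc
      rw [← Finset.sum_filter, Finset.sum_const, smul_eq_mul]
      have : ((Finset.Icc 1 B).filter (fun d => c ∣ d)).card = B / c := by
        rw [← Nat.Ioc_filter_dvd_card_eq_div]; rfl
      rw [this]
      exact Nat.div_mul_le_self _ _
    _ = _ := by rw [Finset.sum_const, smul_eq_mul, mul_comm]

lemma sq_of_mul_sq {n : ℕ} {t α : ℤ} (hα : α ≠ 0) (h : t ^ 2 = n * α ^ 2) : IsSquare n := by
  have h1 : α ^ 2 ∣ t ^ 2 := ⟨n, by rw [h]; ring⟩
  obtain ⟨k, hk⟩ := (Int.pow_dvd_pow_iff two_ne_zero).1 h1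
  have h2 : (n : ℤ) = k ^ 2 := by
    apply mul_right_cancel₀ (pow_ne_zero 2 hα)
    rw [← h, hk]; ring
  refine ⟨k.natAbs, ?_⟩
  zify
  rw [h2, abs_mul_abs_self, sq]

lemma pairs_bound (n X : ℕ) (A : Finset ℕ) (w : ℕ → ℝ) (y b : ℕ → ℤ) (T : ℕ) (hn : 2 ≤ √(n : ℝ))
    (hsq : ¬ IsSquare n) (hX : √(n : ℝ) ≤ (X : ℝ) ^ 2)
    (hA : ∀ a ∈ A, 1 ≤ a ∧ a ≤ X ^ 2 ∧ y a ^ 2 + a * b a = n ∧ w a = (√(n : ℝ) - y a) / a)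
    (hT : ∀ m : ℕ, m ≠ 0 → m ≤ 42 * n ^ 2 → m.divisors.card ≤ T) :
    (((A ×ˢ A).filter (fun p => p.1 ≠ p.2 ∧ ⌊w p.1 * (X : ℝ) ^ 2⌋ = ⌊w p.2 * (X : ℝ) ^ 2⌋)).card : ℝ) ≤
      240 * (T : ℝ) ^ 6 * (X : ℝ) ^ 2 * Real.log (3 * √(n : ℝ) * (X : ℝ) ^ 2) := by
  classical
  set x : ℝ := (X : ℝ) ^ 2 with hx
  set s := √(n : ℝ) with hs
  have hs2 : s ^ 2 = n := Real.sq_sqrt (by positivity)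
  set P := (A ×ˢ A).filter (fun p => p.1 ≠ p.2 ∧ ⌊w p.1 * x⌋ = ⌊w p.2 * x⌋) with hP
  set t : ℕ × ℕ → ℤ := fun p => p.2 * y p.1 - p.1 * y p.2 with ht
  set D : ℕ × ℕ → ℤ := fun p => (y p.2 - y p.1) ^ 2 + (p.2 - p.1) * (b p.2 - b p.1) with hD
  set θ : ℕ × ℕ → ℝ := fun p => p.2 * (w p.2 - w p.1) with hθ
  have hx0 : 0 < x := by linarith
  have memP : ∀ p ∈ P, p.1 ∈ A ∧ p.2 ∈ A ∧ p.1 ≠ p.2 ∧ ⌊w p.1 * x⌋ = ⌊w p.2 * x⌋ := by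
    intro p hp
    simpa [hP, and_assoc] using hp
  have hθx : ∀ p ∈ P, |θ p| ≤ ((p.2 : ℤ) : ℝ) / x := by
    intro p hp
    obtain ⟨m1, m2, ne, fl⟩ := memP p hp
    have := Int.abs_sub_lt_one_of_floor_eq_floor fl.symm
    rw [← sub_mul, abs_mul, abs_of_pos hx0] at this
    simp only [hθ]
    rw [abs_mul, le_div_iff₀ hx0]
    simp only [Nat.abs_cast, Int.cast_natCast]
    nlinarith [Nat.cast_nonneg (α := ℝ) p.2]
  have hPF : ∀ p ∈ P, PF n x (D p) (t p) p.1 p.2 (θ p) := by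
    intro p hp
    obtain ⟨m1, m2, ne, fl⟩ := memP p hp
    obtain ⟨u1, u2, u3, u4⟩ := hA _ m1
    obtain ⟨v1, v2, v3, v4⟩ := hA _ m2
    have hp1 : (0 : ℝ) < p.1 := by exact_mod_cast u1
    have hp2 : (0 : ℝ) < p.2 := by exact_mod_cast v1
    have ha' : (p.2 : ℝ) ≤ x := by rw [hx]; exact_mod_cast v2
    have heq : (t p) ^ 2 - n * ((p.2 : ℤ) - p.1) ^ 2 = D p * p.1 * p.2 := by
      simp only [ht, hD]
      linear_combination ((p.2 : ℤ)^2 - p.1 * p.2) * u3 + ((p.1 : ℤ)^2 - p.1 * p.2) * v3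
    have hht : (t p : ℝ) = θ p * p.1 + s * (p.2 - p.1) := by
      simp only [ht, hθ]
      rw [u4, v4]
      push_cast
      field_simp
      ring
    refine ⟨by exact_mod_cast u1, by exact_mod_cast v1, ?_, ?_, heq, ?_, ?_, ?_⟩
    · rw [hx]; exact_mod_cast u2
    · rw [hx]; exact_mod_cast v2
    · rw [hht]; push_cast; rfl
    · refine (hθx p hp).trans ?_
      rw [div_le_one hx0]; exact_mod_cast ha'
    · intro h0
      apply hsq
      apply sq_of_mul_sq (t := t p) (α := (p.2 : ℤ) - p.1) (by intro h; apply ne; omega)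
      rw [h0, zero_mul, zero_add] at hht
      have : (t p : ℝ) ^ 2 = n * (p.2 - p.1) ^ 2 := by rw [hht, ← hs2]; ring
      exact_mod_cast this
  have hD0 : ∀ p ∈ P, D p ≠ 0 := by
    intro p hp h0
    have h := (hPF p hp).eq
    obtain ⟨m1, m2, ne, fl⟩ := memP p hp
    apply hsq
    apply sq_of_mul_sq (t := t p) (α := (p.2 : ℤ) - p.1) (by intro h; apply ne; omega)
    rw [h0] at h
    linear_combination h
  have hDb : ∀ p ∈ P, |((D p : ℤ) : ℝ)| ≤ 3 * s := fun p hp => (hPF p hp).d_bd hn (hθx p hp)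
  have hG : ∀ p ∈ P, (pG (t p) p.1 p.2 : ℤ) ∣ 2 * D p * (4 * n - D p) := by
    intro p hp
    obtain ⟨m1, m2, ne, fl⟩ := memP p hp
    obtain ⟨u1, u2, u3, u4⟩ := hA _ m1
    obtain ⟨v1, v2, v3, v4⟩ := hA _ m2
    set γ : ℤ := (Int.gcd p.1 p.2 : ℤ) with hγ
    have q1 : γ ∣ (p.1 : ℤ) := Int.gcd_dvd_left _ _
    have q2 : γ ∣ (p.2 : ℤ) := Int.gcd_dvd_right _ _
    have g1 : (pG (t p) p.1 p.2 : ℤ) ∣ p.1 + p.2 := ⟨_, pU_eq _ _ _⟩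
    have g2 : (pG (t p) p.1 p.2 : ℤ) ∣ p.2 - p.1 := ⟨_, pA_eq _ _ _⟩
    have g3 : (pG (t p) p.1 p.2 : ℤ) ∣ 2 * p.1 := dvd_cg (g1.sub g2) (by ring)
    have g4 : (pG (t p) p.1 p.2 : ℤ) ∣ 2 * p.2 := dvd_cg (g1.add g2) (by ring)
    have g5 : (pG (t p) p.1 p.2 : ℤ) ∣ 2 * γ := by
      have := Int.dvd_coe_gcd g3 g4
      rw [Int.gcd_mul_left, Nat.cast_mul] at this
      exact this
    have g6 : γ ∣ D p * (4 * n - D p) := by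
      obtain ⟨r1, hr1⟩ := q1
      obtain ⟨r2, hr2⟩ := q2
      rw [hr1] at u3
      rw [hr2] at v3
      have e1 : D p = (y p.2 - y p.1) ^ 2 + γ * ((r2 - r1) * (b p.2 - b p.1)) := by
        simp only [hD]; rw [hr1, hr2]; ring
      have e2 : 4 * n - D p = (y p.2 + y p.1) ^ 2 + γ * ((r2 + r1) * (b p.2 + b p.1)) := by
        rw [e1]; linear_combination -2 * u3 - 2 * v3
      rw [e2, e1]
      have e3 : (y p.2 - y p.1) * (y p.2 + y p.1) = γ * (r1 * b p.1 - r2 * b p.2) := by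
        linear_combination v3 - u3
      refine ⟨(r1 * b p.1 - r2 * b p.2) * ((y p.2 - y p.1) * (y p.2 + y p.1)) + (y p.2 - y p.1) ^ 2 * ((r2 + r1) * (b p.2 + b p.1)) + ((r2 - r1) * (b p.2 - b p.1)) * ((y p.2 + y p.1) ^ 2 + γ * ((r2 + r1) * (b p.2 + b p.1))), ?_⟩
      linear_combination ((y p.2 - y p.1) * (y p.2 + y p.1)) * e3
    exact dvd_cg (g5.trans (mul_dvd_mul_left 2 g6)) (by ring)
  set B := ⌊3 * s⌋₊ with hB
  have hBle : (B : ℝ) ≤ 3 * s := Nat.floor_le (by linarith)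
  set L := Real.log (3 * s * x) with hL
  have hL1 : 1 ≤ L := by
    rw [hL, Real.le_log_iff_exp_le (by positivity)]
    have := Real.exp_one_lt_d9
    nlinarith
  have n0 : (0 : ℝ) < n := by rw [← hs2]; positivity
  have n0' : 0 < n := by exact_mod_cast n0
  set Ds := (Finset.Icc (-(B : ℤ)) B).erase 0 with hDs
  have maps : ∀ p ∈ P, D p ∈ Ds := by
    intro p hp
    have h1 : ((D p).natAbs : ℝ) ≤ 3 * s := by
      rw [Nat.cast_natAbs]; push_cast; exact hDb p hp
    have h2 : (D p).natAbs ≤ B := Nat.le_floor h1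
    simp only [hDs, Finset.mem_erase, Finset.mem_Icc]
    exact ⟨hD0 p hp, by omega, by omega⟩
  set M : ℝ := 4 * (T : ℝ) ^ 5 * (8 * x * L / s + 2) with hM
  have hM0 : 0 ≤ M := by rw [hM]; positivity
  have fib : ∀ d ∈ Ds, ((P.filter (fun p => D p = d)).card : ℝ) ≤ M * (Nat.gcd d.natAbs (4 * n) : ℝ) := by
    intro d hd
    simp only [hDs, Finset.mem_erase, Finset.mem_Icc] at hd
    have hdb : |(d : ℝ)| ≤ 3 * s := by
      refine le_trans ?_ hBle
      rw [← Int.cast_abs]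
      have : |d| ≤ B := abs_le.2 hd.2
      exact_mod_cast this
    have he : 0 < 4 * (n : ℤ) - d := by
      have : (0 : ℝ) < 4 * n - d := by rw [← hs2]; nlinarith [(abs_le.1 hdb).2]
      exact_mod_cast this
    have := perD n x d hn hd.1 he hX hdb (P.filter (fun p => D p = d)) t θ
      (by intro p hp
          rw [Finset.mem_filter] at hp
          have := hPF p hp.1
          rwa [hp.2] at this)
      (by intro p hp
          rw [Finset.mem_filter] at hp
          have := hG p hp.1
          rwa [hp.2] at this) T hT
    have e1 : Int.gcd d (4 * n - d) = Nat.gcd d.natAbs (4 * n) := by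
      rw [Int.gcd_sub_right_right_of_dvd]
      · rw [Int.gcd_def]; congr 1
      · exact dvd_refl _
    rw [e1] at this
    refine this.trans ?_
    have h1 : (1 : ℝ) ≤ (Nat.gcd d.natAbs (4 * n) : ℝ) := by
      exact_mod_cast Nat.gcd_pos_of_pos_right _ (by omega)
    rw [hM]
    set h : ℝ := (Nat.gcd d.natAbs (4 * n) : ℝ)
    have : L * (8 * x * h) / s + 2 ≤ (8 * x * L / s + 2) * h := by
      have : L * (8 * x * h) / s = 8 * x * L / s * h := by ring
      rw [this]; linarith
    calc _ ≤ 4 * (T : ℝ) ^ 5 * ((8 * x * L / s + 2) * h) := by gcongr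
      _ = _ := by ring
  have tot : (P.card : ℝ) ≤ ∑ d ∈ Ds, M * (Nat.gcd d.natAbs (4 * n) : ℝ) := by
    rw [Finset.card_eq_sum_card_fiberwise maps]
    push_cast
    exact Finset.sum_le_sum fib
  have hsum : ∑ d ∈ Ds, (Nat.gcd d.natAbs (4 * n) : ℝ) ≤ 6 * s * T := by
    have hsub : Ds ⊆ (Finset.Icc 1 B).image (fun k : ℕ => (k : ℤ)) ∪ (Finset.Icc 1 B).image (fun k : ℕ => -(k : ℤ)) := by
      intro d hd
      simp only [hDs, Finset.mem_erase, Finset.mem_Icc] at hd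
      simp only [Finset.mem_union, Finset.mem_image, Finset.mem_Icc]
      rcases le_total 0 d with h | h
      · left; exact ⟨d.natAbs, by omega, by omega⟩
      · right; exact ⟨d.natAbs, by omega, by omega⟩
    have g := sum_gcd_le B (4 * n) (by omega)
    have g' : ∑ d ∈ Finset.Icc 1 B, (Nat.gcd d (4 * n) : ℝ) ≤ B * T := by
      have : ∑ d ∈ Finset.Icc 1 B, Nat.gcd d (4 * n) ≤ B * T :=
        g.trans (Nat.mul_le_mul_left _ (hT _ (by omega) (by nlinarith)))
      exact_mod_cast this
    calc _ ≤ ∑ d ∈ (Finset.Icc 1 B).image (fun k : ℕ => (k : ℤ)) ∪ (Finset.Icc 1 B).image (fun k : ℕ => -(k : ℤ)), (Nat.gcd d.natAbs (4 * n) : ℝ) :=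
          Finset.sum_le_sum_of_subset_of_nonneg hsub (fun _ _ _ => by positivity)
      _ ≤ ∑ d ∈ (Finset.Icc 1 B).image (fun k : ℕ => (k : ℤ)), (Nat.gcd d.natAbs (4 * n) : ℝ) + ∑ d ∈ (Finset.Icc 1 B).image (fun k : ℕ => -(k : ℤ)), (Nat.gcd d.natAbs (4 * n) : ℝ) := by
          rw [← Finset.sum_union_inter]
          have : 0 ≤ ∑ d ∈ (Finset.Icc 1 B).image (fun k : ℕ => (k : ℤ)) ∩ (Finset.Icc 1 B).image (fun k : ℕ => -(k : ℤ)), (Nat.gcd d.natAbs (4 * n) : ℝ) := by positivity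
          linarith
      _ = ∑ d ∈ Finset.Icc 1 B, (Nat.gcd d (4 * n) : ℝ) + ∑ d ∈ Finset.Icc 1 B, (Nat.gcd d (4 * n) : ℝ) := by
          rw [Finset.sum_image (by intro a _ b _ h; simpa using h), Finset.sum_image (by intro a _ b _ h; simpa using h)]
          simp
      _ ≤ 2 * (3 * s * T) := by
          have : (B : ℝ) * T ≤ 3 * s * T := by gcongr
          linarith
      _ = _ := by ring
  rw [← Finset.mul_sum] at tot
  calc _ ≤ _ := tot
    _ ≤ M * (6 * s * T) := mul_le_mul_of_nonneg_left hsum hM0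
    _ = 24 * (T : ℝ) ^ 6 * (8 * x * L + 2 * s) := by rw [hM]; field_simp; ring
    _ ≤ 24 * (T : ℝ) ^ 6 * (10 * (x * L)) := by
      gcongr
      nlinarith
    _ = _ := by ring


open Complex MeasureTheory Filter Topology Asymptotics in
lemma char_sum_period {q : ℕ} [NeZero q] (χ : DirichletCharacter ℂ q) (hχ : χ ≠ 1) :
    ∑ k ∈ Finset.range q, χ (k : ZMod q) = 0 := by
  rw [← MulChar.sum_eq_zero_of_ne_one hχ]
  refine Finset.sum_bij' (fun k _ => (k : ZMod q)) (fun a _ => a.val) ?_ ?_ ?_ ?_ ?_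
  · intro a _; exact Finset.mem_univ _
  · intro a _; exact Finset.mem_range.2 (ZMod.val_lt a)
  · intro a ha; exact ZMod.val_cast_of_lt (Finset.mem_range.1 ha)
  · intro a _; exact ZMod.natCast_zmod_val a
  · intro a _; rfl

lemma char_sum_range_bound {q : ℕ} [NeZero q] (χ : DirichletCharacter ℂ q) (hχ : χ ≠ 1) (N : ℕ) :
    ‖∑ k ∈ Finset.range N, χ (k : ZMod q)‖ ≤ q := by
  induction N using Nat.strong_induction_on with
  | _ N ih =>
    rcases lt_or_ge N q with h | h
    · calc _ ≤ ∑ k ∈ Finset.range N, ‖χ (k : ZMod q)‖ := norm_sum_le _ _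
        _ ≤ ∑ k ∈ Finset.range N, (1 : ℝ) := Finset.sum_le_sum (fun k _ => χ.norm_le_one _)
        _ = N := by simp
        _ ≤ q := by exact_mod_cast h.le
    · obtain ⟨M, rfl⟩ := Nat.exists_eq_add_of_le h
      rw [Finset.sum_range_add, char_sum_period χ hχ, zero_add]
      have : ∀ k ∈ Finset.range M, χ ((q + k : ℕ) : ZMod q) = χ (k : ZMod q) := by
        intro k _; simp
      rw [Finset.sum_congr rfl this]
      exact ih M (by have := NeZero.pos q; omega)

lemma char_sum_bound {q : ℕ} [NeZero q] (χ : DirichletCharacter ℂ q) (hχ : χ ≠ 1) (N : ℕ) :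
    ‖∑ k ∈ Finset.Icc 1 N, χ (k : ZMod q)‖ ≤ q := by
  have hq : q ≠ 1 := by
    rintro rfl
    exact hχ (χ.level_one)
  have h0 : χ ((0 : ℕ) : ZMod q) = 0 := by
    have : Nontrivial (ZMod q) := ZMod.nontrivial_iff.2 hq
    simpa using MulChar.map_zero χ
  have := char_sum_range_bound χ hχ (N + 1)
  rw [Finset.sum_range_succ', h0, add_zero] at this
  convert this using 2
  refine Finset.sum_bij' (fun k _ => k - 1) (fun k _ => k + 1) ?_ ?_ ?_ ?_ ?_
  · intro a ha; simp only [Finset.mem_Icc, Finset.mem_range] at *; omega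
  · intro a ha; simp only [Finset.mem_Icc, Finset.mem_range] at *; omega
  · intro a ha; simp only [Finset.mem_Icc, Finset.mem_range] at *; omega
  · intro a ha; simp only [Finset.mem_Icc, Finset.mem_range] at *; omega
  · intro a ha
    simp only [Finset.mem_Icc] at ha
    rw [Nat.sub_add_cancel ha.1]

/-- summatory function -/
noncomputable def cS {q : ℕ} (χ : DirichletCharacter ℂ q) (t : ℝ) : ℂ := ∑ k ∈ Finset.Icc 1 ⌊t⌋₊, χ (k : ZMod q)

lemma cS_meas {q : ℕ} (χ : DirichletCharacter ℂ q) : Measurable (cS χ) := by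
  have : cS χ = (fun n : ℕ => ∑ k ∈ Finset.Icc 1 n, χ (k : ZMod q)) ∘ (fun t : ℝ => ⌊t⌋₊) := rfl
  rw [this]
  exact (measurable_from_top).comp Nat.measurable_floor

lemma cS_bound {q : ℕ} [NeZero q] (χ : DirichletCharacter ℂ q) (hχ : χ ≠ 1) (t : ℝ) : ‖cS χ t‖ ≤ q :=
  char_sum_bound χ hχ _

open Complex MeasureTheory Filter Topology Asymptotics in
lemma L_integral {q : ℕ} [NeZero q] (χ : DirichletCharacter ℂ q) (hχ : χ ≠ 1) {s : ℂ} (hs : 0 < s.re) :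
    χ.LFunction s = s * ∫ t in Set.Ioi (1 : ℝ), cS χ t * (t : ℂ) ^ (-(s + 1)) := by
  set f : ℝ → ℂ := Set.indicator (Set.Ioi 1) (cS χ) with hf
  have fb : ∀ t, ‖f t‖ ≤ q := by
    intro t
    rw [hf, Set.indicator_apply]
    split_ifs
    · exact cS_bound χ hχ t
    · simp
  have hfm : Measurable f := (cS_meas χ).indicator measurableSet_Ioi
  have hmel : ∀ s : ℂ, mellin f (-s) = ∫ t in Set.Ioi (1 : ℝ), cS χ t * (t : ℂ) ^ (-(s + 1)) := by
    intro s
    rw [mellin]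
    have e : ∀ t : ℝ, (t : ℂ) ^ (-s - 1) • f t = Set.indicator (Set.Ioi 1) (fun t : ℝ => cS χ t * (t : ℂ) ^ (-(s + 1))) t := by
      intro t
      rw [hf, Set.indicator_apply, Set.indicator_apply]
      split_ifs
      · rw [smul_eq_mul, mul_comm]; congr 2; ring
      · simp
    simp_rw [e]
    rw [setIntegral_indicator measurableSet_Ioi]
    congr 2
    ext t; simp only [Set.mem_inter_iff, Set.mem_Ioi]
    constructor
    · intro h; exact h.2
    · intro h; exact ⟨by linarith, h⟩
  have hloc : LocallyIntegrableOn f (Set.Ioi 0) := by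
    apply LocallyIntegrable.locallyIntegrableOn
    apply (locallyIntegrable_const (q : ℝ)).mono hfm.aestronglyMeasurable
    refine Eventually.of_forall fun t => ?_
    simpa using fb t
  have htop : f =O[atTop] (fun t : ℝ => t ^ (-(0:ℝ))) := by
    refine IsBigO.of_bound q (Eventually.of_forall fun t => ?_)
    simpa using fb t
  have hbot : ∀ b : ℝ, f =O[𝓝[>] 0] (fun t : ℝ => t ^ (-b)) := by
    intro b
    have : f =ᶠ[𝓝[>] 0] (fun _ => (0 : ℂ)) := by
      have : Set.Iio (1 : ℝ) ∈ 𝓝[>] (0 : ℝ) := mem_nhdsWithin_of_mem_nhds (Iio_mem_nhds one_pos)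
      filter_upwards [this] with t ht
      rw [hf, Set.indicator_apply, if_neg]
      simpa using le_of_lt ht
    exact this.trans_isBigO (isBigO_zero _ _)
  have hdiff : ∀ s : ℂ, 0 < s.re → DifferentiableAt ℂ (fun s => s * mellin f (-s)) s := by
    intro s hs
    have h1 : DifferentiableAt ℂ (mellin f) (-s) :=
      mellin_differentiableAt_of_isBigO_rpow hloc htop (by simpa using hs) (hbot ((-s).re - 1)) (by linarith)
    exact differentiableAt_id.mul (h1.comp s differentiableAt_id.neg)
  have hU : IsOpen {s : ℂ | 0 < s.re} := isOpen_lt continuous_const continuous_re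
  have hconn : IsPreconnected {s : ℂ | 0 < s.re} := (convex_halfSpace_re_gt 0).isPreconnected
  have hA1 : AnalyticOnNhd ℂ χ.LFunction {s : ℂ | 0 < s.re} :=
    (DirichletCharacter.differentiable_LFunction hχ).differentiableOn.analyticOnNhd hU
  have hA2 : AnalyticOnNhd ℂ (fun s => s * mellin f (-s)) {s : ℂ | 0 < s.re} :=
    DifferentiableOn.analyticOnNhd (fun s hs => (hdiff s hs).differentiableWithinAt) hU
  have heq : χ.LFunction =ᶠ[𝓝 2] (fun s => s * mellin f (-s)) := by
    have : {s : ℂ | 1 < s.re} ∈ 𝓝 (2 : ℂ) := (isOpen_lt continuous_const continuous_re).mem_nhds (by simp)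
    filter_upwards [this] with s hs
    have hs : 1 < s.re := hs
    rw [DirichletCharacter.LFunction_eq_LSeries χ hs, hmel]
    rw [LSeries_eq_mul_integral (fun n => χ (n : ZMod q)) (r := 0) le_rfl (by linarith)]
    · rfl
    · exact DirichletCharacter.LSeriesSummable_of_one_lt_re χ hs
    · refine IsBigO.of_bound q (Eventually.of_forall fun t => ?_)
      simpa using char_sum_bound χ hχ t
  have := hA1.eqOn_of_preconnected_of_eventuallyEq hA2 hconn (z₀ := 2) (by simp) heq hs
  rw [this]
  simp only [hmel]

open Complex MeasureTheory in
lemma L_bound {q : ℕ} [NeZero q] (χ : DirichletCharacter ℂ q) (hχ : χ ≠ 1) {s : ℂ} (hs : 0 < s.re) :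
    ‖χ.LFunction s‖ ≤ ‖s‖ * (q / s.re) := by
  rw [L_integral χ hχ hs, norm_mul]
  gcongr
  have h1 : ∫ t in Set.Ioi (1 : ℝ), (q : ℝ) * t ^ (-(s.re + 1)) = q / s.re := by
    rw [integral_const_mul, integral_Ioi_rpow_of_lt (by linarith) one_pos]
    simp only [Real.one_rpow]
    rw [show -(s.re + 1) + 1 = -s.re by ring]
    field_simp
  rw [← h1]
  apply norm_integral_le_of_norm_le
  · exact (integrableOn_Ioi_rpow_of_lt (by linarith) one_pos).const_mul _
  · filter_upwards [ae_restrict_mem measurableSet_Ioi] with t ht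
    have ht0 : 0 < t := lt_trans one_pos ht
    rw [norm_mul, norm_cpow_eq_rpow_re_of_pos ht0]
    simp only [neg_re, add_re, one_re]
    gcongr
    exact cS_bound χ hχ t


open Complex MeasureTheory in
lemma L_partial {q : ℕ} [NeZero q] (χ : DirichletCharacter ℂ q) (hχ : χ ≠ 1) (N : ℕ) (hN : 1 ≤ N) :
    ‖χ.LFunction 1 - ∑ k ∈ Finset.Icc 1 N, χ (k : ZMod q) / k‖ ≤ 2 * q / N := by
  have hN0 : (0:ℝ) < N := by exact_mod_cast hN
  have hq : q ≠ 1 := by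
    rintro rfl
    exact hχ (χ.level_one)
  have h0 : χ ((0 : ℕ) : ZMod q) = 0 := by
    have : Nontrivial (ZMod q) := ZMod.nontrivial_iff.2 hq
    simpa using MulChar.map_zero χ
  have hsum : ∀ (g : ℕ → ℂ) (m : ℕ), g 0 = 0 → ∑ k ∈ Finset.Icc 0 m, g k = ∑ k ∈ Finset.Icc 1 m, g k := by
    intro g m hg
    symm
    apply Finset.sum_subset
    · intro a; simp
    · intro a ha hb
      have : a = 0 := by
        simp only [Finset.mem_Icc] at ha hb; omega
      rw [this, hg]
  have hder : ∀ t : ℝ, 0 < t → HasDerivAt (fun t : ℝ => ((t⁻¹ : ℝ) : ℂ)) ((-(t^2)⁻¹ : ℝ) : ℂ) t := by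
    intro t ht
    exact (hasDerivAt_inv ht.ne').ofReal_comp
  have hd : ∀ t : ℝ, 0 < t → deriv (fun t : ℝ => ((t⁻¹ : ℝ) : ℂ)) t = ((-(t^2)⁻¹ : ℝ) : ℂ) :=
    fun t ht => (hder t ht).deriv
  have hcont : ContinuousOn (fun t : ℝ => ((-(t^2)⁻¹ : ℝ) : ℂ)) (Set.Icc 1 (N:ℝ)) := by
    apply continuous_ofReal.comp_continuousOn
    apply ContinuousOn.neg
    apply ContinuousOn.inv₀ (by fun_prop)
    intro t ht
    have := ht.1
    positivity
  have abel := sum_mul_eq_sub_integral_mul₀' (f := fun t : ℝ => ((t⁻¹ : ℝ) : ℂ)) (fun k : ℕ => χ (k : ZMod q)) h0 N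
    (fun t ht => (hder t (lt_of_lt_of_le one_pos ht.1)).differentiableAt)
    (by
      apply (hcont.integrableOn_Icc).congr_fun _ measurableSet_Icc
      intro t ht
      exact (hd t (lt_of_lt_of_le one_pos ht.1)).symm)
  rw [hsum _ _ (by simp [h0]), hsum _ _ h0] at abel
  have e1 : ∑ k ∈ Finset.Icc 1 N, χ (k : ZMod q) / k = ∑ k ∈ Finset.Icc 1 N, (((k:ℝ)⁻¹ : ℝ) : ℂ) * χ (k : ZMod q) := by
    apply Finset.sum_congr rfl
    intro k _
    push_cast
    rw [div_eq_mul_inv, mul_comm]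
  set h : ℝ → ℂ := fun t => cS χ t * (((t^2)⁻¹ : ℝ) : ℂ) with hh
  have e2 : ∫ t in Set.Ioc (1:ℝ) N, deriv (fun t : ℝ => ((t⁻¹ : ℝ) : ℂ)) t * ∑ k ∈ Finset.Icc 0 ⌊t⌋₊, χ (k : ZMod q)
      = - ∫ t in Set.Ioc (1:ℝ) N, h t := by
    rw [← integral_neg]
    apply setIntegral_congr_fun measurableSet_Ioc
    intro t ht
    simp only
    rw [hd t (lt_trans one_pos ht.1), hsum _ _ h0, hh]
    simp only [cS]
    push_cast; ring
  have e3 : χ.LFunction 1 = ∫ t in Set.Ioi (1:ℝ), h t := by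
    rw [L_integral χ hχ (by simp), one_mul]
    apply setIntegral_congr_fun measurableSet_Ioi
    intro t ht
    have ht0 : (0:ℝ) < t := lt_trans one_pos ht
    simp only [hh]
    congr 1
    rw [show (-(1+1) : ℂ) = ((-2 : ℝ) : ℂ) by push_cast; norm_num, ← ofReal_cpow ht0.le, Real.rpow_neg ht0.le]
    norm_num
  have hb : ∀ t : ℝ, 0 < t → ‖h t‖ ≤ q * t ^ (-2 : ℝ) := by
    intro t ht
    rw [hh]
    simp only
    rw [norm_mul, norm_real, Real.norm_of_nonneg (by positivity), Real.rpow_neg ht.le]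
    norm_num
    gcongr
    exact cS_bound χ hχ t
  have hm : Measurable h := by
    apply (cS_meas χ).mul
    exact measurable_ofReal.comp (by fun_prop)
  have hIntg : ∀ c : ℝ, 0 < c → IntegrableOn h (Set.Ioi c) := by
    intro c hc
    apply Integrable.mono' ((integrableOn_Ioi_rpow_of_lt (a := -2) (by norm_num) hc).const_mul (q:ℝ)) hm.aestronglyMeasurable
    filter_upwards [ae_restrict_mem measurableSet_Ioi] with t ht
    exact hb t (lt_trans hc ht)
  have e4 : ∫ t in Set.Ioi (1:ℝ), h t = (∫ t in Set.Ioc (1:ℝ) N, h t) + ∫ t in Set.Ioi (N:ℝ), h t := by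
    have h1N : (1:ℝ) ≤ N := by exact_mod_cast hN
    rw [← setIntegral_union (Set.Ioc_disjoint_Ioi le_rfl) measurableSet_Ioi, Set.Ioc_union_Ioi_eq_Ioi h1N]
    · exact (hIntg 1 one_pos).mono_set Set.Ioc_subset_Ioi_self
    · exact hIntg N hN0
  have e5 : ‖∫ t in Set.Ioi (N:ℝ), h t‖ ≤ q / N := by
    have h1 : ∫ t in Set.Ioi (N : ℝ), (q : ℝ) * t ^ (-2:ℝ) = q / N := by
      rw [integral_const_mul, integral_Ioi_rpow_of_lt (by norm_num) hN0]
      rw [show (-2:ℝ)+1 = -1 by norm_num, Real.rpow_neg_one]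
      field_simp
    rw [← h1]
    apply norm_integral_le_of_norm_le
    · exact (integrableOn_Ioi_rpow_of_lt (by norm_num) hN0).const_mul _
    · filter_upwards [ae_restrict_mem measurableSet_Ioi] with t ht
      exact hb t (lt_trans hN0 ht)
  have e6 : χ.LFunction 1 - ∑ k ∈ Finset.Icc 1 N, χ (k : ZMod q) / k =
      (∫ t in Set.Ioi (N:ℝ), h t) - (((N:ℝ)⁻¹ : ℝ) : ℂ) * ∑ k ∈ Finset.Icc 1 N, χ (k : ZMod q) := by
    rw [e1, abel, e2, e3, e4]; ring
  rw [e6]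
  calc _ ≤ ‖∫ t in Set.Ioi (N:ℝ), h t‖ + ‖(((N:ℝ)⁻¹ : ℝ) : ℂ) * ∑ k ∈ Finset.Icc 1 N, χ (k : ZMod q)‖ := norm_sub_le _ _
    _ ≤ q / N + (N:ℝ)⁻¹ * q := by
        gcongr
        rw [norm_mul, norm_real, Real.norm_of_nonneg (by positivity)]
        gcongr
        exact char_sum_bound χ hχ N
    _ = 2 * q / N := by ring

lemma L_one_upper {q : ℕ} [NeZero q] (χ : DirichletCharacter ℂ q) (hχ : χ ≠ 1) :
    ‖χ.LFunction 1‖ ≤ 3 + Real.log q := by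
  have hq : 0 < q := NeZero.pos q
  have hq0 : (0:ℝ) < q := by exact_mod_cast hq
  have h1 := L_partial χ hχ q hq
  have h2 : ‖∑ k ∈ Finset.Icc 1 q, χ (k : ZMod q) / k‖ ≤ 1 + Real.log q := by
    calc _ ≤ ∑ k ∈ Finset.Icc 1 q, ‖χ (k : ZMod q) / k‖ := norm_sum_le _ _
      _ ≤ ∑ k ∈ Finset.Icc 1 q, ((k:ℝ)⁻¹) := by
          apply Finset.sum_le_sum
          intro k _
          rw [norm_div, Complex.norm_natCast, div_eq_mul_inv]
          have := χ.norm_le_one (k : ZMod q)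
          have h3 : (0:ℝ) ≤ (k:ℝ)⁻¹ := by positivity
          nlinarith
      _ = (harmonic q : ℝ) := by
          rw [harmonic_eq_sum_Icc]; push_cast; rfl
      _ ≤ 1 + Real.log q := harmonic_le_one_add_log q
  have h3 : 2 * (q:ℝ) / q = 2 := by field_simp
  rw [h3] at h1
  calc ‖χ.LFunction 1‖ = ‖(χ.LFunction 1 - ∑ k ∈ Finset.Icc 1 q, χ (k : ZMod q) / k) + ∑ k ∈ Finset.Icc 1 q, χ (k : ZMod q) / k‖ := by congr 1; ring
    _ ≤ _ := norm_add_le _ _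
    _ ≤ _ := by linarith


/-- arithmetic function from a sequence -/
noncomputable def aF (c : ℕ → ℂ) : ArithmeticFunction ℂ := toArithmeticFunction c

lemma aF_apply (c : ℕ → ℂ) {n : ℕ} (hn : n ≠ 0) : aF c n = c n := by
  simp [aF, toArithmeticFunction, hn]

/-- logarithmic derivative relation -/
def LD (f g : ArithmeticFunction ℂ) : Prop := ∀ n : ℕ, (Real.log n : ℂ) * f n = (f * g) n

lemma LD.mul {f g f' g' : ArithmeticFunction ℂ} (h : LD f g) (h' : LD f' g') : LD (f * f') (g + g') := by
  intro n
  have e : f * f' * (g + g') = (f * g) * f' + f * (f' * g') := by ring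
  rw [e, ArithmeticFunction.add_apply, ArithmeticFunction.mul_apply, ArithmeticFunction.mul_apply, ArithmeticFunction.mul_apply,
    Finset.mul_sum, ← Finset.sum_add_distrib]
  apply Finset.sum_congr rfl
  intro p hp
  rw [Nat.mem_divisorsAntidiagonal] at hp
  rw [← h, ← h']
  have h1 : p.1 ≠ 0 := by rintro h; rw [h] at hp; simp at hp; exact hp.2 hp.1.symm
  have h2 : p.2 ≠ 0 := by rintro h; rw [h] at hp; simp at hp; exact hp.2 hp.1.symm
  rw [← hp.1]
  push_cast
  rw [Real.log_mul (by exact_mod_cast h1) (by exact_mod_cast h2)]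
  push_cast
  ring

lemma LD_aF (c : ℕ → ℂ) (hc : ∀ m n, c (m * n) = c m * c n) :
    LD (aF c) (aF (fun n => c n * (ArithmeticFunction.vonMangoldt n : ℂ))) := by
  intro n
  rcases eq_or_ne n 0 with rfl | hn
  · simp
  rw [ArithmeticFunction.mul_apply, aF_apply _ hn]
  have : ∀ p ∈ n.divisorsAntidiagonal, aF c p.1 * aF (fun n => c n * (ArithmeticFunction.vonMangoldt n : ℂ)) p.2
      = c n * (ArithmeticFunction.vonMangoldt p.2 : ℂ) := by
    intro p hp
    rw [Nat.mem_divisorsAntidiagonal] at hp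
    have h1 : p.1 ≠ 0 := by rintro h; rw [h] at hp; simp at hp; exact hp.2 hp.1.symm
    have h2 : p.2 ≠ 0 := by rintro h; rw [h] at hp; simp at hp; exact hp.2 hp.1.symm
    rw [aF_apply _ h1, aF_apply _ h2, ← hp.1, hc]
    ring
  rw [Finset.sum_congr rfl this, ← Finset.mul_sum,
    Nat.sum_divisorsAntidiagonal' (f := fun _ b => ((ArithmeticFunction.vonMangoldt b : ℝ) : ℂ)),
    ← Complex.ofReal_sum, ArithmeticFunction.vonMangoldt_sum]
  ring

open ComplexOrder in
lemma LD.nonneg {f g : ArithmeticFunction ℂ} (h : LD f g) (h1 : 0 ≤ f 1) (hg1 : g 1 = 0) (hg : ∀ n, 0 ≤ g n) (n : ℕ) :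
    0 ≤ f n := by
  induction n using Nat.strong_induction_on with
  | _ n ih =>
    rcases lt_or_ge n 2 with h2 | h2
    · interval_cases n
      · simp
      · exact h1
    have hs : 0 ≤ (f * g) n := by
      rw [ArithmeticFunction.mul_apply]
      apply Finset.sum_nonneg
      intro p hp
      rw [Nat.mem_divisorsAntidiagonal] at hp
      rcases eq_or_ne p.2 1 with h3 | h3
      · rw [h3, hg1]; simp
      · apply mul_nonneg (ih _ _) (hg _)
        have h20 : p.2 ≠ 0 := by rintro h; rw [h] at hp; simp at hp; exact hp.2 hp.1.symm
        have h10 : p.1 ≠ 0 := by rintro h; rw [h] at hp; simp at hp; exact hp.2 hp.1.symm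
        rw [← hp.1]
        have : 2 ≤ p.2 := by omega
        have := Nat.pos_of_ne_zero h10
        nlinarith
    rw [← h n] at hs
    have hl : 0 < Real.log n := Real.log_pos (by exact_mod_cast h2)
    have : f n = ((Real.log n)⁻¹ : ℝ) * ((Real.log n : ℂ) * f n) := by
      rw [← mul_assoc, ← Complex.ofReal_mul, inv_mul_cancel₀ hl.ne']; simp
    rw [this]
    apply mul_nonneg _ hs
    rw [Complex.zero_le_real]
    positivity

/-- the coefficients -/
noncomputable def rF (c1 c2 : ℕ → ℂ) : ArithmeticFunction ℂ := aF 1 * aF c1 * aF c2 * aF (c1 * c2)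

lemma rF_one (c1 c2 : ℕ → ℂ) (h1 : c1 1 = 1) (h2 : c2 1 = 1) : rF c1 c2 1 = 1 := by
  simp [rF, ArithmeticFunction.mul_apply, aF_apply, h1, h2]

open ComplexOrder in
lemma rF_nonneg (c1 c2 : ℕ → ℂ) (h1 : c1 1 = 1) (h2 : c2 1 = 1)
    (m1 : ∀ m n, c1 (m * n) = c1 m * c1 n) (m2 : ∀ m n, c2 (m * n) = c2 m * c2 n)
    (v1 : ∀ n, c1 n = 0 ∨ c1 n = 1 ∨ c1 n = -1) (v2 : ∀ n, c2 n = 0 ∨ c2 n = 1 ∨ c2 n = -1) (n : ℕ) :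
    0 ≤ rF c1 c2 n := by
  have H := (((LD_aF 1 (by simp)).mul (LD_aF c1 m1)).mul (LD_aF c2 m2)).mul
    (LD_aF (c1 * c2) (by intro m n; simp only [Pi.mul_apply, m1, m2]; ring))
  refine LD.nonneg H ?_ ?_ ?_ n
  · have := rF_one c1 c2 h1 h2
    unfold rF at this
    rw [this]; exact zero_le_one
  · simp [aF_apply]
  · intro n
    rcases eq_or_ne n 0 with rfl | hn
    · simp
    simp only [ArithmeticFunction.add_apply, aF_apply _ hn, Pi.one_apply, Pi.mul_apply]
    have hL : (0:ℂ) ≤ (ArithmeticFunction.vonMangoldt n : ℂ) := by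
      rw [Complex.zero_le_real]; exact ArithmeticFunction.vonMangoldt_nonneg
    have e : (1 * (ArithmeticFunction.vonMangoldt n : ℂ) + c1 n * (ArithmeticFunction.vonMangoldt n : ℂ) +
      c2 n * (ArithmeticFunction.vonMangoldt n : ℂ) + c1 n * c2 n * (ArithmeticFunction.vonMangoldt n : ℂ))
       = (1 + c1 n) * (1 + c2 n) * (ArithmeticFunction.vonMangoldt n : ℂ) := by ring
    rw [e]
    apply mul_nonneg _ hL
    have two : (0:ℂ) ≤ 1 + 1 := add_nonneg zero_le_one zero_le_one
    apply mul_nonneg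
    · rcases v1 n with h | h | h <;> rw [h] <;> simp [two]
    · rcases v2 n with h | h | h <;> rw [h] <;> simp [two]

open LSeries in
lemma rF_LSeries (c1 c2 : ℕ → ℂ) (b1 : ∀ n, ‖c1 n‖ ≤ 1) (b2 : ∀ n, ‖c2 n‖ ≤ 1) {s : ℂ} (hs : 1 < s.re) :
    LSeriesSummable (rF c1 c2) s ∧ LSeries (rF c1 c2) s = riemannZeta s * LSeries c1 s * LSeries c2 s * LSeries (c1 * c2) s := by
  have key : ∀ c : ℕ → ℂ, (∀ n, ‖c n‖ ≤ 1) → LSeriesSummable (aF c) s := by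
    intro c hc
    refine LSeriesSummable_of_bounded_of_one_lt_re (m := 1) (fun n hn => ?_) hs
    rw [aF_apply _ hn]; exact hc n
  have eqs : ∀ c : ℕ → ℂ, LSeries (aF c) s = LSeries c s := by
    intro c
    exact LSeries_congr (fun hn => aF_apply c hn) s
  have s0 := key 1 (by simp)
  have s1 := key c1 b1
  have s2 := key c2 b2
  have s3 := key (c1 * c2) (by
    intro n; rw [Pi.mul_apply, norm_mul]
    exact mul_le_one₀ (b1 n) (norm_nonneg _) (b2 n))
  have t1 := ArithmeticFunction.LSeriesSummable_mul s0 s1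
  have t2 := ArithmeticFunction.LSeriesSummable_mul t1 s2
  refine ⟨ArithmeticFunction.LSeriesSummable_mul t2 s3, ?_⟩
  unfold rF
  rw [ArithmeticFunction.LSeries_mul' t2 s3, ArithmeticFunction.LSeries_mul' t1 s2, ArithmeticFunction.LSeries_mul' s0 s1,
    eqs, eqs, eqs, eqs, LSeries_one_eq_riemannZeta hs]


open Complex Metric Topology Filter ComplexOrder in
lemma siegel_coef (G : ℂ → ℂ) (hG : Differentiable ℂ G) (r : ℕ → ℂ) (hr : 0 ≤ r) (hr1 : r 1 = 1)
    (hsum : ∀ s : ℂ, 1 < s.re → LSeriesSummable r s) (hGr : ∀ s : ℂ, 1 < s.re → G s = (s - 1) * LSeries r s)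
    (M : ℝ) (hM : ∀ s ∈ closedBall (2:ℂ) (4/3), ‖G s‖ ≤ M) :
    ∃ b : ℕ → ℝ, (∀ m, 0 ≤ b m) ∧ 1 ≤ b 0 ∧ (∀ m, ‖(b m : ℂ) - G 1‖ ≤ 6 * M * (3/4)^m) ∧
      ∀ x : ℝ, 2/3 < x → x ≤ 2 → HasSum (fun m => ((b m : ℂ) - G 1) * ((2 - x : ℝ) : ℂ)^m) (dslope G 1 x) := by
  have hg : Differentiable ℂ (dslope G 1) := by
    rw [← differentiableOn_univ]
    exact (Complex.differentiableOn_dslope univ_mem).2 hG.differentiableOn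
  have habs : LSeries.abscissaOfAbsConv r ≤ 1 :=
    LSeries.abscissaOfAbsConv_le_of_forall_lt_LSeriesSummable (x := 1) (fun y hy => hsum y (by simpa using hy))
  have habs2 : LSeries.abscissaOfAbsConv r < ((2:ℝ) : EReal) := lt_of_le_of_lt habs (by exact_mod_cast one_lt_two)
  have hpos := fun m => LSeries.iteratedDeriv_alternating hr habs2 m
  have hU : {s : ℂ | 1 < s.re} ∈ 𝓝 (2 : ℂ) := (isOpen_lt continuous_const continuous_re).mem_nhds (by simp)
  have heq : dslope G 1 =ᶠ[𝓝 2] (fun s => LSeries r s - G 1 * (1 * s - 1)⁻¹) := by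
    filter_upwards [hU] with s hs
    have hs : 1 < s.re := hs
    have hs1 : s ≠ 1 := by rintro rfl; simp at hs
    have hs2 : s - 1 ≠ 0 := sub_ne_zero.2 hs1
    rw [dslope_of_ne _ hs1, slope_def_field, hGr s hs, one_mul]
    field_simp
  have han : ContDiffAt ℂ ⊤ (LSeries r) 2 := by
    apply AnalyticAt.contDiffAt
    apply LSeries_analyticOnNhd r
    show LSeries.abscissaOfAbsConv r < _
    simpa using habs2
  have hinv : ContDiffAt ℂ ⊤ (fun s : ℂ => G 1 * (1 * s - 1)⁻¹) 2 := by
    apply ContDiffAt.mul contDiffAt_const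
    apply ContDiffAt.inv
    · fun_prop
    · norm_num
  have hit : ∀ m, iteratedDeriv m (dslope G 1) 2 = iteratedDeriv m (LSeries r) 2 - G 1 * ((-1)^m * m.factorial) := by
    intro m
    rw [heq.iteratedDeriv_eq, iteratedDeriv_fun_sub (han.of_le le_top) (hinv.of_le le_top), iteratedDeriv_const_mul_field,
      iteratedDeriv_eq_iterate (f := fun s : ℂ => (1 * s - 1)⁻¹), iter_deriv_inv_linear_sub]
    norm_num
  have hbex : ∀ m, ∃ b : ℝ, 0 ≤ b ∧ (b : ℂ) = (-1)^m * iteratedDeriv m (LSeries r) 2 * (m.factorial : ℂ)⁻¹ := by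
    intro m
    have h := hpos m
    rw [Complex.nonneg_iff] at h
    refine ⟨((-1)^m * iteratedDeriv m (LSeries r) (2:ℝ)).re * (m.factorial : ℝ)⁻¹, mul_nonneg h.1 (by positivity), ?_⟩
    push_cast
    congr 1
    apply Complex.ext
    · simp
    · have h2 := h.2
      simp only [ofReal_ofNat] at h2
      rw [← h2]; simp
  choose b hb0 hb using hbex
  have hm1 : ∀ m : ℕ, ((-1:ℂ)^m) * (-1)^m = 1 := by
    intro m; rw [← mul_pow]; simp
  have hfac : ∀ m : ℕ, (m.factorial : ℂ) ≠ 0 := fun m => by exact_mod_cast m.factorial_ne_zero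
  have hcoef : ∀ m, iteratedDeriv m (dslope G 1) 2 = (-1)^m * m.factorial * ((b m : ℂ) - G 1) := by
    intro m
    rw [hit, hb]
    have := hm1 m
    have h2 := hfac m
    field_simp
    linear_combination (-iteratedDeriv m (LSeries r) 2) * this
  refine ⟨b, hb0, ?_, ?_, ?_⟩
  · have h0 := hb 0
    have hs2 := hsum 2 (by simp)
    have : (1:ℂ) ≤ LSeries r 2 := by
      unfold LSeries
      have h1 : LSeries.term r 2 1 = 1 := by simp [LSeries.term_def, hr1]
      rw [← h1]
      refine hs2.le_tsum 1 (fun j _ => ?_)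
      have := LSeries.term_nonneg (hr j) 2
      simpa using this
    simp only [pow_zero, one_mul, iteratedDeriv_zero, Nat.factorial_zero, Nat.cast_one, inv_one, mul_one] at h0
    rw [← h0] at this
    exact_mod_cast this
  · intro m
    have hC := Complex.norm_iteratedDeriv_le_of_forall_mem_sphere_norm_le (c := 2) (R := 4/3) (C := 6 * M) m (by norm_num)
      hg.diffContOnCl (f := dslope G 1) (by
        intro z hz
        rw [mem_sphere_iff_norm] at hz
        have hz1 : 1/3 ≤ ‖z - 1‖ := by
          have : ‖z - 2‖ ≤ ‖z - 1‖ + ‖(1:ℂ)‖ := by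
            rw [show z - 2 = (z - 1) - 1 by ring]; exact norm_sub_le _ _
          rw [hz, norm_one] at this
          linarith
        have hne : z ≠ 1 := by rintro rfl; norm_num at hz1
        rw [dslope_of_ne _ hne, slope_def_field, norm_div, div_le_iff₀ (by linarith)]
        have h1 := hM z (by rw [mem_closedBall_iff_norm, hz])
        have h2 := hM 1 (by rw [mem_closedBall_iff_norm]; norm_num)
        have h3 := norm_sub_le (G z) (G 1)
        have hM0 : 0 ≤ M := (norm_nonneg _).trans h2
        nlinarith)
    rw [hcoef, norm_mul, norm_mul, norm_pow, norm_neg, norm_one, one_pow, one_mul, Complex.norm_natCast] at hC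
    have hf : (0:ℝ) < m.factorial := by exact_mod_cast m.factorial_pos
    rw [mul_div_assoc] at hC
    have h4 := le_of_mul_le_mul_left hC hf
    refine h4.trans_eq ?_
    rw [div_eq_mul_inv, ← inv_pow]; norm_num
  · intro x hx hx2
    have := Complex.hasSum_taylorSeries_on_ball (c := 2) (r := 4/3) (f := dslope G 1) hg.differentiableOn (z := (x:ℂ)) (by
      rw [mem_ball_iff_norm, show (x:ℂ) - 2 = ((x - 2 : ℝ) : ℂ) by push_cast; rfl, norm_real, Real.norm_eq_abs, abs_lt]
      constructor <;> linarith)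
    suffices key : ∀ m : ℕ, ((b m : ℂ) - G 1) * ((2 - x : ℝ) : ℂ)^m = (m.factorial : ℂ)⁻¹ • ((x:ℂ) - 2)^m • iteratedDeriv m (dslope G 1) 2 by
      rw [funext key]; exact this
    intro m
    rw [hcoef]
    simp only [smul_eq_mul]
    have h2 := hfac m
    have e : ((2 - x : ℝ) : ℂ)^m = (-1)^m * ((x:ℂ) - 2)^m := by
      rw [← mul_pow]; push_cast; congr 1; ring
    rw [e]
    field_simp

open Complex Metric Topology Filter ComplexOrder in
lemma siegel_core (G : ℂ → ℂ) (hG : Differentiable ℂ G) (r : ℕ → ℂ) (hr : 0 ≤ r) (hr1 : r 1 = 1)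
    (hsum : ∀ s : ℂ, 1 < s.re → LSeriesSummable r s) (hGr : ∀ s : ℂ, 1 < s.re → G s = (s - 1) * LSeries r s)
    (M : ℝ) (hM : ∀ s ∈ closedBall (2:ℂ) (4/3), ‖G s‖ ≤ M) (β : ℝ) (hβ : 7/8 ≤ β) (hβ1 : β < 1)
    (hz : G β = 0 ∨ ∀ x : ℝ, β ≤ x → x ≤ 2 → G x ≠ 0) (N : ℕ) (hN : 6 * M * (32/5) * (27/32)^N ≤ 1/2) :
    (1 - β) / 2 ≤ ‖G 1‖ * (2 - β)^N := by
  obtain ⟨b, hb0, hb1, hbM, hS⟩ := siegel_coef G hG r hr hr1 hsum hGr M hM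
  have hM0 : 0 ≤ M := (norm_nonneg _).trans (hM 1 (by rw [mem_closedBall_iff_norm]; norm_num))
  have hGd : ∀ x : ℂ, G x = G 1 + (x - 1) * dslope G 1 x := by
    intro x
    have := sub_smul_dslope G 1 x
    rw [smul_eq_mul] at this
    rw [this]; ring
  have habs : LSeries.abscissaOfAbsConv r ≤ 1 :=
    LSeries.abscissaOfAbsConv_le_of_forall_lt_LSeriesSummable (x := 1) (fun y hy => hsum y (by simpa using hy))
  have hGpos : ∀ x : ℝ, 1 < x → 0 < G x := by
    intro x hx
    rw [hGr x (by simpa using hx)]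
    apply mul_pos
    · rw [show (x:ℂ) - 1 = ((x - 1 : ℝ) : ℂ) by push_cast; rfl]
      rw [Complex.zero_lt_real]; linarith
    · exact LSeries.positive hr (by rw [hr1]; exact zero_lt_one) (lt_of_le_of_lt habs (by exact_mod_cast hx))
  have hGc : Continuous (fun x : ℝ => G x) := hG.continuous.comp continuous_ofReal
  have him1 : (G 1).im = 0 := by
    have hc : Tendsto (fun x : ℝ => (G x).im) (𝓝[>] 1) (𝓝 (G (1:ℝ)).im) :=
      ((continuous_im.comp hGc).tendsto 1).mono_left nhdsWithin_le_nhds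
    have hc2 : Tendsto (fun x : ℝ => (G x).im) (𝓝[>] 1) (𝓝 0) := by
      apply tendsto_const_nhds.congr'
      filter_upwards [self_mem_nhdsWithin] with x hx
      exact (Complex.pos_iff.1 (hGpos x hx)).2
    have := tendsto_nhds_unique hc hc2
    simpa using this
  have him : ∀ x : ℝ, β ≤ x → x ≤ 2 → (G x).im = 0 := by
    intro x hx hx2
    have h1 := Complex.hasSum_im (hS x (by linarith) hx2)
    have h2 : ∀ m, (((b m : ℂ) - G 1) * ((2 - x : ℝ) : ℂ)^m).im = 0 := by
      intro m
      rw [← ofReal_pow, im_mul_ofReal]; simp [him1]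
    have h3 : (dslope G 1 x).im = 0 := by
      apply h1.unique
      simp_rw [h2]
      exact hasSum_zero
    rw [hGd]
    rw [show (x:ℂ) - 1 = ((x - 1 : ℝ) : ℂ) by push_cast; rfl]
    simp [him1, h3]
  have hre : 0 ≤ (G β).re := by
    rcases hz with h | h
    · rw [h]; simp
    by_contra hlt
    push Not at hlt
    have h2 : 0 < (G (2:ℝ)).re := (Complex.pos_iff.1 (hGpos 2 (by norm_num))).1
    have hiv := intermediate_value_Icc (show β ≤ 2 by linarith) (continuous_re.comp hGc).continuousOn
    obtain ⟨x, hx, hx0⟩ := hiv (show (0:ℝ) ∈ Set.Icc _ _ from ⟨hlt.le, h2.le⟩)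
    exact h x hx.1 hx.2 (Complex.ext hx0 (him x hx.1 hx.2))
  set u := 2 - β with hu
  have hu1 : 1 < u := by linarith
  have hu2 : u ≤ 9/8 := by linarith
  have hSre := Complex.hasSum_re (hS β (by linarith) (by linarith))
  have ht : ∀ m, (((b m : ℂ) - G 1) * ((2 - β : ℝ) : ℂ)^m).re = (b m - (G 1).re) * u^m := by
    intro m
    rw [← ofReal_pow, re_mul_ofReal]; simp [hu]
  simp_rw [ht] at hSre
  have hbnd : ∀ m, - (6 * M * (27/32)^m) ≤ (b m - (G 1).re) * u^m := by
    intro m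
    have h1 : |b m - (G 1).re| ≤ 6 * M * (3/4)^m := by
      have := (Complex.abs_re_le_norm ((b m : ℂ) - G 1)).trans (hbM m)
      simpa using this
    have h2 : u^m ≤ (9/8)^m := pow_le_pow_left₀ (by linarith) hu2 m
    have h3 : |(b m - (G 1).re) * u^m| ≤ 6 * M * (27/32)^m := by
      rw [abs_mul, abs_of_nonneg (pow_nonneg (by linarith : 0 ≤ u) m)]
      calc _ ≤ (6 * M * (3/4)^m) * (9/8)^m := by gcongr
        _ = 6 * M * (27/32)^m := by rw [mul_assoc, ← mul_pow]; norm_num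
    exact (abs_le.1 h3).1
  have hlow : 1 - (G 1).re * ∑ m ∈ Finset.range N, u^m - 1/2 ≤ (dslope G 1 β).re := by
    rw [← hSre.tsum_eq, ← hSre.summable.sum_add_tsum_nat_add N]
    have hN0 : 0 < N ∨ N = 0 := by omega
    have htail : -(6 * M * (32/5) * (27/32)^N) ≤ ∑' i, (b (i + N) - (G 1).re) * u^(i+N) := by
      have hg := (hasSum_geometric_of_lt_one (show (0:ℝ) ≤ 27/32 by norm_num) (by norm_num)).mul_left (-(6 * M * (27/32)^N))
      have : -(6 * M * (27/32)^N) * (1 - 27/32)⁻¹ = -(6 * M * (32/5) * (27/32)^N) := by norm_num; ring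
      rw [this] at hg
      rw [← hg.tsum_eq]
      apply hg.summable.tsum_le_tsum _ ((summable_nat_add_iff N).2 hSre.summable)
      intro m
      have := hbnd (m + N)
      rw [pow_add (27/32 : ℝ)] at this
      linarith
    rcases N with _ | N
    · exfalso
      have h2 := hbnd 0
      have h3 := hbM 0
      have hg2 : ‖G 2‖ ≤ M := hM 2 (by rw [mem_closedBall_iff_norm]; norm_num)
      have hg2' : (1:ℝ) ≤ ‖G 2‖ := by
        have hd := hGd 2
        have hs2 := (hS 2 (by norm_num) le_rfl)
        have hs3 : dslope G 1 2 = (b 0 : ℂ) - G 1 := by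
          have : HasSum (fun m => ((b m : ℂ) - G 1) * ((2 - (2:ℝ) : ℝ) : ℂ)^m) ((b 0 : ℂ) - G 1) := by
            convert hasSum_single 0 ?_ using 1
            · simp
            · intro m hm; simp [hm]
          have := hs2.unique this
          simpa using this
        rw [hs3] at hd
        have : G 2 = b 0 := by rw [hd]; ring
        rw [this, norm_real, Real.norm_eq_abs]
        exact hb1.trans (le_abs_self _)
      norm_num at hN
      linarith
    · have hhead : 1 - (G 1).re * ∑ m ∈ Finset.range (N+1), u^m ≤ ∑ m ∈ Finset.range (N+1), (b m - (G 1).re) * u^m := by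
        simp_rw [sub_mul]
        rw [Finset.sum_sub_distrib, ← Finset.mul_sum]
        have : 1 ≤ ∑ m ∈ Finset.range (N+1), b m * u^m := by
          have h0 := Finset.single_le_sum (f := fun m => b m * u^m) (s := Finset.range (N+1))
            (fun m _ => mul_nonneg (hb0 m) (pow_nonneg (by linarith) m)) (Finset.mem_range.2 (Nat.succ_pos N))
          simp only [pow_zero, mul_one] at h0
          linarith
        linarith
      linarith
  have hgeo : (∑ m ∈ Finset.range N, u^m) * (u - 1) = u^N - 1 := geom_sum_mul u N
  have hGre : (G β).re = (G 1).re - (u - 1) * (dslope G 1 β).re := by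
    rw [hGd β, show (β:ℂ) - 1 = ((β - 1 : ℝ) : ℂ) by push_cast; rfl, add_re, re_ofReal_mul, hu]
    ring
  have hnorm : (G 1).re ≤ ‖G 1‖ := Complex.re_le_norm _
  have huN : 0 < u^N := pow_pos (by linarith) N
  have hfin : (u - 1) * (1 - (G 1).re * ∑ m ∈ Finset.range N, u^m - 1/2) ≤ (G 1).re := by
    have := mul_le_mul_of_nonneg_left hlow (show 0 ≤ u - 1 by linarith)
    linarith
  have hexp : (u - 1) * (1 - (G 1).re * ∑ m ∈ Finset.range N, u^m - 1/2) = (u-1)/2 - (G 1).re * (u^N - 1) := by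
    rw [← hgeo]; ring
  rw [hexp] at hfin
  have := mul_le_mul_of_nonneg_right hnorm huN.le
  have h1β : 1 - β = u - 1 := by rw [hu]; ring
  rw [h1β]
  linarith


open NumberTheorySymbols in
lemma exists_jacobi_neg (m : ℕ) (hm0 : m ≠ 0) (hm : ¬ IsSquare m) :
    ∃ b : ℕ, b.Coprime (4 * m) ∧ J(m | b) = -1 := by
  obtain ⟨a, s, hsa, hsq⟩ := Nat.sq_mul_squarefree m
  have hs0 : s ≠ 0 := by rintro rfl; simp at hsa; exact hm0 hsa.symm
  have ha1 : a ≠ 1 := by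
    rintro rfl
    exact hm ⟨s, by rw [← hsa]; ring⟩
  obtain ⟨p, hp, hpa⟩ := Nat.exists_prime_and_dvd ha1
  obtain ⟨a', rfl⟩ := hpa
  have hpa' : ¬ p ∣ a' := by
    rintro ⟨t, rfl⟩
    have := hsq p ⟨t, by ring⟩
    exact hp.one_lt.ne' (Nat.isUnit_iff.1 this)
  obtain ⟨k, s', hps', rfl⟩ := Nat.exists_eq_pow_mul_and_not_dvd hs0 p hp.ne_one
  set m' := s'^2 * a' with hm'
  have hmm : m = p^(2*k+1) * m' := by rw [← hsa, hm']; ring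
  have hpm' : ¬ p ∣ m' := by
    rw [hm', hp.dvd_mul]
    push Not
    exact ⟨fun h => hps' (hp.dvd_of_dvd_pow h), hpa'⟩
  have hcop : p.Coprime m' := (hp.coprime_iff_not_dvd).2 hpm'
  have hm'0 : m' ≠ 0 := by rintro h; rw [h] at hpm'; exact hpm' (dvd_zero _)
  haveI : Fact p.Prime := ⟨hp⟩
  have hJ : ∀ b : ℕ, J(m | b) = J(p | b)^(2*k+1) * J(m' | b) := by
    intro b
    rw [hmm]; push_cast
    rw [jacobiSym.mul_left, jacobiSym.pow_left]
  have odd_neg : ((-1:ℤ))^(2*k+1) = -1 := Odd.neg_one_pow ⟨k, rfl⟩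
  rcases hp.eq_two_or_odd' with h2 | hodd
  · -- p = 2
    subst h2
    have hm'odd : Odd m' := by rwa [← Nat.not_even_iff_odd, even_iff_two_dvd]
    have hco8 : Nat.Coprime 8 m' := by
      rw [show 8 = 2^3 by norm_num]; exact hcop.pow_left 3
    obtain ⟨b, hb8, hbm⟩ := Nat.chineseRemainder hco8 5 1
    have hb4 : b % 4 = 1 := by have : b % 8 = 5 := hb8; omega
    have hbodd : Odd b := Nat.odd_iff.2 (by omega)
    refine ⟨b, ?_, ?_⟩
    · rw [hmm]
      apply Nat.Coprime.mul_right
      · rw [show 4 = 2^2 by norm_num]; exact (Nat.Coprime.pow_right 2 hbodd.coprime_two_right)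
      · apply Nat.Coprime.mul_right
        · exact (Nat.Coprime.pow_right _ hbodd.coprime_two_right)
        · rw [Nat.Coprime, Nat.ModEq.gcd_eq hbm]; simp
    · rw [hJ]
      have h1 : J((2:ℕ) | b) = -1 := by
        have := jacobiSym.at_two hbodd
        rw [show ((2:ℕ):ℤ) = 2 by rfl, this]
        have h5 : ((b:ℕ) : ZMod 8) = ((5:ℕ) : ZMod 8) := (ZMod.natCast_eq_natCast_iff b 5 8).2 hb8
        rw [h5]; decide
      have h3 : J(m' | b) = 1 := by
        rw [jacobiSym.quadratic_reciprocity_one_mod_four' hm'odd hb4, jacobiSym.mod_left]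
        have : ((b:ℤ) % (m':ℤ)) = ((1:ℤ) % (m':ℤ)) := by exact_mod_cast hbm
        rw [this, ← jacobiSym.mod_left, jacobiSym.one_left]
      rw [h1, h3, odd_neg]; norm_num
  · obtain ⟨c, hc⟩ := FiniteField.exists_nonsquare (F := ZMod p) (by
      rw [ZMod.ringChar_zmod_n]; rintro rfl; exact absurd hodd (by decide))
    have hco : Nat.Coprime (8 * m') p := by
      apply Nat.Coprime.symm
      apply Nat.Coprime.mul_right _ hcop
      rw [show 8 = 2^3 by norm_num]; exact Nat.Coprime.pow_right 3 hodd.coprime_two_right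
    obtain ⟨b, hb8, hbp⟩ := Nat.chineseRemainder hco 1 c.val
    have hb8' : b ≡ 1 [MOD 8] := hb8.of_mul_right m'
    have hb4 : b % 4 = 1 := by have : b % 8 = 1 := hb8'; omega
    have hbodd : Odd b := Nat.odd_iff.2 (by omega)
    have hbc : ((b:ℕ) : ZMod p) = c := by
      have := (ZMod.natCast_eq_natCast_iff b c.val p).2 hbp
      rw [this, ZMod.natCast_zmod_val]
    have hl : legendreSym p b = -1 := by
      rw [legendreSym.eq_neg_one_iff]
      push_cast
      rwa [hbc]
    refine ⟨b, ?_, ?_⟩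
    · rw [hmm]
      apply Nat.Coprime.mul_right
      · rw [show 4 = 2^2 by norm_num]; exact (Nat.Coprime.pow_right 2 hbodd.coprime_two_right)
      · apply Nat.Coprime.mul_right
        · apply Nat.Coprime.pow_right
          apply Nat.Coprime.symm
          rw [hp.coprime_iff_not_dvd]
          intro hd
          apply hc
          rw [← hbc, (ZMod.natCast_eq_zero_iff b p).2 hd]
          exact ⟨0, by simp⟩
        · rw [Nat.Coprime, Nat.ModEq.gcd_eq (hb8.of_mul_left 8)]; simp
    · rw [hJ]
      have h1 : J(p | b) = -1 := by
        rw [jacobiSym.quadratic_reciprocity_one_mod_four' hodd hb4]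
        rw [← jacobiSym.legendreSym.to_jacobiSym]; exact hl
      have h3 : J(m' | b) = 1 := by
        rw [jacobiSym.mod_right' m' hbodd]
        have h4 : b ≡ 1 [MOD 4 * m'] := by
          apply hb8.of_dvd
          exact ⟨2, by ring⟩
        have h5 : b % (4 * m') = 1 % (4 * m') := h4
        rw [h5, Nat.mod_eq_of_lt (by omega)]
        exact jacobiSym.one_right _
      rw [h1, h3, odd_neg]; norm_num

open NumberTheorySymbols in
open Classical in
/-- quadratic character -/
noncomputable def chiD (D : ℕ) [NeZero D] : DirichletCharacter ℂ (4 * D) where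
  toFun a := if IsUnit a then ((J(D | a.val) : ℤ) : ℂ) else 0
  map_one' := by
    have h4 : 1 < 4 * D := by have := NeZero.pos D; omega
    haveI : Fact (1 < 4 * D) := ⟨h4⟩
    rw [if_pos isUnit_one, ZMod.val_one]
    simp
  map_mul' a b := by
    by_cases ha : IsUnit a
    · by_cases hb : IsUnit b
      · rw [if_pos ha, if_pos hb, if_pos (ha.mul hb), ZMod.val_mul]
        have key : ∀ a : ZMod (4*D), IsUnit a → Odd a.val := by
          intro a ha
          have : a.val.Coprime (4 * D) := ZMod.val_coe_unit_coprime ha.unit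
          have h2 : a.val.Coprime 2 := this.coprime_dvd_right ⟨2 * D, by ring⟩
          exact Nat.coprime_two_right.1 h2
        rw [← jacobiSym.mod_right' D ((key a ha).mul (key b hb)), jacobiSym.mul_right' _ (by
          have := key a ha; rintro h; rw [h] at this; exact absurd this (by decide)) (by
          have := key b hb; rintro h; rw [h] at this; exact absurd this (by decide))]
        push_cast; rfl
      · rw [if_neg hb, if_neg (fun h => hb (isUnit_of_mul_isUnit_right h)), mul_zero]
    · rw [if_neg ha, if_neg (fun h => ha (isUnit_of_mul_isUnit_left h)), zero_mul]
  map_nonunit' a ha := if_neg ha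

open NumberTheorySymbols in
lemma chiD_apply (D : ℕ) [NeZero D] (b : ℕ) (hb : b.Coprime (4 * D)) : chiD D (b : ZMod (4*D)) = ((J(D | b) : ℤ) : ℂ) := by
  have hu : IsUnit (b : ZMod (4*D)) := (ZMod.isUnit_iff_coprime b (4*D)).2 hb
  have hodd : Odd b := Nat.coprime_two_right.1 (hb.coprime_dvd_right ⟨2 * D, by ring⟩)
  show (if IsUnit (b : ZMod (4*D)) then _ else _) = _
  rw [if_pos hu, ZMod.val_natCast, ← jacobiSym.mod_right' D hodd]

lemma chiD_apply_zero (D : ℕ) [NeZero D] (b : ℕ) (hb : ¬ b.Coprime (4 * D)) : chiD D (b : ZMod (4*D)) = 0 := by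
  apply MulChar.map_nonunit
  rwa [ZMod.isUnit_iff_coprime b (4*D)]

lemma chiD_vals (D : ℕ) [NeZero D] (b : ℕ) :
    chiD D (b : ZMod (4*D)) = 0 ∨ chiD D (b : ZMod (4*D)) = 1 ∨ chiD D (b : ZMod (4*D)) = -1 := by
  by_cases hb : b.Coprime (4 * D)
  · rw [chiD_apply D b hb]
    rcases jacobiSym.trichotomy D b with h | h | h <;> rw [h] <;> simp
  · left; exact chiD_apply_zero D b hb

lemma chiD_ne_one (D : ℕ) [NeZero D] (hD : ¬ IsSquare D) : chiD D ≠ 1 := by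
  intro h
  obtain ⟨b, hb, hJ⟩ := exists_jacobi_neg D (NeZero.ne D) hD
  have := chiD_apply D b hb
  rw [h, hJ, MulChar.one_apply ((ZMod.isUnit_iff_coprime b (4*D)).2 hb)] at this
  norm_num at this

lemma chiD_sq (D : ℕ) [NeZero D] : (chiD D)^2 = 1 := by
  rw [← MulChar.isQuadratic_iff_sq_eq_one]
  intro a
  rw [← ZMod.natCast_zmod_val a]
  exact chiD_vals D _

open NumberTheorySymbols in
lemma chiD_mul (D E : ℕ) [NeZero D] [NeZero E] (b : ℕ) :
    chiD (D * E) (b : ZMod (4 * (D * E))) = chiD D (b : ZMod (4*D)) * chiD E (b : ZMod (4*E)) := by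
  by_cases hb : b.Coprime (4 * (D * E))
  · have hbD : b.Coprime (4 * D) := hb.coprime_dvd_right ⟨E, by ring⟩
    have hbE : b.Coprime (4 * E) := hb.coprime_dvd_right ⟨D, by ring⟩
    rw [chiD_apply _ b hb, chiD_apply D b hbD, chiD_apply E b hbE]
    push_cast
    rw [jacobiSym.mul_left]
    push_cast; rfl
  · rw [chiD_apply_zero _ b hb]
    have : ¬ (b.Coprime (4 * D) ∧ b.Coprime (4 * E)) := by
      rintro ⟨h1, h2⟩
      apply hb
      rw [← mul_assoc]
      exact Nat.Coprime.mul_right h1 (h2.coprime_dvd_right ⟨4, by ring⟩)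
    rw [not_and_or] at this
    rcases this with h | h
    · rw [chiD_apply_zero D b h, zero_mul]
    · rw [chiD_apply_zero E b h, mul_zero]


/-- `(s-1)ζ(s)` -/
noncomputable def Zf : ℂ → ℂ := DirichletCharacter.LFunctionTrivChar₁ 1

lemma Zf_diff : Differentiable ℂ Zf := DirichletCharacter.differentiable_LFunctionTrivChar₁ 1

lemma Zf_one : Zf 1 = 1 := by
  simp [Zf, DirichletCharacter.LFunctionTrivChar₁]

lemma Zf_of_ne {s : ℂ} (hs : s ≠ 1) : Zf s = (s - 1) * riemannZeta s := by
  rw [Zf, DirichletCharacter.LFunctionTrivChar₁, Function.update_of_ne hs, DirichletCharacter.LFunctionTrivChar,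
    DirichletCharacter.LFunction_modOne_eq]

/-- the auxiliary product -/
noncomputable def Gf (D E : ℕ) [NeZero D] [NeZero E] (s : ℂ) : ℂ :=
  Zf s * (chiD D).LFunction s * (chiD E).LFunction s * (chiD (D * E)).LFunction s

open Metric in
lemma siegel_core2 (D E : ℕ) [NeZero D] [NeZero E] (hD : ¬ IsSquare D) (hE : ¬ IsSquare E) (hDE : ¬ IsSquare (D * E))
    (C : ℝ) (hC1 : 1 ≤ C) (hC : ∀ s ∈ closedBall (2:ℂ) (4/3), ‖Zf s‖ ≤ C)
    (β δ : ℝ) (hβ : 7/8 ≤ β) (hβ1 : β < 1) (hδ : 1 - β ≤ δ)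
    (hz : Gf D E β = 0 ∨ ∀ x : ℝ, β ≤ x → x ≤ 2 → Gf D E x ≠ 0) :
    (1 - β) / 2 ≤ ‖Gf D E 1‖ * (Real.exp δ * (614400 * C * (D:ℝ)^2 * (E:ℝ)^2)^(6.4 * δ)) := by
  have hD0 : (1:ℝ) ≤ D := by exact_mod_cast NeZero.pos D
  have hE0 : (1:ℝ) ≤ E := by exact_mod_cast NeZero.pos E
  have dL : ∀ (F : ℕ) [NeZero F], ¬ IsSquare F → Differentiable ℂ (chiD F).LFunction := fun F _ hF =>
    DirichletCharacter.differentiable_LFunction (chiD_ne_one F hF)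
  have bL : ∀ (F : ℕ) [NeZero F], ¬ IsSquare F → ∀ s ∈ closedBall (2:ℂ) (4/3), ‖(chiD F).LFunction s‖ ≤ 20 * F := by
    intro F _ hF s hs
    rw [mem_closedBall_iff_norm] at hs
    have h1 : |(s - 2).re| ≤ 4/3 := (Complex.abs_re_le_norm _).trans hs
    have h2 : 2/3 ≤ s.re := by
      rw [abs_le] at h1; simp at h1; linarith
    have h3 : ‖s‖ ≤ 10/3 := by
      calc ‖s‖ = ‖(s - 2) + 2‖ := by congr 1; ring
        _ ≤ ‖s - 2‖ + ‖(2:ℂ)‖ := norm_add_le _ _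
        _ ≤ 10/3 := by rw [Complex.norm_ofNat]; linarith
    have h4 := L_bound (chiD F) (chiD_ne_one F hF) (s := s) (by linarith)
    have hF0 : (0:ℝ) ≤ F := by positivity
    calc _ ≤ _ := h4
      _ ≤ (10/3) * ((4 * F : ℕ) / (2/3)) := by gcongr
      _ = 20 * F := by push_cast; ring
  set M : ℝ := C * (20 * D) * (20 * E) * (20 * (D * E : ℕ)) with hM
  have hMe : M = 8000 * C * (D:ℝ)^2 * (E:ℝ)^2 := by rw [hM]; push_cast; ring
  have hM1 : 1 ≤ M := by
    rw [hMe]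
    have h1 : 1 ≤ (D:ℝ)^2 := one_le_pow₀ hD0
    have h2 : 1 ≤ (E:ℝ)^2 := one_le_pow₀ hE0
    have h3 : 1 ≤ 8000 * C := by linarith
    exact one_le_mul_of_one_le_of_one_le (one_le_mul_of_one_le_of_one_le h3 h1) h2
  set T : ℝ := 614400 * C * (D:ℝ)^2 * (E:ℝ)^2 with hT
  have hTM : T = 76.8 * M := by rw [hT, hMe]; ring
  have hT0 : 0 < T := by rw [hTM]; linarith
  set N := ⌈6.4 * Real.log T⌉₊ with hN
  have hlogT : 0 ≤ Real.log T := Real.log_nonneg (by rw [hTM]; linarith)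
  have hN1 : 6.4 * Real.log T ≤ N := Nat.le_ceil _
  have hN2 : (N:ℝ) ≤ 6.4 * Real.log T + 1 := (Nat.ceil_lt_add_one (by positivity)).le
  have hpow : (27/32 : ℝ)^N ≤ 1 / T := by
    have h1 : (27/32:ℝ) ≤ Real.exp (-(5/32)) := by
      have := Real.add_one_le_exp (-(5/32 : ℝ)); linarith
    calc (27/32 : ℝ)^N ≤ (Real.exp (-(5/32)))^N := pow_le_pow_left₀ (by norm_num) h1 N
      _ = Real.exp (-(5/32) * N) := by rw [← Real.exp_nat_mul]; ring_nf
      _ ≤ Real.exp (- Real.log T) := by apply Real.exp_le_exp.2; linarith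
      _ = 1 / T := by rw [Real.exp_neg, Real.exp_log hT0, one_div]
  have c1 := chiD_vals D
  have c2 := chiD_vals E
  have b1 : ∀ n : ℕ, ‖chiD D (n : ZMod (4*D))‖ ≤ 1 := fun n => DirichletCharacter.norm_le_one _ _
  have b2 : ∀ n : ℕ, ‖chiD E (n : ZMod (4*E))‖ ≤ 1 := fun n => DirichletCharacter.norm_le_one _ _
  have hrL := fun (s : ℂ) (hs : 1 < s.re) => rF_LSeries (fun n : ℕ => chiD D (n : ZMod (4*D))) (fun n : ℕ => chiD E (n : ZMod (4*E))) b1 b2 hs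
  have core := siegel_core (Gf D E) (((Zf_diff.mul (dL D hD)).mul (dL E hE)).mul (dL (D*E) hDE))
    (rF (fun n : ℕ => chiD D (n : ZMod (4*D))) (fun n : ℕ => chiD E (n : ZMod (4*E))))
    (fun n => rF_nonneg _ _ (by simp) (by simp) (by intro m n; simp) (by intro m n; simp) c1 c2 n)
    (rF_one _ _ (by simp) (by simp)) (fun s hs => (hrL s hs).1) (by
      intro s hs
      have hs1 : s ≠ 1 := by rintro rfl; simp at hs
      rw [(hrL s hs).2, Gf, Zf_of_ne hs1, DirichletCharacter.LFunction_eq_LSeries _ hs, DirichletCharacter.LFunction_eq_LSeries _ hs,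
        DirichletCharacter.LFunction_eq_LSeries _ hs]
      have : (fun n : ℕ => chiD (D*E) (n : ZMod (4*(D*E)))) = (fun n : ℕ => chiD D (n : ZMod (4*D))) * (fun n : ℕ => chiD E (n : ZMod (4*E))) := by
        funext n; exact chiD_mul D E n
      rw [this]; ring) M (by
      intro s hs
      rw [Gf, norm_mul, norm_mul, norm_mul, hM]
      have h1 := hC s hs
      have h2 := bL D hD s hs
      have h3 := bL E hE s hs
      have h4 := bL (D*E) hDE s hs
      gcongr) β hβ hβ1 hz N (by
      calc 6 * M * (32/5) * (27/32)^N ≤ 6 * M * (32/5) * (1 / T) := by gcongr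
        _ = 1/2 := by rw [hTM]; field_simp; norm_num)
  refine core.trans ?_
  gcongr
  have hb0 : 0 ≤ 1 - β := by linarith
  calc (2 - β)^N ≤ (Real.exp (1 - β))^N := by
        apply pow_le_pow_left₀ (by linarith)
        have := Real.add_one_le_exp (1 - β); linarith
    _ = Real.exp ((1 - β) * N) := by rw [← Real.exp_nat_mul]; ring_nf
    _ ≤ Real.exp (δ * (6.4 * Real.log T + 1)) := by
        apply Real.exp_le_exp.2
        exact mul_le_mul hδ hN2 (by positivity) (by linarith)
    _ = Real.exp δ * T^(6.4 * δ) := by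
        rw [Real.rpow_def_of_pos hT0, ← Real.exp_add]; ring_nf

lemma siegel_dichotomy (δ : ℝ) (hδ : 0 < δ) (hδ2 : δ ≤ 1/8) : ∃ (D : ℕ) (_ : NeZero D) (β : ℝ), ¬ IsSquare D ∧ 7/8 ≤ β ∧ β < 1 ∧ 1 - β ≤ δ ∧
    ∀ (E : ℕ) [NeZero E], ¬ IsSquare E → ¬ IsSquare (D * E) → (Gf D E β = 0 ∨ ∀ x : ℝ, β ≤ x → x ≤ 2 → Gf D E x ≠ 0) := by
  have hZc : ContinuousAt (fun x : ℝ => Zf x) 1 := (Zf_diff.continuous.comp Complex.continuous_ofReal).continuousAt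
  have hZn : (fun x : ℝ => Zf x) 1 ≠ 0 := by simp [Zf_one]
  obtain ⟨η, hη, hZ⟩ := Metric.eventually_nhds_iff.1 (hZc.eventually_ne hZn)
  set δ' := min δ (η/2) with hδ'
  have hδ'0 : 0 < δ' := lt_min hδ (by linarith)
  have hd1 : δ' ≤ δ := min_le_left _ _
  have hd2 : δ' ≤ η/2 := min_le_right _ _
  by_cases hex : ∃ (D : ℕ) (_ : NeZero D) (β : ℝ), ¬ IsSquare D ∧ 1 - δ' ≤ β ∧ β < 1 ∧ (chiD D).LFunction β = 0
  · obtain ⟨D, hD0, β, hD, hβ, hβ1, hL⟩ := hex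
    refine ⟨D, hD0, β, hD, by linarith, hβ1, by linarith, ?_⟩
    intro E _ _ _
    left
    rw [Gf, hL]; simp
  · push Not at hex
    have hns : ¬ IsSquare (2:ℕ) := by
      rintro ⟨r, hr⟩
      have : r < 2 := by nlinarith
      interval_cases r <;> omega
    refine ⟨2, inferInstance, 1 - δ', hns, by linarith, by linarith, by linarith, ?_⟩
    intro E _ hE hDE
    right
    intro x hx hx2
    have hL : ∀ (F : ℕ) [NeZero F], ¬ IsSquare F → (chiD F).LFunction x ≠ 0 := by
      intro F _ hF
      rcases lt_or_ge x 1 with h | h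
      · exact hex F inferInstance x hF hx h
      · exact DirichletCharacter.LFunction_ne_zero_of_one_le_re _ (.inl (chiD_ne_one F hF)) (by simpa using h)
    have hZx : Zf x ≠ 0 := by
      rcases le_or_gt x 1 with h | h
      · apply hZ
        rw [Real.dist_eq, abs_lt]; constructor <;> linarith
      · have hx1 : (x:ℂ) ≠ 1 := by
          intro h'; have : x = 1 := by exact_mod_cast h'
          linarith
        rw [Zf_of_ne hx1]
        exact mul_ne_zero (sub_ne_zero.2 hx1) (riemannZeta_ne_zero_of_one_le_re (by simpa using h.le))
    rw [Gf]
    exact mul_ne_zero (mul_ne_zero (mul_ne_zero hZx (hL 2 hns)) (hL E hE)) (hL (2 * E) hDE)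


lemma not_isSquare_of_squarefree {D : ℕ} (h : Squarefree D) (h2 : 2 ≤ D) : ¬ IsSquare D := by
  rintro ⟨r, rfl⟩
  have := Nat.isUnit_iff.1 (h r dvd_rfl)
  subst this
  omega

lemma not_isSquare_mul {D E : ℕ} (hD : D ≠ 0) (h : Squarefree E) (hlt : D < E) : ¬ IsSquare (D * E) := by
  rintro ⟨r, hr⟩
  have h1 : E ∣ r ^ 2 := ⟨D, by rw [pow_two, ← hr]; ring⟩
  have h2 : E ∣ r := (h.dvd_pow_iff_dvd two_ne_zero).1 h1
  obtain ⟨j, rfl⟩ := h2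
  have h3 : D = E * j * j := by
    have hE : 0 < E := by omega
    apply Nat.eq_of_mul_eq_mul_right hE
    rw [hr]; ring
  rcases Nat.eq_zero_or_pos j with rfl | hj
  · simp at h3; exact hD h3
  · have : E ≤ D := by rw [h3]; nlinarith [Nat.mul_pos (show 0 < E by omega) hj]
    omega

lemma siegel_small (D1 : ℕ) : ∃ c : ℝ, 0 < c ∧ ∀ (E : ℕ) [NeZero E], Squarefree E → 2 ≤ E → E ≤ D1 → c ≤ ‖(chiD E).LFunction 1‖ := by
  induction D1 with
  | zero => exact ⟨1, one_pos, fun E _ _ h2 h => by omega⟩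
  | succ D ih =>
    obtain ⟨c, hc, h⟩ := ih
    haveI : NeZero (D + 1) := ⟨by omega⟩
    by_cases hs : Squarefree (D + 1) ∧ 2 ≤ D + 1
    · have hL : (chiD (D+1)).LFunction 1 ≠ 0 :=
        DirichletCharacter.LFunction_apply_one_ne_zero (chiD_ne_one _ (not_isSquare_of_squarefree hs.1 hs.2))
      refine ⟨min c ‖(chiD (D+1)).LFunction 1‖, lt_min hc (norm_pos_iff.2 hL), ?_⟩
      intro E _ hE hE2 hle
      rcases Nat.lt_or_ge D E with h1 | h1
      · obtain rfl : E = D + 1 := by omega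
        exact min_le_right _ _
      · exact (min_le_left _ _).trans (h E hE hE2 h1)
    · refine ⟨c, hc, ?_⟩
      intro E _ hE hE2 hle
      rcases Nat.lt_or_ge D E with h1 | h1
      · obtain rfl : E = D + 1 := by omega
        exact absurd ⟨hE, hE2⟩ hs
      · exact h E hE hE2 h1

lemma siegel (ε : ℝ) (hε : 0 < ε) : ∃ c : ℝ, 0 < c ∧ ∀ (E : ℕ) [NeZero E], Squarefree E → 2 ≤ E →
    c * (E:ℝ)^(-ε) ≤ ‖(chiD E).LFunction 1‖ := by
  set δ : ℝ := min (1/8) (ε/14) with hδdef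
  have hδ : 0 < δ := lt_min (by norm_num) (by linarith)
  have hδ8 : δ ≤ 1/8 := min_le_left _ _
  have hδε : 13.8 * δ ≤ ε := by have : δ ≤ ε/14 := min_le_right _ _; linarith
  obtain ⟨D, hD0, β, hD, hβ, hβ1, hβδ, hG⟩ := siegel_dichotomy δ hδ hδ8
  obtain ⟨C0, hC0⟩ := (isCompact_closedBall (2:ℂ) (4/3)).exists_bound_of_continuousOn Zf_diff.continuous.continuousOn
  set C := max 1 C0 with hCdef
  have hC1 : 1 ≤ C := le_max_left _ _
  have hC : ∀ s ∈ Metric.closedBall (2:ℂ) (4/3), ‖Zf s‖ ≤ C := fun s hs => (hC0 s hs).trans (le_max_right _ _)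
  obtain ⟨c1, hc1, hsmall⟩ := siegel_small D
  have hDpos : 0 < D := NeZero.pos D
  have hDr : (0:ℝ) < D := by exact_mod_cast hDpos
  have hL1 : 0 < ‖(chiD D).LFunction 1‖ :=
    norm_pos_iff.2 (DirichletCharacter.LFunction_apply_one_ne_zero (chiD_ne_one D hD))
  set K : ℝ := 614400 * C * (D:ℝ)^2 with hK
  have hK0 : 0 < K := by positivity
  set K2 : ℝ := 3 + (4 * D)^δ / δ with hK2
  have hK20 : 0 < K2 := by positivity
  set B : ℝ := ‖(chiD D).LFunction 1‖ * K2 * (Real.exp δ * K^(6.4*δ)) with hB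
  have hB0 : 0 < B := by positivity
  refine ⟨min c1 ((1 - β) / 2 / B), lt_min hc1 (by have : 0 < 1 - β := by linarith
                                                   positivity), ?_⟩
  intro E _ hE hE2
  have hE1 : (1:ℝ) ≤ E := by exact_mod_cast (by omega : 1 ≤ E)
  have hE0 : (0:ℝ) < E := by linarith
  have hEε : (E:ℝ)^(-ε) ≤ 1 := Real.rpow_le_one_of_one_le_of_nonpos hE1 (by linarith)
  rcases Nat.lt_or_ge D E with hlt | hge
  · have hEns := not_isSquare_of_squarefree hE hE2
    have hDE := not_isSquare_mul (NeZero.ne D) hE hlt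
    have h := siegel_core2 D E hD hEns hDE C hC1 hC β δ hβ hβ1 hβδ (hG E hEns hDE)
    have hG1 : ‖Gf D E 1‖ = ‖(chiD D).LFunction 1‖ * ‖(chiD E).LFunction 1‖ * ‖(chiD (D*E)).LFunction 1‖ := by
      rw [Gf, Zf_one, norm_mul, norm_mul, norm_mul, norm_one, one_mul]
    have hup : ‖(chiD (D*E)).LFunction 1‖ ≤ K2 * (E:ℝ)^δ := by
      refine (L_one_upper _ (chiD_ne_one _ hDE)).trans ?_
      have h1 := Real.log_le_rpow_div (x := ((4 * (D * E) : ℕ) : ℝ)) (by positivity) hδ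
      have h2 : (((4 * (D * E) : ℕ) : ℝ))^δ = (4 * D)^δ * (E:ℝ)^δ := by
        push_cast
        rw [← Real.mul_rpow (by positivity) (by positivity)]; ring_nf
      rw [h2] at h1
      have h3 : 1 ≤ (E:ℝ)^δ := Real.one_le_rpow hE1 hδ.le
      have h4 : K2 * (E:ℝ)^δ = 3 * (E:ℝ)^δ + (4 * D)^δ * (E:ℝ)^δ / δ := by rw [hK2]; ring
      rw [h4]; linarith
    have hT : (614400 * C * (D:ℝ)^2 * (E:ℝ)^2)^(6.4 * δ) = K^(6.4*δ) * (E:ℝ)^(12.8 * δ) := by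
      rw [Real.mul_rpow (by positivity) (by positivity), ← hK]
      congr 1
      rw [← Real.rpow_natCast, ← Real.rpow_mul hE0.le]
      congr 1; push_cast; ring
    rw [hG1, hT] at h
    have h5 : (1 - β)/2 ≤ ‖(chiD E).LFunction 1‖ * B * (E:ℝ)^ε := by
      calc (1 - β)/2 ≤ _ := h
        _ ≤ ‖(chiD D).LFunction 1‖ * ‖(chiD E).LFunction 1‖ * (K2 * (E:ℝ)^δ) * (Real.exp δ * (K^(6.4*δ) * (E:ℝ)^(12.8*δ))) := by gcongr
        _ = ‖(chiD E).LFunction 1‖ * B * (E:ℝ)^(13.8 * δ) := by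
            rw [hB, show 13.8 * δ = δ + 12.8 * δ by ring, Real.rpow_add hE0]; ring
        _ ≤ _ := by gcongr
    calc min c1 ((1 - β) / 2 / B) * (E:ℝ)^(-ε) ≤ ((1 - β) / 2 / B) * (E:ℝ)^(-ε) := by gcongr; exact min_le_right _ _
      _ ≤ ‖(chiD E).LFunction 1‖ := by
          rw [Real.rpow_neg hE0.le, ← div_eq_mul_inv, div_div, div_le_iff₀ (by positivity)]
          linarith
  · calc min c1 ((1 - β) / 2 / B) * (E:ℝ)^(-ε) ≤ c1 * 1 := by gcongr; exact min_le_left _ _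
      _ ≤ _ := by rw [mul_one]; exact hsmall E hE hE2 hge


lemma hyperbola {q : ℕ} [NeZero q] (χ : DirichletCharacter ℂ q) (hχ : χ ≠ 1) (Y Z : ℕ) (hY : 1 ≤ Y) (hZ : 1 ≤ Z) :
    ‖∑ a ∈ Finset.Icc 1 (Y * Z), ∑ d ∈ a.divisors, χ (d : ZMod q) - ((Y * Z : ℕ) : ℂ) * χ.LFunction 1‖
      ≤ (Z : ℝ) * (2 * q) + Y + Z * (2 * q) := by
  set x := Y * Z with hx
  have hYx : Y ≤ x := Nat.le_mul_of_pos_right _ hZ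
  have hY0 : (0:ℝ) < Y := by exact_mod_cast hY
  have e1 : ∑ a ∈ Finset.Icc 1 x, ∑ d ∈ a.divisors, χ (d : ZMod q) =
      ∑ d ∈ Finset.Icc 1 x, ((x / d : ℕ) : ℂ) * χ (d : ZMod q) := by
    rw [Finset.sum_comm' (s' := fun d => (Finset.Ioc 0 x).filter (fun a => d ∣ a)) (t' := Finset.Icc 1 x)]
    · apply Finset.sum_congr rfl
      intro d hd
      rw [Finset.sum_const, Nat.Ioc_filter_dvd_card_eq_div, nsmul_eq_mul]
    · intro a d
      simp only [Finset.mem_Icc, Nat.mem_divisors, Finset.mem_filter, Finset.mem_Ioc]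
      constructor
      · rintro ⟨⟨h1, h2⟩, h3, h4⟩
        exact ⟨⟨⟨h1, h2⟩, h3⟩, Nat.pos_of_dvd_of_pos h3 h1, (Nat.le_of_dvd h1 h3).trans h2⟩
      · rintro ⟨⟨⟨h1, h2⟩, h3⟩, _, _⟩
        exact ⟨⟨h1, h2⟩, h3, by omega⟩
  have e2 : ∑ d ∈ Finset.Icc 1 x, ((x / d : ℕ) : ℂ) * χ (d : ZMod q) =
      ∑ d ∈ Finset.Icc 1 Y, ((x / d : ℕ) : ℂ) * χ (d : ZMod q) + ∑ d ∈ Finset.Ioc Y x, ((x / d : ℕ) : ℂ) * χ (d : ZMod q) := by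
    rw [← Finset.sum_union]
    · congr 1
      ext d; simp only [Finset.mem_Icc, Finset.mem_union, Finset.mem_Ioc]; omega
    · rw [Finset.disjoint_left]; intro d; simp only [Finset.mem_Icc, Finset.mem_Ioc]; omega
  have e3 : ∑ d ∈ Finset.Ioc Y x, ((x / d : ℕ) : ℂ) * χ (d : ZMod q) =
      ∑ m ∈ Finset.Icc 1 Z, ∑ d ∈ Finset.Ioc Y (x / m), χ (d : ZMod q) := by
    rw [Finset.sum_comm' (s' := fun d => Finset.Icc 1 (x / d)) (t' := Finset.Ioc Y x)]
    · apply Finset.sum_congr rfl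
      intro d hd
      rw [Finset.sum_const, nsmul_eq_mul]; simp
    · intro m d
      simp only [Finset.mem_Icc, Finset.mem_Ioc]
      constructor
      · rintro ⟨⟨h1, h2⟩, h3, h4⟩
        rw [Nat.le_div_iff_mul_le h1] at h4
        rw [Nat.le_div_iff_mul_le (by omega)]
        exact ⟨⟨h1, by linarith⟩, h3, le_trans (Nat.le_mul_of_pos_right _ h1) h4⟩
      · rintro ⟨⟨h1, h2⟩, h3, h4⟩
        rw [Nat.le_div_iff_mul_le (by omega)] at h2
        rw [Nat.le_div_iff_mul_le h1]
        refine ⟨⟨h1, ?_⟩, h3, by linarith⟩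
        by_contra hc
        push Not at hc
        have : Y * Z < m * d := by rw [mul_comm]; exact Nat.mul_lt_mul'' hc h3
        omega
  have b3 : ‖∑ m ∈ Finset.Icc 1 Z, ∑ d ∈ Finset.Ioc Y (x / m), χ (d : ZMod q)‖ ≤ Z * (2 * q) := by
    calc _ ≤ ∑ m ∈ Finset.Icc 1 Z, ‖∑ d ∈ Finset.Ioc Y (x / m), χ (d : ZMod q)‖ := norm_sum_le _ _
      _ ≤ ∑ m ∈ Finset.Icc 1 Z, (2 * q : ℝ) := by
          apply Finset.sum_le_sum
          intro m hm
          rw [Finset.mem_Icc] at hm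
          have hle : Y ≤ x / m := by
            rw [Nat.le_div_iff_mul_le hm.1]; exact Nat.mul_le_mul_left _ hm.2
          have : ∑ d ∈ Finset.Ioc Y (x / m), χ (d : ZMod q) = ∑ d ∈ Finset.Icc 1 (x / m), χ (d : ZMod q) - ∑ d ∈ Finset.Icc 1 Y, χ (d : ZMod q) := by
            rw [eq_sub_iff_add_eq, ← Finset.sum_union]
            · congr 1
              ext d; simp only [Finset.mem_Icc, Finset.mem_union, Finset.mem_Ioc]; omega
            · rw [Finset.disjoint_left]; intro d; simp only [Finset.mem_Icc, Finset.mem_Ioc]; omega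
          rw [this]
          have h1 := char_sum_bound χ hχ (x / m)
          have h2 := char_sum_bound χ hχ Y
          have h3 := norm_sub_le (∑ d ∈ Finset.Icc 1 (x / m), χ (d : ZMod q)) (∑ d ∈ Finset.Icc 1 Y, χ (d : ZMod q))
          linarith
      _ = _ := by simp
  have b2 : ‖∑ d ∈ Finset.Icc 1 Y, ((x / d : ℕ) : ℂ) * χ (d : ZMod q) - (x : ℂ) * ∑ d ∈ Finset.Icc 1 Y, χ (d : ZMod q) / d‖ ≤ Y := by
    rw [Finset.mul_sum, ← Finset.sum_sub_distrib]
    calc _ ≤ ∑ d ∈ Finset.Icc 1 Y, ‖((x / d : ℕ) : ℂ) * χ (d : ZMod q) - (x:ℂ) * (χ (d : ZMod q) / d)‖ := norm_sum_le _ _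
      _ ≤ ∑ d ∈ Finset.Icc 1 Y, (1:ℝ) := by
          apply Finset.sum_le_sum
          intro d hd
          rw [Finset.mem_Icc] at hd
          have hd0 : (0:ℝ) < d := by exact_mod_cast hd.1
          have e : ((x / d : ℕ) : ℂ) * χ (d : ZMod q) - (x:ℂ) * (χ (d : ZMod q) / d) =
            ((((x / d : ℕ) : ℝ) - (x:ℝ) / d : ℝ) : ℂ) * χ (d : ZMod q) := by push_cast; ring
          rw [e, norm_mul, Complex.norm_real]
          have h1 : |((x / d : ℕ) : ℝ) - (x:ℝ) / d| ≤ 1 := by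
            have h2 : ((x / d : ℕ) : ℝ) ≤ (x:ℝ) / d := Nat.cast_div_le
            have h3 : (x:ℝ) / d < ((x / d : ℕ) : ℝ) + 1 := by
              rw [div_lt_iff₀ hd0]
              exact_mod_cast (by have := Nat.lt_div_mul_add (a := x) hd.1; linarith : x < (x / d + 1) * d)
            rw [abs_le]; constructor <;> linarith
          exact mul_le_one₀ h1 (norm_nonneg _) (χ.norm_le_one _)
      _ = _ := by simp
  have b1 := L_partial χ hχ Y hY
  rw [e1, e2, e3]
  have e5 : ∑ d ∈ Finset.Icc 1 Y, ((x / d : ℕ) : ℂ) * χ (d : ZMod q) + ∑ m ∈ Finset.Icc 1 Z, ∑ d ∈ Finset.Ioc Y (x / m), χ (d : ZMod q) - (x:ℂ) * χ.LFunction 1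
    = -((x:ℂ) * (χ.LFunction 1 - ∑ k ∈ Finset.Icc 1 Y, χ (k:ZMod q) / k)) +
      (∑ d ∈ Finset.Icc 1 Y, ((x / d : ℕ) : ℂ) * χ (d : ZMod q) - (x : ℂ) * ∑ d ∈ Finset.Icc 1 Y, χ (d : ZMod q) / d) +
      ∑ m ∈ Finset.Icc 1 Z, ∑ d ∈ Finset.Ioc Y (x / m), χ (d : ZMod q) := by ring
  rw [e5]
  refine (norm_add₃_le).trans ?_
  gcongr
  rw [norm_neg, norm_mul, Complex.norm_natCast]
  calc (x:ℝ) * _ ≤ x * (2 * q / Y) := by gcongr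
    _ = Z * (2 * q) := by rw [hx]; push_cast; field_simp

lemma crt_square (D : ℤ) (m : ℕ) (hm : Squarefree m) (h : ∀ p : ℕ, p.Prime → p ∣ m → ∃ r : ℤ, (p:ℤ) ∣ D - r^2) :
    ∃ r : ℤ, (m:ℤ) ∣ D - r^2 := by
  induction m using Nat.strong_induction_on with
  | _ m ih =>
    rcases eq_or_ne m 1 with rfl | h1
    · exact ⟨0, by simp⟩
    obtain ⟨p, hp, hpm⟩ := Nat.exists_prime_and_dvd h1
    obtain ⟨k, rfl⟩ := hpm
    have hcop := Nat.coprime_of_squarefree_mul hm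
    have hk0 : 0 < k := Nat.pos_of_ne_zero (by rintro rfl; simp at hm)
    obtain ⟨r2, hr2⟩ := ih k (by have := hp.two_le; nlinarith) (hm.of_mul_right) (fun p' hp' hd => h p' hp' (hd.mul_left _))
    obtain ⟨r1, hr1⟩ := h p hp (dvd_mul_right _ _)
    obtain ⟨u, v, huv⟩ := Nat.isCoprime_iff_coprime.2 hcop
    refine ⟨r1 * (v * k) + r2 * (u * p), ?_⟩
    push_cast
    apply IsCoprime.mul_dvd (Nat.isCoprime_iff_coprime.2 hcop)
    · obtain ⟨s, hs⟩ := hr1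
      have hv : v * k = 1 - u * p := by linarith
      rw [hv]
      refine ⟨s + 2 * r1^2 * u - 2*r1*r2*u - p * (r1 * u - r2 * u)^2 , ?_⟩
      have hD : D = p * s + r1^2 := by linarith
      rw [hD]; ring
    · obtain ⟨s, hs⟩ := hr2
      have hv : u * p = 1 - v * k := by linarith
      rw [hv]
      refine ⟨s + 2 * r2^2 * v - 2*r1*r2*v - k * (r1 * v - r2 * v)^2 , ?_⟩
      have hD : D = k * s + r2^2 := by linarith
      rw [hD]; ring

lemma zetaMul_eq {q : ℕ} [NeZero q] (χ : DirichletCharacter ℂ q) (a : ℕ) :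
    χ.zetaMul a = ∑ d ∈ a.divisors, χ (d : ZMod q) := by
  rw [DirichletCharacter.zetaMul, ArithmeticFunction.coe_zeta_mul_apply]
  simp only [toArithmeticFunction, ArithmeticFunction.coe_mk]
  apply Finset.sum_congr rfl
  intro d hd
  rw [if_neg (Nat.pos_of_mem_divisors hd).ne']

lemma zetaMul_ne_zero_prime {q : ℕ} [NeZero q] (χ : DirichletCharacter ℂ q) (a1 k p : ℕ) (ha : k^2 * a1 ≠ 0) (hs : Squarefree a1)
    (hp : p.Prime) (hpa : p ∣ a1) (h : χ.zetaMul (k^2 * a1) ≠ 0) : χ (p : ZMod q) ≠ -1 := by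
  intro hc
  apply h
  have ha1 : a1 ≠ 0 := by rintro rfl; simp at ha
  have hk : k ≠ 0 := by rintro rfl; simp at ha
  have hv : (k^2 * a1).factorization p = 2 * k.factorization p + 1 := by
    rw [Nat.factorization_mul (by positivity) ha1, Nat.factorization_pow]
    have h1 : a1.factorization p = 1 := by
      have h2 := (Nat.squarefree_iff_factorization_le_one ha1).1 hs p
      have h3 := (hp.dvd_iff_one_le_factorization ha1).1 hpa
      omega
    simp [h1]
  rw [χ.isMultiplicative_zetaMul.multiplicative_factorization _ ha, Finsupp.prod]
  apply Finset.prod_eq_zero (i := p)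
  · rw [Finsupp.mem_support_iff, hv]; omega
  rw [hv, zetaMul_eq, Nat.sum_divisors_prime_pow hp]
  have : ∀ i ∈ Finset.range (2 * k.factorization p + 1 + 1), χ ((p^i : ℕ) : ZMod q) = (-1)^i := by
    intro i _
    push_cast
    rw [map_pow, hc]
  rw [Finset.sum_congr rfl this, neg_one_geom_sum, if_pos]
  exact ⟨k.factorization p + 1, by ring⟩

lemma zetaMul_ne_zero_square (D : ℕ) [NeZero D] (a : ℕ) (ha : a ≠ 0) (h : (chiD D).zetaMul a ≠ 0) :
    ∃ k a1 : ℕ, a = k^2 * a1 ∧ ∃ r : ℤ, (a1:ℤ) ∣ (D:ℤ) - r^2 := by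
  obtain ⟨a1, k, hka, hs⟩ := Nat.sq_mul_squarefree a
  refine ⟨k, a1, hka.symm, ?_⟩
  subst hka
  apply crt_square _ _ hs
  intro p hp hpa
  have h1 := zetaMul_ne_zero_prime (chiD D) a1 k p ha hs hp hpa h
  by_cases hc : p.Coprime (4 * D)
  · rw [chiD_apply D p hc] at h1
    haveI := Fact.mk hp
    rw [← jacobiSym.legendreSym.to_jacobiSym] at h1
    have h2 : ((D:ℤ) : ZMod p) ≠ 0 := by
      rw [Int.cast_natCast, Ne, ZMod.natCast_eq_zero_iff]
      intro hd
      have := Nat.Coprime.eq_one_of_dvd hc (hd.mul_left 4)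
      exact hp.one_lt.ne' this
    rcases legendreSym.eq_one_or_neg_one p h2 with h3 | h3
    · rw [legendreSym.eq_one_iff p h2] at h3
      obtain ⟨s, hs⟩ := h3
      refine ⟨s.val, ?_⟩
      rw [← ZMod.intCast_zmod_eq_zero_iff_dvd]
      push_cast
      rw [ZMod.natCast_zmod_val]
      push_cast at hs
      rw [hs]; ring
    · rw [h3] at h1; simp at h1
  · rw [hp.coprime_iff_not_dvd, not_not, hp.dvd_mul] at hc
    rcases hc with hc | hc
    · have : p = 2 := (Nat.prime_dvd_prime_iff_eq hp Nat.prime_two).1 (hp.dvd_of_dvd_pow (show p ∣ 2^2 from hc))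
      subst this
      refine ⟨D, ?_⟩
      push_cast
      have := Int.even_mul_succ_self ((D:ℤ) - 1)
      obtain ⟨t, ht⟩ := this
      exact ⟨-t, by linarith⟩
    · refine ⟨0, ?_⟩
      simpa using (Int.natCast_dvd_natCast.2 hc)


open Classical in
/-- moduli up to x for which n is a square -/
noncomputable def SqA (n x : ℕ) : Finset ℕ := (Finset.Icc 1 x).filter (fun a => ∃ r : ℤ, (a:ℤ) ∣ (n:ℤ) - r^2)

lemma mem_SqA {n x a : ℕ} : a ∈ SqA n x ↔ (1 ≤ a ∧ a ≤ x) ∧ ∃ r : ℤ, (a:ℤ) ∣ (n:ℤ) - r^2 := by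
  simp [SqA]

lemma SqA_mono (D f x : ℕ) : SqA D x ⊆ SqA (f^2 * D) x := by
  intro a ha
  rw [mem_SqA] at ha ⊢
  refine ⟨ha.1, ?_⟩
  obtain ⟨r, s, hs⟩ := ha.2
  refine ⟨f * r, f^2 * s, ?_⟩
  push_cast
  linear_combination (f:ℤ)^2 * hs

lemma tail_sum (K x : ℕ) (hK : 1 ≤ K) : ∑ k ∈ Finset.Ioc K x, (1 / (k:ℝ)^2 : ℝ) ≤ 1 / (K:ℝ) := by
  rcases le_or_gt K x with h | h
  · have : ∑ k ∈ Finset.Ioc K x, (1 / (k:ℝ)^2 : ℝ) ≤ 1 / (K:ℝ) - 1 / (x:ℝ) := by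
      induction x, h using Nat.le_induction with
      | base => simp
      | succ m hm ih =>
        rw [Finset.sum_Ioc_succ_top (by omega)]
        have hm0 : (0:ℝ) < m := by exact_mod_cast (by omega : 0 < m)
        have : 1 / ((m+1:ℕ):ℝ)^2 ≤ 1 / m - 1 / ((m+1:ℕ):ℝ) := by
          push_cast
          rw [div_sub_div _ _ hm0.ne' (by positivity), div_le_div_iff₀ (by positivity) (by positivity)]
          nlinarith
        linarith
    have h0 : (0:ℝ) ≤ 1 / (x:ℝ) := by positivity
    linarith
  · rw [Finset.Ioc_eq_empty (by omega)]; simp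

lemma count_ne_zero (D : ℕ) [NeZero D] (x K : ℕ) (hK : 1 ≤ K) :
    (((Finset.Icc 1 x).filter (fun a => (chiD D).zetaMul a ≠ 0)).card : ℝ) ≤ K * (SqA D x).card + x / K := by
  have hsub : (Finset.Icc 1 x).filter (fun a => (chiD D).zetaMul a ≠ 0) ⊆
      (Finset.Icc 1 K ×ˢ SqA D x).image (fun p => p.1^2 * p.2) ∪
      (Finset.Ioc K x).biUnion (fun k => (Finset.Ioc 0 x).filter (fun a => k^2 ∣ a)) := by
    intro a ha
    rw [Finset.mem_filter, Finset.mem_Icc] at ha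
    obtain ⟨k, a1, rfl, hr⟩ := zetaMul_ne_zero_square D a (by omega) ha.2
    have hk : k ≠ 0 := by rintro rfl; simp at ha
    have ha1 : a1 ≠ 0 := by rintro rfl; simp at ha
    have hk2 : 0 < k^2 := by positivity
    rw [Finset.mem_union]
    by_cases hkK : k ≤ K
    · left
      rw [Finset.mem_image]
      refine ⟨(k, a1), ?_, rfl⟩
      rw [Finset.mem_product, Finset.mem_Icc, mem_SqA]
      refine ⟨⟨by omega, hkK⟩, ⟨by omega, ?_⟩, hr⟩
      exact (Nat.le_mul_of_pos_left _ hk2).trans ha.1.2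
    · right
      rw [Finset.mem_biUnion]
      refine ⟨k, ?_, ?_⟩
      · rw [Finset.mem_Ioc]
        refine ⟨by omega, ?_⟩
        calc k ≤ k^2 := Nat.le_self_pow (by norm_num) _
          _ ≤ k^2 * a1 := Nat.le_mul_of_pos_right _ (by omega)
          _ ≤ x := ha.1.2
      · rw [Finset.mem_filter, Finset.mem_Ioc]
        exact ⟨⟨ha.1.1, ha.1.2⟩, dvd_mul_right _ _⟩
  have h1 := (Finset.card_le_card hsub).trans (Finset.card_union_le _ _)
  have h2 : ((Finset.Icc 1 K ×ˢ SqA D x).image (fun p => p.1^2 * p.2)).card ≤ K * (SqA D x).card := by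
    refine Finset.card_image_le.trans ?_
    rw [Finset.card_product]; simp
  have h3 : (((Finset.Ioc K x).biUnion (fun k => (Finset.Ioc 0 x).filter (fun a => k^2 ∣ a))).card : ℝ) ≤ x / K := by
    calc _ ≤ ((∑ k ∈ Finset.Ioc K x, ((Finset.Ioc 0 x).filter (fun a => k^2 ∣ a)).card : ℕ) : ℝ) := by
          exact_mod_cast Finset.card_biUnion_le
      _ ≤ ∑ k ∈ Finset.Ioc K x, (x:ℝ) * (1 / (k:ℝ)^2) := by
          push_cast
          apply Finset.sum_le_sum
          intro k _
          rw [Nat.Ioc_filter_dvd_card_eq_div]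
          refine Nat.cast_div_le.trans ?_
          push_cast
          rw [mul_one_div]
      _ ≤ x * (1 / K) := by
          rw [← Finset.mul_sum]
          gcongr
          exact tail_sum K x hK
      _ = _ := by ring
  have h4 : (((Finset.Icc 1 x).filter (fun a => (chiD D).zetaMul a ≠ 0)).card : ℝ) ≤
     (((Finset.Icc 1 K ×ˢ SqA D x).image (fun p => p.1^2 * p.2)).card : ℝ) + (((Finset.Ioc K x).biUnion (fun k => (Finset.Ioc 0 x).filter (fun a => k^2 ∣ a))).card : ℝ) := by
    exact_mod_cast h1
  have h5 : (((Finset.Icc 1 K ×ˢ SqA D x).image (fun p => p.1^2 * p.2)).card : ℝ) ≤ K * (SqA D x).card := by exact_mod_cast h2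
  linarith

lemma SqA_lower1 (D : ℕ) [NeZero D] (hD : ¬ IsSquare D) (N K : ℕ) (hN : 1 ≤ N) (hK : 1 ≤ K) (hDN : D ≤ N) (B : ℝ) (hB0 : 0 ≤ B)
    (hB : ∀ m : ℕ, m ≠ 0 → m ≤ N^6 → (m.divisors.card : ℝ) ≤ B) :
    (N:ℝ)^6 * ‖(chiD D).LFunction 1‖ - 17 * (N:ℝ)^4 ≤ B * (K * (SqA D (N^6)).card + (N:ℝ)^6 / K) := by
  have hN3 : 1 ≤ N^3 := Nat.one_le_pow _ _ hN
  have h1 := hyperbola (chiD D) (chiD_ne_one D hD) (N^3) (N^3) hN3 hN3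
  rw [show N^3 * N^3 = N^6 by ring] at h1
  have h2 : ‖∑ a ∈ Finset.Icc 1 (N^6), ∑ d ∈ a.divisors, (chiD D) (d : ZMod (4*D))‖ ≤ B * (K * (SqA D (N^6)).card + (N:ℝ)^6 / K) := by
    calc _ ≤ ∑ a ∈ Finset.Icc 1 (N^6), ‖∑ d ∈ a.divisors, (chiD D) (d : ZMod (4*D))‖ := norm_sum_le _ _
      _ ≤ ∑ a ∈ Finset.Icc 1 (N^6), (if (chiD D).zetaMul a ≠ 0 then B else 0) := by
          apply Finset.sum_le_sum
          intro a ha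
          rw [Finset.mem_Icc] at ha
          rw [← zetaMul_eq]
          split_ifs with hz
          · rw [zetaMul_eq]
            calc _ ≤ ∑ d ∈ a.divisors, ‖(chiD D) (d : ZMod (4*D))‖ := norm_sum_le _ _
              _ ≤ ∑ d ∈ a.divisors, (1:ℝ) := Finset.sum_le_sum (fun d _ => (chiD D).norm_le_one _)
              _ = a.divisors.card := by simp
              _ ≤ B := hB a (by omega) ha.2
          · push Not at hz
            rw [hz]; simp
      _ = B * ((Finset.Icc 1 (N^6)).filter (fun a => (chiD D).zetaMul a ≠ 0)).card := by
          rw [← Finset.sum_filter, Finset.sum_const, nsmul_eq_mul, mul_comm]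
      _ ≤ _ := by
          gcongr
          have := count_ne_zero D (N^6) K hK
          push_cast at this
          exact this
  have h3 : ‖((N^6 : ℕ) : ℂ) * (chiD D).LFunction 1‖ = (N:ℝ)^6 * ‖(chiD D).LFunction 1‖ := by
    rw [norm_mul, Complex.norm_natCast]; push_cast; rfl
  have h4 := norm_sub_norm_le (((N^6 : ℕ) : ℂ) * (chiD D).LFunction 1) (∑ a ∈ Finset.Icc 1 (N^6), ∑ d ∈ a.divisors, (chiD D) (d : ZMod (4*D)))
  rw [norm_sub_rev, h3] at h4
  have h5 : (((N^3:ℕ):ℝ)) * (2 * ((4 * D : ℕ):ℝ)) + ((N^3:ℕ):ℝ) + ((N^3:ℕ):ℝ) * (2 * ((4 * D : ℕ):ℝ)) ≤ 17 * (N:ℝ)^4 := by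
    have : (N^3) * (2 * (4 * D)) + N^3 + N^3 * (2 * (4 * D)) ≤ 17 * N^4 := by
      calc _ ≤ N^3 * (2 * (4 * N)) + N^3 * N + N^3 * (2 * (4 * N)) := by
            gcongr
            exact Nat.le_mul_of_pos_right _ hN
        _ = _ := by ring
    exact_mod_cast this
  linarith

lemma SqA_lower (δ : ℝ) (hδ : 0 < δ) (hδ1 : δ ≤ 1) : ∃ N0 : ℕ, ∀ n : ℕ, N0 ≤ n → ¬ IsSquare n →
    (n:ℝ)^6 * (n:ℝ)^(-6*δ) ≤ ((SqA n (n^6)).card : ℝ) := by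
  obtain ⟨c, hc, hsieg⟩ := siegel δ hδ
  obtain ⟨C, hC, hdiv⟩ := divisor_bound (δ/6) (by positivity)
  have hlim : Filter.Tendsto (fun n : ℕ => (n:ℝ)^δ) Filter.atTop Filter.atTop :=
    (tendsto_rpow_atTop hδ).comp tendsto_natCast_atTop_atTop
  obtain ⟨N0, hN0⟩ := Filter.eventually_atTop.1 ((hlim.eventually_ge_atTop (2 * (17 + C) / c)).and
    ((hlim.eventually_ge_atTop (4 * C / c)).and (Filter.eventually_ge_atTop 1)))
  refine ⟨N0, fun n hn hsq => ?_⟩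
  obtain ⟨hu1, hu2, hn1⟩ := hN0 n hn
  set u : ℝ := (n:ℝ)^δ with hu
  have hn1' : (1:ℝ) ≤ n := by exact_mod_cast hn1
  have hu1' : 1 ≤ u := Real.one_le_rpow hn1' hδ.le
  have hu0 : 0 < u := by linarith
  obtain ⟨D, f, hDf, hDs⟩ := Nat.sq_mul_squarefree n
  have hf0 : f ≠ 0 := by rintro rfl; simp at hDf; omega
  have hD0 : D ≠ 0 := by rintro rfl; simp at hDs
  haveI : NeZero D := ⟨hD0⟩
  have hD2 : 2 ≤ D := by
    by_contra h
    have : D = 1 := by omega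
    subst this
    exact hsq ⟨f, by rw [← hDf]; ring⟩
  have hDn : D ≤ n := by
    rw [← hDf]; exact Nat.le_mul_of_pos_left _ (by positivity)
  have hL := hsieg D hDs hD2
  have hL2 : c * u⁻¹ ≤ ‖(chiD D).LFunction 1‖ := by
    refine le_trans ?_ hL
    rw [Real.rpow_neg (by positivity)]
    have : (D:ℝ)^δ ≤ u := by
      rw [hu]
      exact Real.rpow_le_rpow (by positivity) (by exact_mod_cast hDn) hδ.le
    have hDp : (0:ℝ) < (D:ℝ)^δ := Real.rpow_pos_of_pos (by exact_mod_cast Nat.pos_of_ne_zero hD0) _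
    gcongr
  set K : ℕ := ⌈u^3⌉₊ with hK
  have hK1 : u^3 ≤ K := Nat.le_ceil _
  have hu3 : 1 ≤ u^3 := one_le_pow₀ hu1'
  have hK2 : (K:ℝ) ≤ 2 * u^3 := by
    have := Nat.ceil_lt_add_one (show 0 ≤ u^3 by positivity)
    linarith
  have hK0 : 1 ≤ K := by
    have : (1:ℝ) ≤ K := hu3.trans hK1
    exact_mod_cast this
  have hB : ∀ m : ℕ, m ≠ 0 → m ≤ n^6 → (m.divisors.card : ℝ) ≤ C * u := by
    intro m hm hmn
    refine (hdiv m hm).trans ?_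
    have : u = (((n^6 : ℕ)):ℝ)^(δ/6) := by
      push_cast
      rw [← Real.rpow_natCast, ← Real.rpow_mul (by positivity), hu]
      congr 1; push_cast; ring
    rw [this]
    gcongr
  have h := SqA_lower1 D (not_isSquare_of_squarefree hDs hD2) n K hn1 hK0 hDn (C * u) (by positivity) hB
  have hmono : ((SqA D (n^6)).card : ℝ) ≤ (SqA n (n^6)).card := by
    have h1 := SqA_mono D f (n^6)
    rw [hDf] at h1
    exact_mod_cast Finset.card_le_card h1
  set S : ℝ := ((SqA n (n^6)).card : ℝ) with hS
  set x : ℝ := (n:ℝ)^6 with hx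
  have hx0 : 0 < x := by positivity
  have h17 : (n:ℝ)^4 ≤ x / u^2 := by
    rw [le_div_iff₀ (by positivity)]
    have : u ≤ n := by
      calc u ≤ (n:ℝ)^(1:ℝ) := Real.rpow_le_rpow_of_exponent_le hn1' hδ1
        _ = n := Real.rpow_one _
    calc (n:ℝ)^4 * u^2 ≤ (n:ℝ)^4 * (n:ℝ)^2 := by gcongr
      _ = x := by rw [hx]; ring
  have h2 : x * (c * u⁻¹) - 17 * (x / u^2) ≤ C * u * (2 * u^3 * S + x / u^3) := by
    calc _ ≤ x * ‖(chiD D).LFunction 1‖ - 17 * (n:ℝ)^4 := by gcongr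
      _ ≤ _ := h
      _ ≤ _ := by gcongr
  have h3 : x * c / u - 17 * x / u^2 ≤ 2 * C * u^4 * S + C * x / u^2 := by
    calc _ = x * (c * u⁻¹) - 17 * (x / u^2) := by ring
      _ ≤ _ := h2
      _ = _ := by field_simp
  rw [div_le_iff₀ hc] at hu1 hu2
  have h4 : (17 + C) * x / u^2 ≤ x * c / (2 * u) := by
    rw [div_le_div_iff₀ (by positivity) (by positivity)]
    have : (x * u) * (2 * (17 + C)) ≤ (x * u) * (u * c) := by gcongr
    linarith
  have h5 : x * c / (2 * u) ≤ 2 * C * u^4 * S := by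
    have e1 : (17 + C) * x / u^2 = 17 * x / u^2 + C * x / u^2 := by ring
    have e2 : x * c / u = x * c / (2 * u) + x * c / (2*u) := by field_simp; ring
    linarith
  have h6 : (n:ℝ)^(-6*δ) = (u^6)⁻¹ := by
    rw [show -6*δ = -(δ * (6:ℕ)) by push_cast; ring, Real.rpow_neg (by positivity), Real.rpow_mul (by positivity), Real.rpow_natCast]
  rw [h6, ← div_eq_mul_inv, div_le_iff₀ (by positivity)]
  rw [div_le_iff₀ (by positivity)] at h5
  have h7 : x * (4 * C) ≤ x * (u * c) := by gcongr
  have h8 : 4 * C * x ≤ 4 * C * (S * u^6) := by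
    calc 4 * C * x = x * (4 * C) := by ring
      _ ≤ u * (x * c) := by linarith
      _ ≤ u * (2 * C * u^4 * S * (2 * u)) := by gcongr
      _ = _ := by ring
  exact le_of_mul_le_mul_left h8 (by positivity)


lemma cs_cells (A : Finset ℕ) (g : ℕ → ℤ) :
    ((A.card : ℝ))^2 ≤ ((A.image g).card : ℝ) * (A.card + (((A ×ˢ A).filter (fun p => p.1 ≠ p.2 ∧ g p.1 = g p.2)).card : ℝ)) := by
  have h1 : A.card = ∑ c ∈ A.image g, (A.filter (fun a => g a = c)).card :=
    Finset.card_eq_sum_card_image g A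
  have h2 := sq_sum_le_card_mul_sum_sq (s := A.image g) (f := fun c => (A.filter (fun a => g a = c)).card)
  rw [← h1] at h2
  have h3 : ∑ c ∈ A.image g, (A.filter (fun a => g a = c)).card^2 = ((A ×ˢ A).filter (fun p => g p.1 = g p.2)).card := by
    rw [Finset.card_eq_sum_card_fiberwise (f := fun p => g p.1) (t := A.image g)]
    · apply Finset.sum_congr rfl
      intro c hc
      rw [pow_two, ← Finset.card_product]
      congr 1
      ext ⟨p, q⟩
      simp only [Finset.mem_product, Finset.mem_filter]
      constructor
      · rintro ⟨⟨h1, h2⟩, h3, h4⟩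
        exact ⟨⟨⟨h1, h3⟩, by rw [h2, h4]⟩, h2⟩
      · rintro ⟨⟨⟨h1, h3⟩, h4⟩, h2⟩
        exact ⟨⟨h1, h2⟩, h3, by rw [← h4, h2]⟩
    · intro p hp
      have hp : p ∈ (A ×ˢ A).filter (fun p => g p.1 = g p.2) := hp
      rw [Finset.mem_filter, Finset.mem_product] at hp
      exact Finset.mem_image_of_mem g hp.1.1
  have h4 : ((A ×ˢ A).filter (fun p => g p.1 = g p.2)).card ≤
      A.card + ((A ×ˢ A).filter (fun p => p.1 ≠ p.2 ∧ g p.1 = g p.2)).card := by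
    have hs : (A ×ˢ A).filter (fun p => g p.1 = g p.2) ⊆
        A.image (fun a => (a, a)) ∪ (A ×ˢ A).filter (fun p => p.1 ≠ p.2 ∧ g p.1 = g p.2) := by
      rintro ⟨p, q⟩ hp
      rw [Finset.mem_filter, Finset.mem_product] at hp
      rw [Finset.mem_union, Finset.mem_image, Finset.mem_filter, Finset.mem_product]
      by_cases hpq : p = q
      · left; exact ⟨p, hp.1.1, by rw [hpq]⟩
      · right; exact ⟨hp.1, hpq, hp.2⟩
    refine (Finset.card_le_card hs).trans ((Finset.card_union_le _ _).trans ?_)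
    gcongr
    exact Finset.card_image_le
  rw [h3] at h2
  have h5 := h2.trans (Nat.mul_le_mul_left _ h4)
  exact_mod_cast h5

lemma choose_y (n : ℕ) (hsq : ¬ IsSquare n) (a : ℕ) (ha : 1 ≤ a) (h : ∃ r : ℤ, (a:ℤ) ∣ (n:ℤ) - r^2) :
    ∃ y b : ℤ, y^2 + a * b = n ∧ 0 < (√(n:ℝ) - y)/a ∧ (√(n:ℝ) - y)/a < 1 ∧ Irrational ((√(n:ℝ) - y)/a) := by
  obtain ⟨r, s, hs⟩ := h
  have ha0 : (0:ℝ) < a := by exact_mod_cast ha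
  set k : ℤ := ⌊(√(n:ℝ) - r)/a⌋ with hk
  have hw : (√(n:ℝ) - ((r + a * k : ℤ):ℝ))/a = (√(n:ℝ) - r)/a - k := by
    push_cast; field_simp; ring
  have hirr : Irrational ((√(n:ℝ) - ((r + a * k : ℤ):ℝ))/a) := by
    have h1 : Irrational (√(n:ℝ)) := irrational_sqrt_natCast_iff.2 hsq
    exact (h1.sub_intCast _).div_natCast (by omega)
  refine ⟨r + a * k, s - 2 * r * k - a * k^2, ?_, ?_, ?_, hirr⟩
  · linear_combination -hs
  · apply lt_of_le_of_ne
    · rw [hw]; linarith [Int.floor_le ((√(n:ℝ) - r)/a)]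
    · exact hirr.ne_zero.symm
  · rw [hw]; linarith [Int.lt_floor_add_one ((√(n:ℝ) - r)/a)]

lemma main_ineq : ∃ C : ℝ, 0 < C ∧ ∀ n : ℕ, 4 ≤ n → ¬ IsSquare n →
    (¬ ∃ x y z : ℤ, (n:ℤ) = x^2+y^2-z^2 ∧ x^2 ≤ n ∧ y^2 ≤ n ∧ z^2 ≤ n) →
    ((SqA n (n^6)).card : ℝ)^2 ≤ C * (n:ℝ)^(11.98:ℝ) := by
  obtain ⟨C, hC, hdiv⟩ := divisor_bound 0.0001 (by norm_num)
  refine ⟨12000 * (1 + 240 * (42 * C)^6 * (8 * 10000)), by positivity, fun n hn hsq hns => ?_⟩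
  have hn1 : (4:ℝ) ≤ n := by exact_mod_cast hn
  have hn0 : (0:ℝ) < n := by linarith
  have hch : ∀ a : ℕ, ∃ yb : ℤ × ℤ, a ∈ SqA n (n^6) → yb.1^2 + a * yb.2 = n ∧ 0 < (√(n:ℝ) - yb.1)/a ∧ (√(n:ℝ) - yb.1)/a < 1 ∧ Irrational ((√(n:ℝ) - yb.1)/a) := by
    intro a
    by_cases ha : a ∈ SqA n (n^6)
    · have ha' := mem_SqA.1 ha
      obtain ⟨y, b, h⟩ := choose_y n hsq a ha'.1.1 ha'.2
      exact ⟨(y, b), fun _ => h⟩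
    · exact ⟨(0,0), fun h => absurd h ha⟩
  choose yb hyb using hch
  set A := SqA n (n^6) with hA
  set w : ℕ → ℝ := fun a => (√(n:ℝ) - (yb a).1)/a with hw
  have hAA : ∀ a ∈ A, 1 ≤ a ∧ a ≤ (n^3)^2 ∧ (yb a).1 ^ 2 + a * (yb a).2 = n ∧ w a = (√(n:ℝ) - (yb a).1)/a := by
    intro a ha
    have ha' := mem_SqA.1 ha
    refine ⟨ha'.1.1, ?_, (hyb a ha).1, rfl⟩
    rw [← pow_mul]; exact ha'.1.2
  set R : ℕ := ⌈(n:ℝ)^(2.75:ℝ)⌉₊ with hR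
  have hR1 : (n:ℝ)^(2.75:ℝ) ≤ R := Nat.le_ceil _
  have hnn : (n:ℝ) ≤ (n:ℝ)^(2.75:ℝ) := by
    calc (n:ℝ) = (n:ℝ)^(1:ℝ) := (Real.rpow_one _).symm
      _ ≤ _ := Real.rpow_le_rpow_of_exponent_le (by linarith) (by norm_num)
  have hR2 : (R:ℝ) ≤ 2 * (n:ℝ)^(2.75:ℝ) := by
    have := Nat.ceil_lt_add_one (show 0 ≤ (n:ℝ)^(2.75:ℝ) by positivity)
    rw [← hR] at this
    linarith
  have hRX : R ≤ n^3 := by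
    rw [hR, Nat.ceil_le]
    push_cast
    rw [← Real.rpow_natCast]
    exact Real.rpow_le_rpow_of_exponent_le (by linarith) (by norm_num)
  have hR4 : 2 ≤ R := by
    have : (2:ℝ) ≤ R := by linarith
    exact_mod_cast this
  have hRsq : (((n^3:ℕ)):ℝ)^2 ≤ √(n:ℝ) * R^2 := by
    calc (((n^3:ℕ)):ℝ)^2 = √(n:ℝ) * ((n:ℝ)^(2.75:ℝ))^2 := by
          rw [Real.sqrt_eq_rpow, ← Real.rpow_natCast ((n:ℝ)^(2.75:ℝ)), ← Real.rpow_mul hn0.le, ← Real.rpow_add hn0]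
          push_cast
          rw [← pow_mul, ← Real.rpow_natCast]
          norm_num
      _ ≤ _ := by gcongr
  have hpar := parH_of_noSol n A w (fun a => (yb a).2) (fun a => (yb a).1) R (n^3) hns hAA (by omega) hRsq
  have hcov := cover_bound A w (fun a => (yb a).2) R (n^3) hpar hRX hR4 (fun a ha => (hyb a ha).2)
  have hcells : cells w (n^3) A ≤ 12000 * (n:ℝ)^(5.975:ℝ) := by
    refine hcov.trans ?_
    have e1 : (((n^3:ℕ)):ℝ)^(1.9:ℝ) = (n:ℝ)^(5.7:ℝ) := by
      push_cast
      rw [← Real.rpow_natCast, ← Real.rpow_mul hn0.le]; norm_num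
    have e2 : (R:ℝ)^(0.1:ℝ) ≤ 2 * (n:ℝ)^(0.275:ℝ) := by
      calc (R:ℝ)^(0.1:ℝ) ≤ (2 * (n:ℝ)^(2.75:ℝ))^(0.1:ℝ) := by gcongr
        _ = 2^(0.1:ℝ) * (n:ℝ)^(0.275:ℝ) := by
            rw [Real.mul_rpow (by norm_num) (by positivity), ← Real.rpow_mul hn0.le]; norm_num
        _ ≤ 2^(1:ℝ) * (n:ℝ)^(0.275:ℝ) := by
            gcongr
            · norm_num
            · norm_num
        _ = _ := by rw [Real.rpow_one]
    rw [e1]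
    calc 6000 * (n:ℝ)^(5.7:ℝ) * (R:ℝ)^(0.1:ℝ) ≤ 6000 * (n:ℝ)^(5.7:ℝ) * (2 * (n:ℝ)^(0.275:ℝ)) := by gcongr
      _ = 12000 * ((n:ℝ)^(5.7:ℝ) * (n:ℝ)^(0.275:ℝ)) := by ring
      _ = _ := by rw [← Real.rpow_add hn0]; norm_num
  set T : ℕ := ⌊C * ((42 * n^2 : ℕ):ℝ)^(0.0001:ℝ)⌋₊ with hT
  have hTT : ∀ m : ℕ, m ≠ 0 → m ≤ 42 * n^2 → m.divisors.card ≤ T := by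
    intro m hm hmn
    apply Nat.le_floor
    refine (hdiv m hm).trans ?_
    gcongr
  have hTle : (T:ℝ) ≤ 42 * C * (n:ℝ)^(0.0002:ℝ) := by
    refine (Nat.floor_le (by positivity)).trans ?_
    push_cast
    rw [Real.mul_rpow (by norm_num) (by positivity), ← Real.rpow_natCast, ← Real.rpow_mul hn0.le]
    have h42 : (42:ℝ)^(0.0001:ℝ) ≤ 42 := by
      calc (42:ℝ)^(0.0001:ℝ) ≤ (42:ℝ)^(1:ℝ) := Real.rpow_le_rpow_of_exponent_le (by norm_num) (by norm_num)
        _ = _ := Real.rpow_one _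
    have e : (((2:ℕ):ℝ) * 0.0001) = 0.0002 := by norm_num
    rw [e]
    calc C * ((42:ℝ)^(0.0001:ℝ) * (n:ℝ)^(0.0002:ℝ)) ≤ C * (42 * (n:ℝ)^(0.0002:ℝ)) := by gcongr
      _ = _ := by ring
  have hsq2 : 2 ≤ √(n:ℝ) := by
    apply Real.le_sqrt_of_sq_le; linarith
  have hsqn : √(n:ℝ) ≤ n := by
    rw [Real.sqrt_le_left hn0.le]; nlinarith
  have hsX : √(n:ℝ) ≤ ((n^3:ℕ):ℝ)^2 := by
    refine hsqn.trans ?_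
    push_cast
    rw [← pow_mul]
    exact le_self_pow₀ (by linarith) (by norm_num)
  have hpairs := pairs_bound n (n^3) A w (fun a => (yb a).1) (fun a => (yb a).2) T hsq2 hsq hsX hAA hTT
  have hlog : Real.log (3 * √(n:ℝ) * ((n^3:ℕ):ℝ)^2) ≤ 8 * 10000 * (n:ℝ)^(0.0001:ℝ) := by
    have h1 : 3 * √(n:ℝ) * ((n^3:ℕ):ℝ)^2 ≤ (n:ℝ)^8 := by
      push_cast
      calc 3 * √(n:ℝ) * ((n:ℝ)^3)^2 ≤ n * n * ((n:ℝ)^3)^2 := by gcongr; linarith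
        _ = _ := by ring
    have h2 := Real.log_le_log (by positivity) h1
    rw [Real.log_pow] at h2
    have h3 := Real.log_le_rpow_div hn0.le (show (0:ℝ) < 0.0001 by norm_num)
    have e : (n:ℝ)^(0.0001:ℝ) / 0.0001 = 10000 * (n:ℝ)^(0.0001:ℝ) := by norm_num; ring
    rw [e] at h3
    push_cast at h2
    push_cast
    linarith
  have hX2 : (((n^3:ℕ)):ℝ)^2 = (n:ℝ)^(6:ℝ) := by
    push_cast
    rw [← pow_mul, ← Real.rpow_natCast]; norm_num
  have hT6 : (T:ℝ)^6 ≤ (42 * C)^6 * (n:ℝ)^(0.0012:ℝ) := by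
    calc (T:ℝ)^6 ≤ (42 * C * (n:ℝ)^(0.0002:ℝ))^6 := by gcongr
      _ = _ := by rw [mul_pow, ← Real.rpow_natCast ((n:ℝ)^(0.0002:ℝ)), ← Real.rpow_mul hn0.le]; norm_num
  have hp2 : (((A ×ˢ A).filter (fun p => p.1 ≠ p.2 ∧ ⌊w p.1 * (((n^3:ℕ)):ℝ)^2⌋ = ⌊w p.2 * (((n^3:ℕ)):ℝ)^2⌋)).card : ℝ)
      ≤ 240 * (42 * C)^6 * (8 * 10000) * (n:ℝ)^(6.0013:ℝ) := by
    refine hpairs.trans ?_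
    rw [hX2] at hlog ⊢
    calc 240 * (T:ℝ)^6 * (n:ℝ)^(6:ℝ) * Real.log (3 * √(n:ℝ) * (n:ℝ)^(6:ℝ))
        ≤ 240 * (T:ℝ)^6 * (n:ℝ)^(6:ℝ) * (8 * 10000 * (n:ℝ)^(0.0001:ℝ)) := mul_le_mul_of_nonneg_left hlog (by positivity)
      _ ≤ 240 * ((42 * C)^6 * (n:ℝ)^(0.0012:ℝ)) * (n:ℝ)^(6:ℝ) * (8 * 10000 * (n:ℝ)^(0.0001:ℝ)) := by gcongr
      _ = 240 * (42 * C)^6 * (8 * 10000) * ((n:ℝ)^(0.0012:ℝ) * (n:ℝ)^(6:ℝ) * (n:ℝ)^(0.0001:ℝ)) := by ring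
      _ = _ := by rw [← Real.rpow_add hn0, ← Real.rpow_add hn0]; norm_num
  have hAc : (A.card : ℝ) ≤ (n:ℝ)^(6.0013:ℝ) := by
    have h1 : A.card ≤ n^6 := by
      have h2 : A ⊆ Finset.Icc 1 (n^6) := fun a ha => by
        rw [Finset.mem_Icc]; exact (mem_SqA.1 ha).1
      have := Finset.card_le_card h2
      simpa using this
    calc (A.card : ℝ) ≤ ((n^6 : ℕ) : ℝ) := by exact_mod_cast h1
      _ = (n:ℝ)^(6:ℝ) := by push_cast; rw [← Real.rpow_natCast]; norm_num
      _ ≤ _ := Real.rpow_le_rpow_of_exponent_le (by linarith) (by norm_num)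
  have hcs := cs_cells A (fun a => ⌊w a * (((n^3:ℕ)):ℝ)^2⌋)
  have hcells' : ((A.image (fun a => ⌊w a * (((n^3:ℕ)):ℝ)^2⌋)).card : ℝ) ≤ 12000 * (n:ℝ)^(5.975:ℝ) := hcells
  calc (A.card : ℝ)^2 ≤ _ := hcs
    _ ≤ 12000 * (n:ℝ)^(5.975:ℝ) * ((n:ℝ)^(6.0013:ℝ) + 240 * (42 * C)^6 * (8 * 10000) * (n:ℝ)^(6.0013:ℝ)) := by
        apply mul_le_mul hcells' (add_le_add hAc hp2) (by positivity) (by positivity)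
    _ = 12000 * (1 + 240 * (42 * C)^6 * (8 * 10000)) * ((n:ℝ)^(5.975:ℝ) * (n:ℝ)^(6.0013:ℝ)) := by ring
    _ = 12000 * (1 + 240 * (42 * C)^6 * (8 * 10000)) * (n:ℝ)^(11.9763:ℝ) := by
        rw [← Real.rpow_add hn0]; norm_num
    _ ≤ _ := by
        gcongr
        · linarith
        · norm_num

theorem erdos_1148 :
    ∃ N : ℕ, ∀ n : ℤ, (N : ℤ) ≤ n →
      ∃ x y z : ℤ, n = x ^ 2 + y ^ 2 - z ^ 2 ∧
        max (x ^ 2) (max (y ^ 2) (z ^ 2)) ≤ n := by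
  obtain ⟨C, hC, hmain⟩ := main_ineq
  obtain ⟨N0, hlow⟩ := SqA_lower 0.001 (by norm_num) (by norm_num)
  have hlim : Filter.Tendsto (fun n : ℕ => (n:ℝ)^(0.008:ℝ)) Filter.atTop Filter.atTop :=
    (tendsto_rpow_atTop (by norm_num)).comp tendsto_natCast_atTop_atTop
  obtain ⟨N1, hN1⟩ := Filter.eventually_atTop.1 (hlim.eventually_gt_atTop C)
  refine ⟨max 4 (max N0 N1), fun n hn => ?_⟩
  lift n to ℕ using by omega
  have hn' : max 4 (max N0 N1) ≤ n := by exact_mod_cast hn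
  have h4 : 4 ≤ n := by omega
  by_cases hsq : IsSquare n
  · obtain ⟨r, rfl⟩ := hsq
    refine ⟨r, 0, 0, by push_cast; ring, ?_⟩
    have h0 : (0:ℤ) ≤ (r:ℤ) * r := by positivity
    push_cast
    refine max_le ?_ (max_le ?_ ?_)
    · rw [pow_two]
    · simpa using h0
    · simpa using h0
  by_contra hcon
  have hns : ¬ ∃ x y z : ℤ, (n:ℤ) = x^2+y^2-z^2 ∧ x^2 ≤ n ∧ y^2 ≤ n ∧ z^2 ≤ n := by
    rintro ⟨x, y, z, h1, h2, h3, h4⟩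
    exact hcon ⟨x, y, z, h1, max_le h2 (max_le h3 h4)⟩
  have h1 := hmain n h4 hsq hns
  have h2 := hlow n (by omega) hsq
  have h3 := hN1 n (by omega)
  have hn0 : (0:ℝ) < n := by exact_mod_cast (by omega : 0 < n)
  have e1 : (n:ℝ)^6 * (n:ℝ)^(-6*(0.001:ℝ)) = (n:ℝ)^(5.994:ℝ) := by
    rw [← Real.rpow_natCast, ← Real.rpow_add hn0]; norm_num
  rw [e1] at h2
  have h5 : (n:ℝ)^(11.988:ℝ) ≤ C * (n:ℝ)^(11.98:ℝ) := by
    calc (n:ℝ)^(11.988:ℝ) = ((n:ℝ)^(5.994:ℝ))^2 := by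
          rw [← Real.rpow_natCast, ← Real.rpow_mul hn0.le]; norm_num
      _ ≤ ((SqA n (n^6)).card : ℝ)^2 := by gcongr
      _ ≤ _ := h1
  have e2 : (n:ℝ)^(11.988:ℝ) = (n:ℝ)^(0.008:ℝ) * (n:ℝ)^(11.98:ℝ) := by
    rw [← Real.rpow_add hn0]; norm_num
  rw [e2] at h5
  have h6 := le_of_mul_le_mul_right h5 (by positivity)
  linarith
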